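/- Let n, n' ≥ 2, and let f, g : Matrix (Fin n) (Fin n) ℂ → Matrix (Fin n') (Fin n') ℂ be holomorphic polynomial maps that map Ω^II_n into Ω^II_{n'}, whose restrictions Ω^II_n → Ω^II_{n'} are proper, and which satisfy f(0) = g(0) = 0. Then there exist automorphisms τ of Ω^II_n and σ of Ω^II_{n'} with f = σ ∘ g ∘ τ on Ω^II_n if and only if there exist such automorphisms additionally satisfying τ(0) = 0 and σ(0) = 0. -/

import Mathlib

open Matrix
open scoped ComplexOrder

noncomputable section

attribute [local instance] Matrix.normedAddCommGroup Matrix.normedSpace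

/-- The type II classical bounded symmetric domain `Ω^II_n` of antisymmetric matrices. -/
def OmegaII (n : ℕ) : Set (Matrix (Fin n) (Fin n) ℂ) :=
  {Z | Zᵀ = -Z ∧ (1 - Z * Zᴴ).PosDef}

/-- `f` is a holomorphic polynomial map between complex matrix spaces. -/
def IsPolyMapII {n n' : ℕ}
    (f : Matrix (Fin n) (Fin n) ℂ → Matrix (Fin n') (Fin n') ℂ) : Prop :=
  ∀ i j, ∃ p : MvPolynomial (Fin n × Fin n) ℂ,
    ∀ Z, f Z i j = MvPolynomial.eval (fun q => Z q.1 q.2) p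

/-- Properness of the restriction `Ω₁ → Ω₂`. -/
def IsProperOn {E F : Type*} [TopologicalSpace E] [TopologicalSpace F]
    (f : E → F) (Ω₁ : Set E) (Ω₂ : Set F) : Prop :=
  ∀ K : Set F, K ⊆ Ω₂ → IsCompact K → IsCompact (Ω₁ ∩ f ⁻¹' K)

/-- `τ` is an automorphism of the domain `Ω`: a holomorphic bijection of `Ω` onto itself
with holomorphic inverse. -/
def IsAutomorphismOf {E : Type*} [NormedAddCommGroup E] [NormedSpace ℂ E]
    (Ω : Set E) (τ : E → E) : Prop :=
  Set.MapsTo τ Ω Ω ∧ DifferentiableOn ℂ τ Ω ∧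
    ∃ τinv : E → E, Set.MapsTo τinv Ω Ω ∧ DifferentiableOn ℂ τinv Ω ∧
      (∀ z ∈ Ω, τinv (τ z) = z) ∧ (∀ z ∈ Ω, τ (τinv z) = z)

set_option linter.unusedSectionVars false

namespace TypeII

section OperatorNorm

variable {ι : Type*} [Fintype ι] [DecidableEq ι]

/-- The Euclidean operator norm of a square complex matrix. -/
def opn (Z : Matrix ι ι ℂ) : ℝ := ‖Matrix.toEuclideanCLM (𝕜 := ℂ) (n := ι) Z‖

/-- The squared Euclidean norm of a complex vector. -/
def nsq (v : ι → ℂ) : ℝ := ‖WithLp.toLp 2 v‖ ^ 2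

lemma nsq_nonneg (v : ι → ℂ) : 0 ≤ nsq v := sq_nonneg _

lemma nsq_coe (v : ι → ℂ) : ((nsq v : ℝ) : ℂ) = star v ⬝ᵥ v := by
  have h := inner_self_eq_norm_sq_to_K (𝕜 := ℂ) (WithLp.toLp 2 v)
  rw [EuclideanSpace.inner_toLp_toLp, dotProduct_comm] at h
  rw [h, nsq]
  push_cast
  rfl

lemma nsq_eq_zero {v : ι → ℂ} : nsq v = 0 ↔ v = 0 := by
  rw [nsq]
  simp

lemma nsq_pos {v : ι → ℂ} (hv : v ≠ 0) : 0 < nsq v :=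
  lt_of_le_of_ne (nsq_nonneg v) (fun h => hv (nsq_eq_zero.1 h.symm))

lemma nsq_smul (c : ℂ) (v : ι → ℂ) : nsq (c • v) = ‖c‖ ^ 2 * nsq v := by
  rw [nsq, WithLp.toLp_smul, norm_smul, mul_pow, nsq]

lemma opn_nonneg (Z : Matrix ι ι ℂ) : 0 ≤ opn Z := norm_nonneg _

lemma nsq_mulVec_le (Z : Matrix ι ι ℂ) (v : ι → ℂ) : nsq (Z *ᵥ v) ≤ opn Z ^ 2 * nsq v := by
  rw [nsq, nsq, ← mul_pow, ← Matrix.toEuclideanCLM_toLp]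
  gcongr
  exact ContinuousLinearMap.le_opNorm _ _

lemma opn_le {Z : Matrix ι ι ℂ} {c : ℝ} (hc : 0 ≤ c)
    (h : ∀ v, nsq (Z *ᵥ v) ≤ c ^ 2 * nsq v) : opn Z ≤ c := by
  refine ContinuousLinearMap.opNorm_le_bound _ hc fun x => ?_
  have := h (WithLp.ofLp x)
  rw [nsq, nsq, ← Matrix.toEuclideanCLM_toLp, ← mul_pow] at this
  exact (sq_le_sq₀ (norm_nonneg _) (by positivity)).1 this

lemma opn_zero : opn (0 : Matrix ι ι ℂ) = 0 := by simp [opn]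

lemma opn_eq_zero {Z : Matrix ι ι ℂ} (h : opn Z = 0) : Z = 0 := by
  simpa [opn] using h

lemma opn_smul (c : ℂ) (Z : Matrix ι ι ℂ) : opn (c • Z) = ‖c‖ * opn Z := by
  rw [opn, map_smul, norm_smul, opn]

lemma opn_gram (Z : Matrix ι ι ℂ) : opn (Zᴴ * Z) = opn Z ^ 2 := by
  rw [opn, map_mul, ← Matrix.star_eq_conjTranspose, map_star, opn, sq]
  exact ContinuousLinearMap.norm_adjoint_comp_self _

lemma norm_entry_le_opn (Z : Matrix ι ι ℂ) (i j : ι) : ‖Z i j‖ ≤ opn Z := by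
  have h1 := nsq_mulVec_le Z (Pi.single j 1)
  have h2 : nsq (Pi.single j (1 : ℂ)) = 1 := by
    rw [nsq, EuclideanSpace.norm_sq_eq]
    simp [Pi.single_apply, apply_ite]
  have h3 : ‖Z i j‖ ^ 2 ≤ nsq (Z *ᵥ Pi.single j 1) := by
    rw [nsq, EuclideanSpace.norm_sq_eq]
    have := Finset.single_le_sum (f := fun k => ‖(Z *ᵥ Pi.single j 1) k‖ ^ 2)
      (fun k _ => by positivity) (Finset.mem_univ i)
    simpa using this
  rw [h2, mul_one] at h1
  exact (sq_le_sq₀ (norm_nonneg _) (opn_nonneg Z)).1 (h3.trans h1)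

lemma star_dotProduct_gram (Z : Matrix ι ι ℂ) (v : ι → ℂ) :
    star v ⬝ᵥ ((Zᴴ * Z) *ᵥ v) = ((nsq (Z *ᵥ v) : ℝ) : ℂ) := by
  rw [nsq_coe, ← Matrix.mulVec_mulVec, Matrix.star_mulVec, Matrix.dotProduct_mulVec]

lemma star_dotProduct_sub_gram (r : ℝ) (Z : Matrix ι ι ℂ) (v : ι → ℂ) :
    star v ⬝ᵥ (((r : ℂ) • (1 : Matrix ι ι ℂ) - Zᴴ * Z) *ᵥ v) =
      ((r * nsq v - nsq (Z *ᵥ v) : ℝ) : ℂ) := by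
  rw [Matrix.sub_mulVec, dotProduct_sub, star_dotProduct_gram, Matrix.smul_mulVec,
    Matrix.one_mulVec, dotProduct_smul, ← nsq_coe]
  push_cast
  simp

lemma isHermitian_sub_gram (r : ℝ) (Z : Matrix ι ι ℂ) :
    ((r : ℂ) • (1 : Matrix ι ι ℂ) - Zᴴ * Z).IsHermitian := by
  rw [Matrix.IsHermitian, conjTranspose_sub, conjTranspose_smul, conjTranspose_mul]
  simp

lemma opn_le_iff_posSemidef {Z : Matrix ι ι ℂ} {c : ℝ} (hc : 0 ≤ c) :
    opn Z ≤ c ↔ (((c ^ 2 : ℝ) : ℂ) • (1 : Matrix ι ι ℂ) - Zᴴ * Z).PosSemidef := by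
  constructor
  · intro h
    refine Matrix.PosSemidef.of_dotProduct_mulVec_nonneg (isHermitian_sub_gram _ _) fun v => ?_
    rw [star_dotProduct_sub_gram, Complex.zero_le_real, sub_nonneg]
    refine (nsq_mulVec_le Z v).trans ?_
    have := nsq_nonneg v
    have := opn_nonneg Z
    gcongr
  · intro h
    refine opn_le hc fun v => ?_
    have := h.dotProduct_mulVec_nonneg v
    rwa [star_dotProduct_sub_gram, Complex.zero_le_real, sub_nonneg] at this

lemma opn_lt_one_iff_posDef {Z : Matrix ι ι ℂ} : opn Z < 1 ↔ (1 - Zᴴ * Z).PosDef := by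
  have e1 : (1 : Matrix ι ι ℂ) = ((1 : ℝ) : ℂ) • 1 := by simp
  constructor
  · intro h
    rw [e1]
    refine Matrix.PosDef.of_dotProduct_mulVec_pos (isHermitian_sub_gram _ _) fun v hv => ?_
    rw [star_dotProduct_sub_gram, Complex.zero_lt_real, sub_pos, one_mul]
    refine (nsq_mulVec_le Z v).trans_lt ?_
    have h1 := nsq_pos hv
    have h2 := opn_nonneg Z
    have : opn Z ^ 2 < 1 := by nlinarith
    nlinarith
  · intro h
    rw [e1] at h
    have key : ∀ v, v ≠ 0 → nsq (Z *ᵥ v) < nsq v := by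
      intro v hv
      have := h.dotProduct_mulVec_pos hv
      rwa [star_dotProduct_sub_gram, Complex.zero_lt_real, sub_pos, one_mul] at this
    rcases isEmpty_or_nonempty ι with hι | hι
    · have : Z = 0 := by ext i; exact isEmptyElim i
      rw [this, opn_zero]; exact one_pos
    obtain ⟨v, hv, hmax⟩ := (isCompact_sphere (0 : EuclideanSpace ℂ ι) 1).exists_isMaxOn
      (NormedSpace.sphere_nonempty.2 zero_le_one)
      (f := fun x => ‖Matrix.toEuclideanCLM (𝕜 := ℂ) (n := ι) Z x‖) (by fun_prop)
    have hv1 : ‖v‖ = 1 := by simpa using hv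
    set C := ‖Matrix.toEuclideanCLM (𝕜 := ℂ) (n := ι) Z v‖ with hC
    have hC1 : C < 1 := by
      have h1 := key (WithLp.ofLp v) (by
        intro h0
        have : v = 0 := by
          rw [← WithLp.toLp_ofLp (p := 2) v, h0]; simp
        rw [this] at hv1; simp at hv1)
      rw [nsq, nsq, ← Matrix.toEuclideanCLM_toLp] at h1
      have h2 := lt_of_pow_lt_pow_left₀ 2 (norm_nonneg _) h1
      simp only [WithLp.toLp_ofLp] at h2
      rwa [hv1] at h2
    refine lt_of_le_of_lt ?_ hC1
    refine ContinuousLinearMap.opNorm_le_bound _ (norm_nonneg _) fun x => ?_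
    rcases eq_or_ne x 0 with rfl | hx
    · simp
    have hx' : ‖x‖ ≠ 0 := by simpa using hx
    have hm := hmax (show ((‖x‖ : ℂ)⁻¹ • x) ∈ Metric.sphere (0 : EuclideanSpace ℂ ι) 1 by
      simp [norm_smul, hx'])
    simp only [Set.mem_ofPred_eq, map_smul, norm_smul, norm_inv, Complex.norm_real,
      norm_norm] at hm
    rw [inv_mul_le_iff₀ (by positivity)] at hm
    rw [mul_comm]
    exact hm

lemma conjTranspose_of_transpose_eq_neg {Z : Matrix ι ι ℂ} (h : Zᵀ = -Z) :
    (Zᴴ)ᵀ = -Zᴴ := by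
  ext i j
  have h1 : Z j i = -Z i j := congrFun (congrFun h i) j
  change star (Z i j) = -star (Z j i)
  rw [h1, star_neg, neg_neg]

end OperatorNorm

lemma mem_OmegaII_iff {n : ℕ} {Z : Matrix (Fin n) (Fin n) ℂ} :
    Z ∈ OmegaII n ↔ Zᵀ = -Z ∧ opn Z < 1 := by
  refine and_congr_right fun h => ?_
  rw [opn_lt_one_iff_posDef, ← Matrix.PosDef.transpose_iff, transpose_sub, transpose_mul,
    conjTranspose_of_transpose_eq_neg h, h]
  simp

lemma zero_mem_OmegaII (n : ℕ) : (0 : Matrix (Fin n) (Fin n) ℂ) ∈ OmegaII n := by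
  rw [mem_OmegaII_iff, opn_zero]; simp

end TypeII

namespace TypeII

section Action

variable {ι : Type*} [Fintype ι] [DecidableEq ι]

/-- The numerator of the linear fractional map attached to a block matrix. -/
def num (T : Matrix (ι ⊕ ι) (ι ⊕ ι) ℂ) (Z : Matrix ι ι ℂ) : Matrix ι ι ℂ :=
  T.toBlocks₁₁ * Z + T.toBlocks₁₂

/-- The denominator of the linear fractional map attached to a block matrix. -/
def den (T : Matrix (ι ⊕ ι) (ι ⊕ ι) ℂ) (Z : Matrix ι ι ℂ) : Matrix ι ι ℂ :=
  T.toBlocks₂₁ * Z + T.toBlocks₂₂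

/-- The linear fractional map attached to a block matrix. -/
def act (T : Matrix (ι ⊕ ι) (ι ⊕ ι) ℂ) (Z : Matrix ι ι ℂ) : Matrix ι ι ℂ :=
  num T Z * (den T Z)⁻¹

/-- The column block matrix with blocks `Z` and `1`. -/
def aug (Z : Matrix ι ι ℂ) : Matrix (ι ⊕ ι) ι ℂ := fromRows Z 1

lemma aug_mul (Z C : Matrix ι ι ℂ) : aug Z * C = fromRows (Z * C) C := by
  rw [aug, fromRows_mul, one_mul]

lemma mul_fromRows_eq (T : Matrix (ι ⊕ ι) (ι ⊕ ι) ℂ) (X Y : Matrix ι ι ℂ) :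
    T * fromRows X Y = fromRows (T.toBlocks₁₁ * X + T.toBlocks₁₂ * Y)
      (T.toBlocks₂₁ * X + T.toBlocks₂₂ * Y) := by
  conv_lhs => rw [← fromBlocks_toBlocks T]
  rw [fromBlocks_mul_fromRows]

lemma mul_fromRows_one (T : Matrix (ι ⊕ ι) (ι ⊕ ι) ℂ) (Z : Matrix ι ι ℂ) :
    T * aug Z = fromRows (num T Z) (den T Z) := by
  rw [aug, mul_fromRows_eq, mul_one, mul_one]; rfl

lemma mul_fromRows_act {T : Matrix (ι ⊕ ι) (ι ⊕ ι) ℂ} {Z : Matrix ι ι ℂ}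
    (h : IsUnit (den T Z).det) :
    T * aug Z = aug (act T Z) * den T Z := by
  rw [mul_fromRows_one, aug_mul, act, Matrix.mul_assoc,
    Matrix.nonsing_inv_mul _ h, mul_one]

lemma den_eq_of_mul_fromRows {T : Matrix (ι ⊕ ι) (ι ⊕ ι) ℂ} {Z W C : Matrix ι ι ℂ}
    (h : T * aug Z = aug W * C) : den T Z = C := by
  rw [mul_fromRows_one, aug_mul] at h
  exact (fromRows_inj h).2

lemma act_eq_of_mul_fromRows {T : Matrix (ι ⊕ ι) (ι ⊕ ι) ℂ} {Z W C : Matrix ι ι ℂ}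
    (h : T * aug Z = aug W * C) (hC : IsUnit C.det) : act T Z = W := by
  have h2 := den_eq_of_mul_fromRows h
  rw [mul_fromRows_one, aug_mul] at h
  rw [act, h2, (fromRows_inj h).1, Matrix.mul_assoc, Matrix.mul_nonsing_inv _ hC, mul_one]

lemma mul_mul_fromRows {S T : Matrix (ι ⊕ ι) (ι ⊕ ι) ℂ} {Z : Matrix ι ι ℂ}
    (hS : IsUnit (den S Z).det) (hT : IsUnit (den T (act S Z)).det) :
    T * S * aug Z = aug (act T (act S Z)) * (den T (act S Z) * den S Z) := by
  rw [Matrix.mul_assoc, mul_fromRows_act hS, ← Matrix.mul_assoc, mul_fromRows_act hT,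
    Matrix.mul_assoc]

lemma act_mul {S T : Matrix (ι ⊕ ι) (ι ⊕ ι) ℂ} {Z : Matrix ι ι ℂ}
    (hS : IsUnit (den S Z).det) (hT : IsUnit (den T (act S Z)).det) :
    act (T * S) Z = act T (act S Z) :=
  act_eq_of_mul_fromRows (mul_mul_fromRows hS hT) (by rw [det_mul]; exact hT.mul hS)

lemma act_one (Z : Matrix ι ι ℂ) : act 1 Z = Z :=
  act_eq_of_mul_fromRows (C := 1) (by rw [Matrix.one_mul, Matrix.mul_one]) (by simp)

/-- The indefinite diagonal form on the doubled space. -/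
def formJ (ι : Type*) [DecidableEq ι] : Matrix (ι ⊕ ι) (ι ⊕ ι) ℂ := fromBlocks 1 0 0 (-1)

/-- The symmetric off-diagonal form on the doubled space. -/
def formK (ι : Type*) [DecidableEq ι] : Matrix (ι ⊕ ι) (ι ⊕ ι) ℂ := fromBlocks 0 1 1 0

lemma formJ_mul_self : formJ ι * formJ ι = 1 := by
  rw [formJ, fromBlocks_multiply]; simp

lemma formK_mul_self : formK ι * formK ι = 1 := by
  rw [formK, fromBlocks_multiply]; simp

/-- The group preserving both forms; it acts on the type II domain. -/
structure InG (T : Matrix (ι ⊕ ι) (ι ⊕ ι) ℂ) : Prop where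
  herm : Tᴴ * formJ ι * T = formJ ι
  symm : Tᵀ * formK ι * T = formK ι

lemma InG.mul {S T : Matrix (ι ⊕ ι) (ι ⊕ ι) ℂ} (hS : InG S) (hT : InG T) : InG (S * T) := by
  constructor
  · calc (S * T)ᴴ * formJ ι * (S * T) = Tᴴ * (Sᴴ * formJ ι * S) * T := by
          rw [conjTranspose_mul]; noncomm_ring
      _ = formJ ι := by rw [hS.herm, hT.herm]
  · calc (S * T)ᵀ * formK ι * (S * T) = Tᵀ * (Sᵀ * formK ι * S) * T := by
          rw [transpose_mul]; noncomm_ring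
      _ = formK ι := by rw [hS.symm, hT.symm]

lemma InG.one : InG (1 : Matrix (ι ⊕ ι) (ι ⊕ ι) ℂ) := by constructor <;> simp

lemma InG.inv_mul {T : Matrix (ι ⊕ ι) (ι ⊕ ι) ℂ} (hT : InG T) :
    formJ ι * Tᴴ * formJ ι * T = 1 := by
  rw [Matrix.mul_assoc (formJ ι) Tᴴ, Matrix.mul_assoc, hT.herm, formJ_mul_self]

lemma InG.isUnit_det {T : Matrix (ι ⊕ ι) (ι ⊕ ι) ℂ} (hT : InG T) : IsUnit T.det :=
  (Matrix.isUnit_iff_isUnit_det _).1 (IsUnit.of_mul_eq_one _ (mul_eq_one_comm.1 hT.inv_mul))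

lemma InG.inv_eq {T : Matrix (ι ⊕ ι) (ι ⊕ ι) ℂ} (hT : InG T) :
    T⁻¹ = formJ ι * Tᴴ * formJ ι :=
  Matrix.inv_eq_left_inv hT.inv_mul

lemma InG.inv {T : Matrix (ι ⊕ ι) (ι ⊕ ι) ℂ} (hT : InG T) : InG T⁻¹ := by
  have h1 : T * T⁻¹ = 1 := Matrix.mul_nonsing_inv _ hT.isUnit_det
  have h2 : (T⁻¹)ᴴ * Tᴴ = 1 := by rw [← conjTranspose_mul, h1, conjTranspose_one]
  have h3 : (T⁻¹)ᵀ * Tᵀ = 1 := by rw [← transpose_mul, h1, transpose_one]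
  constructor
  · calc (T⁻¹)ᴴ * formJ ι * T⁻¹ = (T⁻¹)ᴴ * (Tᴴ * formJ ι * T) * T⁻¹ := by rw [hT.herm]
      _ = ((T⁻¹)ᴴ * Tᴴ) * formJ ι * (T * T⁻¹) := by noncomm_ring
      _ = formJ ι := by rw [h1, h2]; simp
  · calc (T⁻¹)ᵀ * formK ι * T⁻¹ = (T⁻¹)ᵀ * (Tᵀ * formK ι * T) * T⁻¹ := by rw [hT.symm]
      _ = ((T⁻¹)ᵀ * Tᵀ) * formK ι * (T * T⁻¹) := by noncomm_ring
      _ = formK ι := by rw [h1, h3]; simp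

lemma fromRows_formJ (X Y : Matrix ι ι ℂ) :
    (fromRows X Y)ᴴ * formJ ι * fromRows X Y = Xᴴ * X - Yᴴ * Y := by
  rw [conjTranspose_fromRows_eq_fromCols_conjTranspose, formJ, fromCols_mul_fromBlocks,
    fromCols_mul_fromRows]
  simp [sub_eq_add_neg]

lemma fromRows_formK (X Y : Matrix ι ι ℂ) :
    (fromRows X Y)ᵀ * formK ι * fromRows X Y = Yᵀ * X + Xᵀ * Y := by
  rw [transpose_fromRows, formK, fromCols_mul_fromBlocks, fromCols_mul_fromRows]
  simp

lemma InG.den_gram {T : Matrix (ι ⊕ ι) (ι ⊕ ι) ℂ} (hT : InG T) (Z : Matrix ι ι ℂ) :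
    (den T Z)ᴴ * den T Z - (num T Z)ᴴ * num T Z = 1 - Zᴴ * Z := by
  have h1 := fromRows_formJ (num T Z) (den T Z)
  have h2 := fromRows_formJ Z 1
  rw [← mul_fromRows_one] at h1
  rw [← aug] at h2
  have h3 : (T * aug Z)ᴴ * formJ ι * (T * aug Z) =
      (aug Z)ᴴ * (Tᴴ * formJ ι * T) * aug Z := by
    rw [conjTranspose_mul]; simp only [Matrix.mul_assoc]
  rw [h3, hT.herm, h2] at h1
  simp only [conjTranspose_one, mul_one] at h1
  rw [← neg_sub ((num T Z)ᴴ * num T Z), ← h1, neg_sub]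

lemma InG.num_den_symm {T : Matrix (ι ⊕ ι) (ι ⊕ ι) ℂ} (hT : InG T) (Z : Matrix ι ι ℂ) :
    (den T Z)ᵀ * num T Z + (num T Z)ᵀ * den T Z = Z + Zᵀ := by
  have h1 := fromRows_formK (num T Z) (den T Z)
  have h2 := fromRows_formK Z 1
  rw [← mul_fromRows_one] at h1
  rw [← aug] at h2
  have h3 : (T * aug Z)ᵀ * formK ι * (T * aug Z) =
      (aug Z)ᵀ * (Tᵀ * formK ι * T) * aug Z := by
    rw [transpose_mul]; simp only [Matrix.mul_assoc]
  rw [h3, hT.symm, h2] at h1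
  simpa using h1.symm

lemma InG.isUnit_den {T : Matrix (ι ⊕ ι) (ι ⊕ ι) ℂ} (hT : InG T) {Z : Matrix ι ι ℂ}
    (hZ : opn Z < 1) : IsUnit (den T Z).det := by
  have h1 : ((den T Z)ᴴ * den T Z).PosDef := by
    have := (opn_lt_one_iff_posDef.1 hZ).add_posSemidef
      (Matrix.posSemidef_conjTranspose_mul_self (num T Z))
    rwa [← hT.den_gram, sub_add_cancel] at this
  have h2 := (Matrix.isUnit_iff_isUnit_det _).1 h1.isUnit
  rw [det_mul] at h2
  exact isUnit_of_mul_isUnit_right h2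

lemma InG.opn_act_lt {T : Matrix (ι ⊕ ι) (ι ⊕ ι) ℂ} (hT : InG T) {Z : Matrix ι ι ℂ}
    (hZ : opn Z < 1) : opn (act T Z) < 1 := by
  have hD := hT.isUnit_den hZ
  have hD1 := Matrix.mul_nonsing_inv _ hD
  have hD2 : ((den T Z)⁻¹)ᴴ * (den T Z)ᴴ = 1 := by
    rw [← conjTranspose_mul, hD1, conjTranspose_one]
  rw [opn_lt_one_iff_posDef]
  have h := (opn_lt_one_iff_posDef.1 hZ).conjTranspose_mul_mul_same (B := (den T Z)⁻¹)
    (Matrix.mulVec_injective_of_isUnit ((Matrix.isUnit_iff_isUnit_det _).2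
      (Matrix.isUnit_nonsing_inv_det _ hD)))
  rw [← hT.den_gram] at h
  convert h using 1
  calc 1 - (act T Z)ᴴ * act T Z
      = (((den T Z)⁻¹)ᴴ * (den T Z)ᴴ) * (den T Z * (den T Z)⁻¹) - (act T Z)ᴴ * act T Z := by
        rw [hD1, hD2, one_mul]
    _ = _ := by rw [act, conjTranspose_mul]; noncomm_ring

lemma InG.act_transpose {T : Matrix (ι ⊕ ι) (ι ⊕ ι) ℂ} (hT : InG T) {Z : Matrix ι ι ℂ}
    (hD : IsUnit (den T Z).det) (hZ : Zᵀ = -Z) : (act T Z)ᵀ = -act T Z := by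
  have hD1 := Matrix.mul_nonsing_inv _ hD
  have hD2 : ((den T Z)⁻¹)ᵀ * (den T Z)ᵀ = 1 := by
    rw [← transpose_mul, hD1, transpose_one]
  have h := hT.num_den_symm Z
  rw [hZ, add_neg_cancel] at h
  rw [eq_neg_iff_add_eq_zero]
  calc (act T Z)ᵀ + act T Z
      = (act T Z)ᵀ * (den T Z * (den T Z)⁻¹) + ((den T Z)⁻¹)ᵀ * (den T Z)ᵀ * act T Z := by
        rw [hD1, hD2, mul_one, one_mul]
    _ = ((den T Z)⁻¹)ᵀ * ((den T Z)ᵀ * num T Z + (num T Z)ᵀ * den T Z) * (den T Z)⁻¹ := by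
        rw [act, transpose_mul]; noncomm_ring
    _ = 0 := by rw [h]; simp

lemma InG.act_mul {S T : Matrix (ι ⊕ ι) (ι ⊕ ι) ℂ} (hT : InG T) (hS : InG S) {Z : Matrix ι ι ℂ}
    (hZ : opn Z < 1) : act (T * S) Z = act T (act S Z) :=
  TypeII.act_mul (hS.isUnit_den hZ) (hT.isUnit_den (hS.opn_act_lt hZ))

lemma InG.act_inv_act {T : Matrix (ι ⊕ ι) (ι ⊕ ι) ℂ} (hT : InG T) {Z : Matrix ι ι ℂ}
    (hZ : opn Z < 1) : act T⁻¹ (act T Z) = Z := by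
  rw [← hT.inv.act_mul hT hZ, Matrix.nonsing_inv_mul _ hT.isUnit_det, act_one]

lemma InG.act_act_inv {T : Matrix (ι ⊕ ι) (ι ⊕ ι) ℂ} (hT : InG T) {Z : Matrix ι ι ℂ}
    (hZ : opn Z < 1) : act T (act T⁻¹ Z) = Z := by
  rw [← hT.act_mul hT.inv hZ, Matrix.mul_nonsing_inv _ hT.isUnit_det, act_one]

lemma den_zero (T : Matrix (ι ⊕ ι) (ι ⊕ ι) ℂ) : den T 0 = T.toBlocks₂₂ := by simp [den]

lemma num_zero (T : Matrix (ι ⊕ ι) (ι ⊕ ι) ℂ) : num T 0 = T.toBlocks₁₂ := by simp [num]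

lemma InG.den_inv {T : Matrix (ι ⊕ ι) (ι ⊕ ι) ℂ} (hT : InG T) (W : Matrix ι ι ℂ) :
    den T⁻¹ W = (den T 0)ᴴ * (1 - (act T 0)ᴴ * W) := by
  have hD := hT.isUnit_den (Z := 0) (by rw [opn_zero]; exact one_pos)
  have hD2 : (den T 0)ᴴ * ((den T 0)⁻¹)ᴴ = 1 := by
    rw [← conjTranspose_mul, Matrix.nonsing_inv_mul _ hD, conjTranspose_one]
  have h : T⁻¹ = fromBlocks (T.toBlocks₁₁)ᴴ (-(T.toBlocks₂₁)ᴴ) (-(T.toBlocks₁₂)ᴴ)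
      (T.toBlocks₂₂)ᴴ := by
    rw [hT.inv_eq]
    conv_lhs => rw [← fromBlocks_toBlocks T]
    rw [fromBlocks_conjTranspose, formJ, fromBlocks_multiply, fromBlocks_multiply]
    simp
  have h2 : den T⁻¹ W = -(num T 0)ᴴ * W + (den T 0)ᴴ := by
    rw [den, h, den_zero, num_zero]; simp
  rw [h2, mul_sub, mul_one, act, conjTranspose_mul, ← Matrix.mul_assoc, ← Matrix.mul_assoc, hD2,
    one_mul]
  simp [add_comm, sub_eq_add_neg]

end Action

lemma InG.mapsTo {n : ℕ} {T : Matrix (Fin n ⊕ Fin n) (Fin n ⊕ Fin n) ℂ} (hT : InG T) :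
    Set.MapsTo (act T) (OmegaII n) (OmegaII n) := by
  intro Z hZ
  rw [mem_OmegaII_iff] at hZ ⊢
  exact ⟨hT.act_transpose (hT.isUnit_den hZ.2) hZ.1, hT.opn_act_lt hZ.2⟩

section Differentiability

variable {ι : Type*} [Fintype ι] [DecidableEq ι]
  {E : Type*} [NormedAddCommGroup E] [NormedSpace ℂ E] {s : Set E}

lemma differentiableOn_matrix {f : E → Matrix ι ι ℂ}
    (h : ∀ i j, DifferentiableOn ℂ (fun x => f x i j) s) : DifferentiableOn ℂ f s :=
  differentiableOn_pi.2 fun i => differentiableOn_pi.2 fun j => h i j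

lemma differentiableOn_entry {f : E → Matrix ι ι ℂ} (h : DifferentiableOn ℂ f s) (i j : ι) :
    DifferentiableOn ℂ (fun x => f x i j) s :=
  differentiableOn_pi.1 (differentiableOn_pi.1 h i) j

lemma differentiableOn_matrix_mul {f g : E → Matrix ι ι ℂ} (hf : DifferentiableOn ℂ f s)
    (hg : DifferentiableOn ℂ g s) : DifferentiableOn ℂ (fun x => f x * g x) s := by
  refine differentiableOn_matrix fun i j => ?_
  simp only [Matrix.mul_apply]
  exact DifferentiableOn.fun_sum fun k _ =>
    (differentiableOn_entry hf i k).mul (differentiableOn_entry hg k j)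

lemma differentiableOn_det {f : E → Matrix ι ι ℂ} (hf : DifferentiableOn ℂ f s) :
    DifferentiableOn ℂ (fun x => (f x).det) s := by
  simp only [Matrix.det_apply]
  refine DifferentiableOn.fun_sum fun σ _ => ?_
  have key : ∀ t : Finset ι, DifferentiableOn ℂ (fun x => ∏ i ∈ t, f x (σ i) i) s := by
    intro t
    induction t using Finset.induction_on with
    | empty => simp
    | insert a t ha ih =>
      simp only [Finset.prod_insert ha]
      exact (differentiableOn_entry hf _ a).mul ih
  simp only [Units.smul_def, zsmul_eq_mul]
  exact (key _).const_mul _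

lemma differentiableOn_inv {f : E → Matrix ι ι ℂ} (hf : DifferentiableOn ℂ f s)
    (h : ∀ x ∈ s, IsUnit (f x).det) : DifferentiableOn ℂ (fun x => (f x)⁻¹) s := by
  simp only [Matrix.inv_def, Ring.inverse_eq_inv']
  refine ((differentiableOn_det hf).fun_inv fun x hx => (h x hx).ne_zero).smul ?_
  refine differentiableOn_matrix fun i j => ?_
  simp only [Matrix.adjugate_apply]
  refine differentiableOn_det (differentiableOn_matrix fun k l => ?_)
  simp only [Matrix.updateRow_apply]
  split_ifs
  · exact differentiableOn_const _
  · exact differentiableOn_entry hf _ _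

lemma differentiableOn_act {T : Matrix (ι ⊕ ι) (ι ⊕ ι) ℂ} {f : E → Matrix ι ι ℂ}
    (hf : DifferentiableOn ℂ f s) (h : ∀ x ∈ s, IsUnit (den T (f x)).det) :
    DifferentiableOn ℂ (fun x => act T (f x)) s := by
  have hc : ∀ C : Matrix ι ι ℂ, DifferentiableOn ℂ (fun _ : E => C) s :=
    fun C => differentiableOn_const _
  refine differentiableOn_matrix_mul ?_ (differentiableOn_inv ?_ h)
  · exact (differentiableOn_matrix_mul (hc _) hf).add (hc _)
  · exact (differentiableOn_matrix_mul (hc _) hf).add (hc _)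

end Differentiability

lemma InG.isAutomorphismOf {n : ℕ} {T : Matrix (Fin n ⊕ Fin n) (Fin n ⊕ Fin n) ℂ} (hT : InG T) :
    IsAutomorphismOf (OmegaII n) (act T) := by
  refine ⟨hT.mapsTo, differentiableOn_act differentiableOn_id fun x hx =>
    hT.isUnit_den (mem_OmegaII_iff.1 hx).2, act T⁻¹, hT.inv.mapsTo,
    differentiableOn_act differentiableOn_id fun x hx =>
    hT.inv.isUnit_den (mem_OmegaII_iff.1 hx).2, fun z hz => hT.act_inv_act (mem_OmegaII_iff.1 hz).2,
    fun z hz => hT.act_act_inv (mem_OmegaII_iff.1 hz).2⟩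

end TypeII

namespace TypeII

/-- Hyperbolic cosine of the logarithm. -/
def ch (s : ℂ) : ℂ := (s + s⁻¹) / 2

/-- Hyperbolic sine of the logarithm. -/
def sh (s : ℂ) : ℂ := (s - s⁻¹) / 2

lemma ch_mul {s t : ℂ} (hs : s ≠ 0) (ht : t ≠ 0) : ch (s * t) = ch s * ch t + sh s * sh t := by
  simp only [ch, sh]; field_simp; ring

lemma sh_mul {s t : ℂ} (hs : s ≠ 0) (ht : t ≠ 0) : sh (s * t) = ch s * sh t + sh s * ch t := by
  simp only [ch, sh]; field_simp; ring

lemma ch_inv (s : ℂ) : ch s⁻¹ = ch s := by simp only [ch, inv_inv]; ring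

lemma sh_inv (s : ℂ) : sh s⁻¹ = -sh s := by simp only [sh, inv_inv]; ring

lemma ch_one : ch 1 = 1 := by simp [ch]

lemma sh_one : sh 1 = 0 := by simp [sh]

lemma star_ch (s : ℝ) : star (ch s) = ch s := by simp [ch]

lemma star_sh (s : ℝ) : star (sh s) = sh s := by simp [sh]

lemma two_mul_ch {s : ℂ} (hs : s ≠ 0) : 2 * s * ch s = s ^ 2 + 1 := by
  simp only [ch]; field_simp

lemma two_mul_sh {s : ℂ} (hs : s ≠ 0) : 2 * s * sh s = s ^ 2 - 1 := by
  simp only [sh]; field_simp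

/-- An antisymmetric partial isometry. -/
structure IsTripotent {ι : Type*} [Fintype ι] (e : Matrix ι ι ℂ) : Prop where
  antisymm : eᵀ = -e
  tripotent : e * eᴴ * e = e

section Transvection

variable {ι : Type*} [Fintype ι] [DecidableEq ι]

/-- The hyperbolic transvection in the direction of a tripotent. -/
def tv (s : ℂ) (e : Matrix ι ι ℂ) : Matrix (ι ⊕ ι) (ι ⊕ ι) ℂ :=
  fromBlocks (1 + (ch s - 1) • (e * eᴴ)) (sh s • e) (sh s • eᴴ) (1 + (ch s - 1) • (eᴴ * e))

variable {e : Matrix ι ι ℂ}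

lemma IsTripotent.tripotent' (he : IsTripotent e) : eᴴ * e * eᴴ = eᴴ := by
  have := congrArg conjTranspose he.tripotent
  rwa [conjTranspose_mul, conjTranspose_mul, conjTranspose_conjTranspose, ← Matrix.mul_assoc]
    at this

lemma IsTripotent.tv_mul (he : IsTripotent e) {s t : ℂ} (hs : s ≠ 0) (ht : t ≠ 0) :
    tv s e * tv t e = tv (s * t) e := by
  have h1 := he.tripotent
  have h2 := he.tripotent'
  have h3 : e * (eᴴ * e) = e := by rw [← Matrix.mul_assoc, h1]
  have h4 : eᴴ * (e * eᴴ) = eᴴ := by rw [← Matrix.mul_assoc, h2]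
  rw [tv, tv, fromBlocks_multiply, tv, ch_mul hs ht, sh_mul hs ht]
  congr 1 <;>
  · simp only [add_mul, mul_add, smul_mul_assoc, mul_smul_comm, one_mul, mul_one,
      Matrix.mul_assoc, h3, h4]
    module

lemma tv_one (e : Matrix ι ι ℂ) : tv 1 e = 1 := by
  rw [tv, ch_one, sh_one]; simp

lemma IsTripotent.tv_inv_mul (he : IsTripotent e) {s : ℂ} (hs : s ≠ 0) :
    tv s⁻¹ e * tv s e = 1 := by
  rw [he.tv_mul (inv_ne_zero hs) hs, inv_mul_cancel₀ hs, tv_one]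

lemma IsTripotent.inv_tv (he : IsTripotent e) {s : ℂ} (hs : s ≠ 0) :
    (tv s e)⁻¹ = tv s⁻¹ e := Matrix.inv_eq_left_inv (he.tv_inv_mul hs)

lemma formJ_tv (s : ℂ) (e : Matrix ι ι ℂ) : formJ ι * tv s e * formJ ι = tv s⁻¹ e := by
  rw [tv, tv, formJ, fromBlocks_multiply, fromBlocks_multiply, ch_inv, sh_inv]
  simp

lemma tv_conjTranspose (s : ℝ) (e : Matrix ι ι ℂ) : (tv (s : ℂ) e)ᴴ = tv (s : ℂ) e := by
  rw [tv, fromBlocks_conjTranspose]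
  simp only [conjTranspose_add, conjTranspose_smul, conjTranspose_mul, conjTranspose_one,
    conjTranspose_conjTranspose, star_sub, star_one, star_ch, star_sh]

lemma IsTripotent.tv_transpose (he : IsTripotent e) (s : ℂ) :
    (tv s e)ᵀ = formK ι * tv s⁻¹ e * formK ι := by
  have h1 := he.antisymm
  have h2 := conjTranspose_of_transpose_eq_neg h1
  rw [tv, tv, formK, fromBlocks_transpose, fromBlocks_multiply, fromBlocks_multiply, ch_inv, sh_inv]
  simp [h1, h2]

lemma IsTripotent.inG (he : IsTripotent e) {s : ℝ} (hs : 0 < s) : InG (tv (s : ℂ) e) := by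
  have hs' : (s : ℂ) ≠ 0 := by exact_mod_cast hs.ne'
  constructor
  · rw [tv_conjTranspose]
    calc tv (s : ℂ) e * formJ ι * tv (s : ℂ) e
        = (formJ ι * formJ ι) * tv (s : ℂ) e * formJ ι * tv (s : ℂ) e := by
          rw [formJ_mul_self, one_mul]
      _ = formJ ι * (formJ ι * tv (s : ℂ) e * formJ ι) * tv (s : ℂ) e := by noncomm_ring
      _ = formJ ι := by rw [formJ_tv, Matrix.mul_assoc, he.tv_inv_mul hs', mul_one]
  · rw [he.tv_transpose]
    calc formK ι * tv (s : ℂ)⁻¹ e * formK ι * formK ι * tv (s : ℂ) e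
        = formK ι * tv (s : ℂ)⁻¹ e * (formK ι * formK ι) * tv (s : ℂ) e := by noncomm_ring
      _ = formK ι := by rw [formK_mul_self, mul_one, Matrix.mul_assoc, he.tv_inv_mul hs', mul_one]

lemma den_tv_zero (s : ℂ) (e : Matrix ι ι ℂ) : den (tv s e) 0 = 1 + (ch s - 1) • (eᴴ * e) := by
  rw [den_zero, tv, toBlocks_fromBlocks₂₂]

lemma num_tv_zero (s : ℂ) (e : Matrix ι ι ℂ) : num (tv s e) 0 = sh s • e := by
  rw [num_zero, tv, toBlocks_fromBlocks₁₂]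

/-- Scalings along a tripotent multiply. -/
lemma IsTripotent.one_add_mul (he : IsTripotent e) (x y : ℂ) :
    (1 + (x - 1) • (eᴴ * e)) * (1 + (y - 1) • (eᴴ * e)) = 1 + (x * y - 1) • (eᴴ * e) := by
  have h1 : eᴴ * (e * (eᴴ * e)) = eᴴ * e := by rw [← Matrix.mul_assoc e, he.tripotent]
  simp only [add_mul, mul_add, smul_mul_assoc, mul_smul_comm, one_mul, mul_one,
    Matrix.mul_assoc, h1]
  module

lemma IsTripotent.mul_one_add (he : IsTripotent e) (x : ℂ) :
    e * (1 + (x - 1) • (eᴴ * e)) = x • e := by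
  rw [mul_add, mul_one, mul_smul_comm, ← Matrix.mul_assoc, he.tripotent]
  module

lemma IsTripotent.isUnit_one_add (he : IsTripotent e) {x : ℂ} (hx : x ≠ 0) :
    IsUnit (1 + (x - 1) • (eᴴ * e)).det := by
  refine (Matrix.isUnit_iff_isUnit_det _).1 (IsUnit.of_mul_eq_one
    (1 + (x⁻¹ - 1) • (eᴴ * e)) ?_)
  rw [he.one_add_mul, mul_inv_cancel₀ hx, sub_self, zero_smul, add_zero]

lemma IsTripotent.tv_aug_zero (he : IsTripotent e) {s : ℂ} (hc : ch s ≠ 0) :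
    tv s e * aug (0 : Matrix ι ι ℂ) = aug ((sh s / ch s) • e) * (1 + (ch s - 1) • (eᴴ * e)) := by
  rw [mul_fromRows_one, aug_mul, den_tv_zero, num_tv_zero, smul_mul_assoc, he.mul_one_add,
    smul_smul, div_mul_cancel₀ _ hc]

lemma IsTripotent.act_tv_zero (he : IsTripotent e) {s : ℂ} (hc : ch s ≠ 0) :
    act (tv s e) 0 = (sh s / ch s) • e :=
  act_eq_of_mul_fromRows (he.tv_aug_zero hc) (he.isUnit_one_add hc)

lemma opn_le_of_gram_le {Z : Matrix ι ι ℂ} {c : ℝ} (hc : 0 ≤ c) (h : Zᴴ * Z * (Zᴴ * Z) =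
    ((c ^ 2 : ℝ) : ℂ) • (Zᴴ * Z)) : opn Z ≤ c := by
  rcases eq_or_lt_of_le (opn_nonneg Z) with h0 | h0
  · rw [← h0]; exact hc
  have hg : opn (Zᴴ * Z) = opn Z ^ 2 := opn_gram Z
  have h1 : opn Z ^ 2 * opn Z ^ 2 = c ^ 2 * opn Z ^ 2 := by
    have h2 : opn ((Zᴴ * Z)ᴴ * (Zᴴ * Z)) = opn (Zᴴ * Z) ^ 2 := opn_gram _
    rw [conjTranspose_mul, conjTranspose_conjTranspose, h, opn_smul, hg] at h2
    rw [Complex.norm_real, Real.norm_of_nonneg (by positivity)] at h2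
    rw [h2]; ring
  have h3 := mul_right_cancel₀ (by positivity) h1
  exact ((sq_le_sq₀ h0.le hc).1 h3.le)

lemma IsTripotent.opn_le (he : IsTripotent e) : opn e ≤ 1 := by
  refine opn_le_of_gram_le zero_le_one ?_
  rw [Matrix.mul_assoc, ← Matrix.mul_assoc e, he.tripotent]
  simp

end Transvection

end TypeII

namespace TypeII

section FunctionAlgebra

variable {Y : Type*} (A : Subalgebra ℂ (Y → ℂ)) {ι κ μ : Type*}

/-- A matrix-valued function all of whose entries lie in a given algebra of functions. -/
def EntriesIn (γ : Y → Matrix ι κ ℂ) : Prop := ∀ i j, (fun y => γ y i j) ∈ A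

variable {A}

lemma const_mem (c : ℂ) : (fun _ : Y => c) ∈ A := A.algebraMap_mem c

lemma EntriesIn.const (C : Matrix ι κ ℂ) : EntriesIn A fun _ => C := fun _ _ => const_mem _

lemma EntriesIn.add {γ δ : Y → Matrix ι κ ℂ} (hγ : EntriesIn A γ) (hδ : EntriesIn A δ) :
    EntriesIn A fun y => γ y + δ y := fun i j => A.add_mem (hγ i j) (hδ i j)

lemma EntriesIn.sub {γ δ : Y → Matrix ι κ ℂ} (hγ : EntriesIn A γ) (hδ : EntriesIn A δ) :
    EntriesIn A fun y => γ y - δ y := fun i j => A.sub_mem (hγ i j) (hδ i j)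

lemma EntriesIn.smul {c : Y → ℂ} {γ : Y → Matrix ι κ ℂ} (hc : c ∈ A) (hγ : EntriesIn A γ) :
    EntriesIn A fun y => c y • γ y := fun i j => A.mul_mem hc (hγ i j)

lemma EntriesIn.mul [Fintype κ] {γ : Y → Matrix ι κ ℂ} {δ : Y → Matrix κ μ ℂ}
    (hγ : EntriesIn A γ) (hδ : EntriesIn A δ) : EntriesIn A fun y => γ y * δ y := by
  intro i j
  have : (fun y => (γ y * δ y) i j) = ∑ k, (fun y => γ y i k) * (fun y => δ y k j) := by
    funext y
    simp [Matrix.mul_apply, Finset.sum_apply]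
  rw [this]
  exact A.sum_mem fun k _ => A.mul_mem (hγ i k) (hδ k j)

lemma EntriesIn.det [Fintype ι] [DecidableEq ι] {γ : Y → Matrix ι ι ℂ} (hγ : EntriesIn A γ) :
    (fun y => (γ y).det) ∈ A := by
  have : (fun y => (γ y).det) =
      ∑ σ : Equiv.Perm ι, (fun _ => ((Equiv.Perm.sign σ : ℤ) : ℂ)) *
        ∏ i, fun y => γ y (σ i) i := by
    funext y
    simp [Matrix.det_apply', Finset.sum_apply, Finset.prod_apply]
  rw [this]
  exact A.sum_mem fun σ _ => A.mul_mem (const_mem _) (A.prod_mem fun i _ => hγ _ _)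

lemma EntriesIn.adjugate [Fintype ι] [DecidableEq ι] {γ : Y → Matrix ι ι ℂ}
    (hγ : EntriesIn A γ) : EntriesIn A fun y => (γ y).adjugate := by
  intro i j
  simp only [Matrix.adjugate_apply]
  refine EntriesIn.det fun k l => ?_
  simp only [Matrix.updateRow_apply]
  split_ifs
  · exact const_mem _
  · exact hγ _ _

lemma pow_mem' {c : Y → ℂ} (hc : c ∈ A) (K : ℕ) : (fun y => c y ^ K) ∈ A := A.pow_mem hc K

lemma exists_clear_eval {σ : Type*} {γ : σ → Y → ℂ} (hγ : ∀ q, γ q ∈ A) {d : Y → ℂ}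
    (hd : d ∈ A) (p : MvPolynomial σ ℂ) :
    ∃ K₀, ∀ K ≥ K₀, ∃ H ∈ A, ∀ y, d y ≠ 0 →
      H y = d y ^ K * MvPolynomial.eval (fun q => (d y)⁻¹ * γ q y) p := by
  induction p using MvPolynomial.induction_on with
  | C a =>
    refine ⟨0, fun K _ => ⟨fun y => d y ^ K * a, A.mul_mem (pow_mem' hd K) (const_mem a), ?_⟩⟩
    intro y _
    simp
  | add p q hp hq =>
    obtain ⟨K₁, h₁⟩ := hp
    obtain ⟨K₂, h₂⟩ := hq
    refine ⟨max K₁ K₂, fun K hK => ?_⟩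
    obtain ⟨H₁, m₁, e₁⟩ := h₁ K ((le_max_left _ _).trans hK)
    obtain ⟨H₂, m₂, e₂⟩ := h₂ K ((le_max_right _ _).trans hK)
    refine ⟨H₁ + H₂, A.add_mem m₁ m₂, fun y hy => ?_⟩
    rw [Pi.add_apply, e₁ y hy, e₂ y hy, map_add]
    ring
  | mul_X p q hp =>
    obtain ⟨K₁, h₁⟩ := hp
    refine ⟨K₁ + 1, fun K hK => ?_⟩
    obtain ⟨L, rfl⟩ : ∃ L, K = L + 1 := ⟨K - 1, by omega⟩
    obtain ⟨H₁, m₁, e₁⟩ := h₁ L (by omega)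
    refine ⟨H₁ * γ q, A.mul_mem m₁ (hγ q), fun y hy => ?_⟩
    rw [Pi.mul_apply, e₁ y hy, map_mul, MvPolynomial.eval_X, pow_succ]
    field_simp

variable {n n' : ℕ} {f : Matrix (Fin n) (Fin n) ℂ → Matrix (Fin n') (Fin n') ℂ}

lemma exists_clear (hf : IsPolyMapII f) {γ : Y → Matrix (Fin n) (Fin n) ℂ}
    (hγ : EntriesIn A γ) {d : Y → ℂ} (hd : d ∈ A) :
    ∃ (K : ℕ) (H : Y → Matrix (Fin n') (Fin n') ℂ), EntriesIn A H ∧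
      ∀ y, d y ≠ 0 → H y = d y ^ K • f ((d y)⁻¹ • γ y) := by
  choose p hp using hf
  have h := fun i j => exists_clear_eval (γ := fun q : Fin n × Fin n => fun y => γ y q.1 q.2)
    (fun q => hγ q.1 q.2) hd (p i j)
  choose K hK using h
  set L := ∑ i, ∑ j, K i j with hL
  have hKL : ∀ i j, K i j ≤ L := fun i j =>
    (Finset.single_le_sum (f := fun j => K i j) (fun _ _ => Nat.zero_le _)
      (Finset.mem_univ j)).trans
    (Finset.single_le_sum (f := fun i => ∑ j, K i j) (fun _ _ => Nat.zero_le _)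
      (Finset.mem_univ i))
  choose H hH hH' using fun i j => hK i j L (hKL i j)
  refine ⟨L, fun y => Matrix.of fun i j => H i j y, fun i j => hH i j, fun y hy => ?_⟩
  ext i j
  change H i j y = d y ^ L * f ((d y)⁻¹ • γ y) i j
  rw [hH' i j y hy, hp]
  rfl

lemma EntriesIn.comp (hf : IsPolyMapII f) {γ : Y → Matrix (Fin n) (Fin n) ℂ}
    (hγ : EntriesIn A γ) : EntriesIn A fun y => f (γ y) := by
  obtain ⟨K, H, hH, h⟩ := exists_clear hf hγ (d := fun _ => 1) (const_mem 1)
  have : (fun y => f (γ y)) = H := by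
    funext y
    rw [h y one_ne_zero]
    simp
  rw [this]
  exact hH

end FunctionAlgebra

section Univariate

open Polynomial

/-- Polynomial functions of one complex variable. -/
def PF1 : Subalgebra ℂ (ℂ → ℂ) := Algebra.adjoin ℂ {id}

/-- Polynomial functions of two complex variables. -/
def PF2 : Subalgebra ℂ (ℂ × ℂ → ℂ) := Algebra.adjoin ℂ {Prod.fst, Prod.snd}

lemma id_mem_PF1 : (fun x : ℂ => x) ∈ PF1 := Algebra.subset_adjoin rfl

lemma fst_mem_PF2 : (fun x : ℂ × ℂ => x.1) ∈ PF2 := Algebra.subset_adjoin (Or.inl rfl)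

lemma snd_mem_PF2 : (fun x : ℂ × ℂ => x.2) ∈ PF2 := Algebra.subset_adjoin (Or.inr rfl)

lemma exists_polynomial {u : ℂ → ℂ} (hu : u ∈ PF1) : ∃ p : ℂ[X], ∀ x, u x = p.eval x := by
  refine Algebra.adjoin_induction (p := fun u _ => ∃ p : ℂ[X], ∀ x, u x = p.eval x)
    ?_ ?_ ?_ ?_ hu
  · rintro _ rfl
    exact ⟨X, fun x => by simp⟩
  · exact fun r => ⟨C r, fun x => by simp⟩
  · rintro u v _ _ ⟨p, hp⟩ ⟨q, hq⟩
    exact ⟨p + q, fun x => by simp [hp, hq]⟩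
  · rintro u v _ _ ⟨p, hp⟩ ⟨q, hq⟩
    exact ⟨p * q, fun x => by simp [hp, hq]⟩

lemma eval_mem_PF1 (p : ℂ[X]) : (fun x => p.eval x) ∈ PF1 := by
  induction p using Polynomial.induction_on' with
  | add p q hp hq =>
    have h : (fun x => (p + q).eval x) = (fun x => p.eval x) + fun x => q.eval x := by
      funext x
      simp
    rw [h]
    exact PF1.add_mem hp hq
  | monomial k a =>
    have h : (fun x => (monomial k a).eval x) = (fun _ => a) * fun x => x ^ k := by
      funext x
      simp
    rw [h]
    exact PF1.mul_mem (const_mem a) (pow_mem' id_mem_PF1 k)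

lemma exists_polynomial₂ {u : ℂ × ℂ → ℂ} (hu : u ∈ PF2) :
    ∃ p : ℂ[X][X], ∀ s z, u (s, z) = (p.map (evalRingHom s)).eval z := by
  refine Algebra.adjoin_induction
    (p := fun u _ => ∃ p : ℂ[X][X], ∀ s z, u (s, z) = (p.map (evalRingHom s)).eval z)
    ?_ ?_ ?_ ?_ hu
  · rintro _ (rfl | rfl)
    · exact ⟨C X, fun s z => by simp⟩
    · exact ⟨X, fun s z => by simp⟩
  · exact fun r => ⟨C (C r), fun s z => by simp⟩
  · rintro u v _ _ ⟨p, hp⟩ ⟨q, hq⟩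
    exact ⟨p + q, fun s z => by simp [hp, hq]⟩
  · rintro u v _ _ ⟨p, hp⟩ ⟨q, hq⟩
    exact ⟨p * q, fun s z => by simp [hp, hq]⟩

lemma comp_mem {Y Z : Type*} {A : Subalgebra ℂ (Y → ℂ)} {g : Z → Y} {B : Subalgebra ℂ (Z → ℂ)}
    {S : Set (Y → ℂ)} (hA : A = Algebra.adjoin ℂ S) (hS : ∀ u ∈ S, u ∘ g ∈ B) {u : Y → ℂ}
    (hu : u ∈ A) : u ∘ g ∈ B := by
  subst hA
  refine Algebra.adjoin_induction (p := fun u _ => u ∘ g ∈ B) hS ?_ ?_ ?_ hu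
  · exact fun r => const_mem r
  · exact fun u v _ _ hu hv => B.add_mem hu hv
  · exact fun u v _ _ hu hv => B.mul_mem hu hv

lemma PF2.comp {Z : Type*} {B : Subalgebra ℂ (Z → ℂ)} {a b : Z → ℂ} (ha : a ∈ B) (hb : b ∈ B)
    {u : ℂ × ℂ → ℂ} (hu : u ∈ PF2) : (fun z => u (a z, b z)) ∈ B :=
  comp_mem (g := fun z => (a z, b z)) rfl (by rintro _ (rfl | rfl); exacts [ha, hb]) hu

lemma PF1.comp {Z : Type*} {B : Subalgebra ℂ (Z → ℂ)} {a : Z → ℂ} (ha : a ∈ B)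
    {u : ℂ → ℂ} (hu : u ∈ PF1) : (fun z => u (a z)) ∈ B :=
  comp_mem (g := a) rfl (by rintro _ rfl; exact ha) hu

lemma PF1.differentiable {u : ℂ → ℂ} (hu : u ∈ PF1) : Differentiable ℂ u := by
  obtain ⟨p, hp⟩ := exists_polynomial hu
  rw [funext hp]
  exact p.differentiable

/-- Polynomial functions agreeing on an infinite set agree. -/
lemma PF1.eq_of_infinite {u v : ℂ → ℂ} (hu : u ∈ PF1) (hv : v ∈ PF1) {S : Set ℂ}
    (hS : S.Infinite) (h : ∀ x ∈ S, u x = v x) : u = v := by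
  obtain ⟨p, hp⟩ := exists_polynomial hu
  obtain ⟨q, hq⟩ := exists_polynomial hv
  have : p = q := Polynomial.eq_of_infinite_eval_eq p q
    (hS.mono fun x hx => by rw [Set.mem_ofPred_eq, ← hp, ← hq, h x hx])
  funext x
  rw [hp, hq, this]

lemma infinite_ball {r : ℝ} (hr : 0 < r) : (Metric.ball (0 : ℂ) r).Infinite :=
  infinite_of_mem_nhds 0 (Metric.ball_mem_nhds _ hr)

lemma infinite_pos : {x : ℂ | ∃ s : ℝ, 0 < s ∧ (s : ℂ) = x}.Infinite := by
  have : (Set.Ioi (0 : ℝ)).Infinite := Set.Ioi_infinite _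
  refine (this.image (f := fun s : ℝ => (s : ℂ)) (Complex.ofReal_injective.injOn)).mono ?_
  rintro _ ⟨s, hs, rfl⟩
  exact ⟨s, hs, rfl⟩

/-- A polynomial of growth order `N` along the positive axis has degree at
most `N`. -/
lemma natDegree_le_of_growth {p : ℂ[X]} {N : ℕ} {C : ℝ}
    (h : ∀ᶠ x : ℝ in Filter.atTop, ‖p.eval (x : ℂ)‖ ≤ C * x ^ N) : p.natDegree ≤ N := by
  by_contra hN
  push Not at hN
  have hO : (fun x : ℝ => (p.eval (x : ℂ))) =O[Filter.atTop] fun x : ℝ => x ^ N := by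
    refine Asymptotics.IsBigO.of_bound C ?_
    filter_upwards [h, Filter.eventually_ge_atTop 1] with x hx hx1
    rw [Real.norm_of_nonneg (show (0 : ℝ) ≤ x ^ N by positivity)]
    exact hx
  set q := p /ₘ (X ^ (N + 1)) with hq
  set r := p %ₘ (X ^ (N + 1)) with hr
  have hmonic : (X ^ (N + 1) : ℂ[X]).Monic := monic_X_pow _
  have hdec : r + X ^ (N + 1) * q = p := modByMonic_add_div p (X ^ (N + 1))
  have hq0 : q ≠ 0 := by
    rw [hq, Ne, Polynomial.divByMonic_eq_zero_iff hmonic, not_lt, degree_X_pow,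
      degree_eq_natDegree (by rintro rfl; simp at hN)]
    exact_mod_cast hN
  have hrdeg : r.natDegree ≤ N := by
    have := natDegree_modByMonic_lt p hmonic (by
      intro h1
      have := congrArg natDegree h1
      simp at this)
    rw [natDegree_X_pow] at this
    exact Nat.lt_succ_iff.1 this
  have hrO : (fun x : ℝ => (r.eval (x : ℂ))) =O[Filter.atTop] fun x : ℝ => x ^ N := by
    have : (fun x : ℝ => (r.eval (x : ℂ))) =
        fun x : ℝ => ∑ i ∈ Finset.range (N + 1), r.coeff i * (x : ℂ) ^ i := by
      funext x
      exact eval_eq_sum_range' (Nat.lt_succ_iff.2 hrdeg) _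
    rw [this]
    have key : ∀ i ∈ Finset.range (N + 1), (fun x : ℝ => r.coeff i * (x : ℂ) ^ i)
        =O[Filter.atTop] fun x : ℝ => x ^ N := by
      intro i hi
      refine Asymptotics.IsBigO.of_bound ‖r.coeff i‖ ?_
      filter_upwards [Filter.eventually_ge_atTop 1] with x hx
      have hi' : i ≤ N := Nat.lt_succ_iff.1 (Finset.mem_range.1 hi)
      rw [norm_mul, norm_pow, Complex.norm_real, norm_pow]
      have h0 : ‖x‖ = x := Real.norm_of_nonneg (by linarith)
      rw [h0]
      gcongr
    exact Asymptotics.IsBigO.fun_sum key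
  have h1 : (fun x : ℝ => (x : ℂ) ^ (N + 1) * q.eval (x : ℂ)) =O[Filter.atTop]
      fun x : ℝ => x ^ N := by
    have := hO.sub hrO
    refine this.congr_left fun x => ?_
    rw [← hdec]
    simp
  have h2 : (fun x : ℝ => (x : ℂ) * q.eval (x : ℂ)) =O[Filter.atTop] fun _ : ℝ => (1 : ℝ) := by
    obtain ⟨c, hc⟩ := h1.bound
    refine Asymptotics.IsBigO.of_bound c ?_
    filter_upwards [hc, Filter.eventually_ge_atTop 1] with x hx hx1
    have hx0 : 0 < x := by linarith
    rw [norm_one, mul_one]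
    rw [pow_succ, mul_assoc, norm_mul, norm_pow, norm_pow, Complex.norm_real,
      Real.norm_of_nonneg hx0.le, mul_comm c] at hx
    exact le_of_mul_le_mul_left hx (by positivity)
  have hXq : 0 < (X * q).degree := by
    rw [degree_mul, degree_X, degree_eq_natDegree hq0]
    have : (0 : WithBot ℕ) < ((1 + q.natDegree : ℕ) : WithBot ℕ) := by exact_mod_cast (by omega)
    exact_mod_cast this
  have h3 : Filter.Tendsto (fun x : ℝ => ‖(X * q).eval (x : ℂ)‖) Filter.atTop Filter.atTop := by
    refine Polynomial.tendsto_norm_atTop (X * q) hXq (z := fun x : ℝ => (x : ℂ)) ?_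
    have h0 : (fun x : ℝ => ‖(x : ℂ)‖) = fun x => |x| := by
      funext x
      rw [Complex.norm_real, Real.norm_eq_abs]
    rw [h0]
    exact Filter.tendsto_abs_atTop_atTop
  obtain ⟨c, hc⟩ := h2.bound
  obtain ⟨x, hx1, hx2⟩ := (hc.and (h3.eventually_gt_atTop c)).exists
  simp at hx1 hx2
  linarith

end Univariate

end TypeII

namespace TypeII

section Family

open Polynomial

lemma PF2.exists_div {u : ℂ × ℂ → ℂ} (hu : u ∈ PF2) :
    ∃ v ∈ PF2, ∀ s z, u (s, z) = u (s, 0) + z * v (s, z) := by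
  refine Algebra.adjoin_induction
    (p := fun u _ => ∃ v ∈ PF2, ∀ s z, u (s, z) = u (s, 0) + z * v (s, z)) ?_ ?_ ?_ ?_ hu
  · rintro _ (rfl | rfl)
    · exact ⟨fun _ => 0, const_mem 0, fun s z => by simp⟩
    · exact ⟨fun _ => 1, const_mem 1, fun s z => by simp⟩
  · exact fun r => ⟨fun _ => 0, const_mem 0, fun s z => by simp⟩
  · rintro u u' hu hu' ⟨v, hv, h⟩ ⟨v', hv', h'⟩
    refine ⟨v + v', PF2.add_mem hv hv', fun s z => ?_⟩
    simp only [Pi.add_apply]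
    rw [h s z, h' s z]
    ring
  · rintro u u' hu hu' ⟨v, hv, h⟩ ⟨v', hv', h'⟩
    refine ⟨v * u' + (fun p => u (p.1, 0)) * v', PF2.add_mem (PF2.mul_mem hv hu')
      (PF2.mul_mem (PF2.comp fst_mem_PF2 (const_mem 0) hu) hv'), fun s z => ?_⟩
    simp only [Pi.add_apply, Pi.mul_apply]
    rw [h s z, h' s z]
    ring

lemma PF2.continuous {u : ℂ × ℂ → ℂ} (hu : u ∈ PF2) : Continuous u := by
  refine Algebra.adjoin_induction (p := fun u _ => Continuous u) ?_ ?_ ?_ ?_ hu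
  · rintro _ (rfl | rfl)
    exacts [continuous_fst, continuous_snd]
  · exact fun r => continuous_const
  · exact fun u v _ _ hu hv => hu.add hv
  · exact fun u v _ _ hu hv => hu.mul hv

lemma PF2.slice_left {u : ℂ × ℂ → ℂ} (hu : u ∈ PF2) (z : ℂ) : (fun s => u (s, z)) ∈ PF1 :=
  PF2.comp id_mem_PF1 (const_mem z) hu

/-- A polynomial bounded on the positive axis by a multiple of a power is a monomial. -/
lemma eq_monomial_of_bound {B : ℝ} (j : ℕ) :
    ∀ r : ℂ[X], (∀ s : ℝ, 0 < s → ‖r.eval (s : ℂ)‖ ≤ B * s ^ j) → ∃ c, r = C c * X ^ j := by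
  induction j with
  | zero =>
    intro r h
    have h0 : r.natDegree ≤ 0 := natDegree_le_of_growth (C := B) <|
      (Filter.eventually_gt_atTop 0).mono h
    exact ⟨r.coeff 0, by rw [pow_zero, mul_one]; exact eq_C_of_natDegree_le_zero h0⟩
  | succ j ih =>
    intro r h
    have h0 : r.eval 0 = 0 := by
      have h1 : Filter.Tendsto (fun s : ℝ => r.eval (s : ℂ)) (nhdsWithin 0 (Set.Ioi 0))
          (nhds (r.eval ((0 : ℝ) : ℂ))) :=
        ((r.continuous.comp Complex.continuous_ofReal).tendsto 0).mono_left nhdsWithin_le_nhds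
      have h2 : Filter.Tendsto (fun s : ℝ => B * s ^ (j + 1)) (nhdsWithin 0 (Set.Ioi 0))
          (nhds (B * 0 ^ (j + 1))) :=
        (((continuous_const.mul (continuous_pow (j + 1))).tendsto 0)).mono_left
          nhdsWithin_le_nhds
      have h3 := le_of_tendsto_of_tendsto h1.norm h2
        (by filter_upwards [self_mem_nhdsWithin] with s hs using h s hs)
      simpa using h3
    obtain ⟨q, rfl⟩ : X ∣ r := X_dvd_iff.2 (by rwa [coeff_zero_eq_eval_zero])
    obtain ⟨c, rfl⟩ := ih q fun s hs => by
      have := h s hs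
      rw [eval_mul, eval_X, norm_mul, Complex.norm_real, Real.norm_of_nonneg hs.le, pow_succ',
        mul_left_comm] at this
      exact le_of_mul_le_mul_left this hs
    exact ⟨c, by ring⟩

/-- A bounded family of holomorphic functions on the unit disc, with two rational
representations in the parameter and the variable, whose denominators at the origin have
complementary zeros. -/
structure IsRationalFamily (G : ℝ → ℂ → ℂ) (B : ℝ) : Prop where
  pos : 0 < B
  diff : ∀ s, 0 < s → DifferentiableOn ℂ (G s) (Metric.ball 0 1)
  bound : ∀ s, 0 < s → ∀ z ∈ Metric.ball (0 : ℂ) 1, ‖G s z‖ ≤ B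
  rep₁ : ∃ n ∈ PF2, ∃ d ∈ PF2, (∀ s : ℝ, 0 < s → ∀ z ∈ Metric.ball (0 : ℂ) 1,
    d ((s : ℂ), z) * G s z = n ((s : ℂ), z)) ∧ ∀ s, d (s, 0) = 0 → s = 0 ∨ s ^ 2 = -1
  rep₂ : ∃ n ∈ PF2, ∃ d ∈ PF2, (∀ s : ℝ, 0 < s → ∀ z ∈ Metric.ball (0 : ℂ) 1,
    d ((s : ℂ), z) * G s z = n ((s : ℂ), z)) ∧ ∀ s, d (s, 0) = 0 → s = 0 ∨ s ^ 2 ≠ -1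

variable {G : ℝ → ℂ → ℂ} {B : ℝ}

lemma zero_mem_ball : (0 : ℂ) ∈ Metric.ball (0 : ℂ) 1 := Metric.mem_ball_self one_pos

lemma IsRationalFamily.apply_zero (hG : IsRationalFamily G B) {s t : ℝ} (hs : 0 < s)
    (ht : 0 < t) : G s 0 = G t 0 := by
  obtain ⟨n₁, hn₁, d₁, hd₁, e₁, z₁⟩ := hG.rep₁
  obtain ⟨n₂, hn₂, d₂, hd₂, e₂, z₂⟩ := hG.rep₂
  obtain ⟨p₁, hp₁⟩ := exists_polynomial (PF2.slice_left hn₁ 0)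
  obtain ⟨q₁, hq₁⟩ := exists_polynomial (PF2.slice_left hd₁ 0)
  obtain ⟨p₂, hp₂⟩ := exists_polynomial (PF2.slice_left hn₂ 0)
  obtain ⟨q₂, hq₂⟩ := exists_polynomial (PF2.slice_left hd₂ 0)
  have E₁ : ∀ s : ℝ, 0 < s → q₁.eval (s : ℂ) * G s 0 = p₁.eval (s : ℂ) := fun s hs => by
    rw [← hp₁, ← hq₁]; exact e₁ s hs 0 zero_mem_ball
  have E₂ : ∀ s : ℝ, 0 < s → q₂.eval (s : ℂ) * G s 0 = p₂.eval (s : ℂ) := fun s hs => by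
    rw [← hp₂, ← hq₂]; exact e₂ s hs 0 zero_mem_ball
  simp only [hq₁] at z₁
  simp only [hq₂] at z₂
  have hpq : p₁ * q₂ = p₂ * q₁ := by
    refine Polynomial.eq_of_infinite_eval_eq _ _ (infinite_pos.mono ?_)
    rintro _ ⟨s, hs, rfl⟩
    rw [Set.mem_ofPred_eq, eval_mul, eval_mul, ← E₁ s hs, ← E₂ s hs]
    ring
  have hq0 : q₁ ≠ 0 := by
    rintro rfl
    rcases z₁ 1 (by simp) with h | h
    · exact one_ne_zero h
    · norm_num at h
  obtain ⟨q, hq, hq'⟩ := exists_eq_pow_rootMultiplicity_mul_and_not_dvd q₁ hq0 0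
  rw [C_0, sub_zero] at hq hq'
  set j := rootMultiplicity 0 q₁
  have hroot : ∀ x, q.eval x = 0 → x ^ 2 = -1 := by
    intro x hx
    rcases z₁ x (by rw [hq, eval_mul, hx, mul_zero]) with h | h
    · subst h
      exact absurd (X_dvd_iff.2 (by rwa [coeff_zero_eq_eval_zero])) hq'
    · exact h
  have hcop : IsCoprime q q₂ := by
    rw [Polynomial.isCoprime_iff_aeval_ne_zero_of_isAlgClosed ℂ ℂ]
    intro x
    by_contra! h
    simp only [coe_aeval_eq_eval] at h
    have h1 := hroot x h.1
    rcases z₂ x h.2 with h2 | h2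
    · rw [h2] at h1
      norm_num at h1
    · exact h2 h1
  obtain ⟨r, hr⟩ : q ∣ p₁ :=
    hcop.dvd_of_dvd_mul_right (by rw [hpq, hq]; exact ⟨p₂ * X ^ j, by ring⟩)
  have E : ∀ s : ℝ, 0 < s → (s : ℂ) ^ j * G s 0 = r.eval (s : ℂ) := by
    intro s hs
    have h1 := E₁ s hs
    rw [hq, hr, eval_mul, eval_mul, eval_pow, eval_X] at h1
    have h2 : q.eval (s : ℂ) ≠ 0 := by
      intro h
      have h3 := hroot _ h
      have h4 : s ^ 2 = -1 := by exact_mod_cast h3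
      nlinarith
    refine mul_left_cancel₀ h2 ?_
    rw [← h1]
    ring
  obtain ⟨c, rfl⟩ := eq_monomial_of_bound (B := B) j r fun s hs => by
    rw [← E s hs, norm_mul, norm_pow, Complex.norm_real, Real.norm_of_nonneg hs.le, mul_comm]
    exact mul_le_mul_of_nonneg_right (hG.bound s hs 0 zero_mem_ball) (by positivity)
  have key : ∀ s : ℝ, 0 < s → G s 0 = c := by
    intro s hs
    have h1 := E s hs
    rw [eval_mul, eval_C, eval_pow, eval_X, mul_comm] at h1
    exact mul_right_cancel₀ (pow_ne_zero _ (by exact_mod_cast hs.ne')) h1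
  rw [key s hs, key t ht]

lemma rep_dslope {F : ℂ → ℂ} (hF : DifferentiableOn ℂ F (Metric.ball 0 1)) {n d v w : ℂ → ℂ}
    (hd : Continuous d) (hv : Continuous v) (e : ∀ z ∈ Metric.ball (0 : ℂ) 1, d z * F z = n z)
    (hw : ∀ z, d 0 * n z - d z * n 0 = w z + z * v z) (hw0 : ∀ z, w z = 0) :
    ∀ z ∈ Metric.ball (0 : ℂ) 1, d 0 * d z * dslope F 0 z = v z := by
  have hne : ∀ z ∈ Metric.ball (0 : ℂ) 1, z ≠ 0 → d 0 * d z * dslope F 0 z = v z := by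
    intro z hz hz0
    rw [dslope_of_ne _ hz0, slope_def_field, sub_zero]
    have h1 := hw z
    rw [hw0, zero_add, ← e z hz, ← e 0 zero_mem_ball] at h1
    field_simp
    linear_combination h1
  intro z hz
  by_cases hz0 : z = 0
  · subst hz0
    have hball : Metric.ball (0 : ℂ) 1 ∈ nhds (0 : ℂ) := Metric.ball_mem_nhds _ one_pos
    have hc : ContinuousAt (dslope F 0) 0 :=
      (((Complex.differentiableOn_dslope hball).2 hF).continuousOn).continuousAt hball
    have h1 : Filter.Tendsto (fun z => d 0 * d z * dslope F 0 z) (nhdsWithin 0 {0}ᶜ)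
        (nhds (d 0 * d 0 * dslope F 0 0)) :=
      ((continuousAt_const.mul hd.continuousAt).mul hc).tendsto.mono_left nhdsWithin_le_nhds
    have h2 : Filter.Tendsto v (nhdsWithin 0 {0}ᶜ) (nhds (v 0)) :=
      (hv.tendsto 0).mono_left nhdsWithin_le_nhds
    refine tendsto_nhds_unique (h1.congr' ?_) h2
    filter_upwards [self_mem_nhdsWithin, nhdsWithin_le_nhds hball] with z h0 hz
    exact hne z hz h0
  · exact hne z hz hz0

lemma IsRationalFamily.dslope (hG : IsRationalFamily G B) :
    IsRationalFamily (fun s => dslope (G s) 0) (2 * B) := by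
  have hball : Metric.ball (0 : ℂ) 1 ∈ nhds (0 : ℂ) := Metric.ball_mem_nhds _ one_pos
  have hB := hG.pos
  have key : ∀ n ∈ PF2, ∀ d ∈ PF2, (∀ s : ℝ, 0 < s → ∀ z ∈ Metric.ball (0 : ℂ) 1,
      d ((s : ℂ), z) * G s z = n ((s : ℂ), z)) → ∃ v ∈ PF2, ∃ d' ∈ PF2,
      (∀ s : ℝ, 0 < s → ∀ z ∈ Metric.ball (0 : ℂ) 1,
      d' ((s : ℂ), z) * _root_.dslope (G s) 0 z = v ((s : ℂ), z)) ∧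
      ∀ s, d' (s, 0) = 0 → d (s, 0) = 0 := by
    intro n hn d hd e
    have hn0 := PF2.comp (a := fun p : ℂ × ℂ => p.1) (b := fun _ => 0) fst_mem_PF2 (const_mem 0) hn
    have hd0 := PF2.comp (a := fun p : ℂ × ℂ => p.1) (b := fun _ => 0) fst_mem_PF2 (const_mem 0) hd
    obtain ⟨v, hv, h⟩ := PF2.exists_div (PF2.sub_mem (PF2.mul_mem hd0 hn) (PF2.mul_mem hd hn0))
    refine ⟨v, hv, _, PF2.mul_mem hd0 hd, fun s hs => ?_, fun s h0 => by simpa using h0⟩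
    refine rep_dslope (hG.diff s hs) (n := fun z => n (s, z)) (d := fun z => d (s, z))
      (v := fun z => v (s, z)) ((PF2.continuous hd).comp (by fun_prop))
      ((PF2.continuous hv).comp (by fun_prop)) (e s hs) (fun z => h s z) fun z => ?_
    simp only [Pi.sub_apply, Pi.mul_apply]
    ring
  refine ⟨by positivity, fun s hs => (Complex.differentiableOn_dslope hball).2 (hG.diff s hs),
    fun s hs z hz => ?_, ?_, ?_⟩
  · have hm : Set.MapsTo (G s) (Metric.ball 0 1) (Metric.closedBall (G s 0) (2 * B)) := by
      intro w hw
      rw [mem_closedBall_iff_norm]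
      calc ‖G s w - G s 0‖ ≤ ‖G s w‖ + ‖G s 0‖ := norm_sub_le _ _
        _ ≤ B + B := add_le_add (hG.bound s hs w hw) (hG.bound s hs 0 zero_mem_ball)
        _ = 2 * B := by ring
    simpa using Complex.norm_dslope_le_div_of_mapsTo_ball (hG.diff s hs) hm hz
  · obtain ⟨n, hn, d, hd, e, hz⟩ := hG.rep₁
    obtain ⟨v, hv, d', hd', e', h'⟩ := key n hn d hd e
    exact ⟨v, hv, d', hd', e', fun s h => hz s (h' s h)⟩
  · obtain ⟨n, hn, d, hd, e, hz⟩ := hG.rep₂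
    obtain ⟨v, hv, d', hd', e', h'⟩ := key n hn d hd e
    exact ⟨v, hv, d', hd', e', fun s h => hz s (h' s h)⟩

lemma IsRationalFamily.norm_sub_le (k : ℕ) : ∀ {G : ℝ → ℂ → ℂ} {B : ℝ},
    IsRationalFamily G B → ∀ {s t : ℝ}, 0 < s → 0 < t → ∀ z ∈ Metric.ball (0 : ℂ) 1,
    ‖G s z - G t z‖ ≤ 2 * B * (2 * ‖z‖) ^ k := by
  induction k with
  | zero =>
    intro G B hG s t hs ht z hz
    rw [pow_zero, mul_one, two_mul]
    exact (_root_.norm_sub_le _ _).trans (add_le_add (hG.bound s hs z hz) (hG.bound t ht z hz))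
  | succ k ih =>
    intro G B hG s t hs ht z hz
    have h := ih hG.dslope hs ht z hz
    have hsl : ∀ F : ℂ → ℂ, F z = F 0 + z * _root_.dslope F 0 z := fun F => by
      have := sub_smul_dslope F 0 z
      rw [sub_zero, smul_eq_mul] at this
      rw [this]; ring
    have h1 : G s z - G t z = z * (_root_.dslope (G s) 0 z - _root_.dslope (G t) 0 z) := by
      rw [hsl (G s), hsl (G t), hG.apply_zero hs ht]; ring
    rw [h1, norm_mul]
    calc ‖z‖ * ‖_root_.dslope (G s) 0 z - _root_.dslope (G t) 0 z‖
        ≤ ‖z‖ * (2 * (2 * B) * (2 * ‖z‖) ^ k) := by gcongr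
      _ = 2 * B * (2 * ‖z‖) ^ (k + 1) := by ring

/-- A bounded rational family does not depend on the parameter. -/
lemma IsRationalFamily.eq (hG : IsRationalFamily G B) {s t : ℝ} (hs : 0 < s) (ht : 0 < t)
    {z : ℂ} (hz : z ∈ Metric.ball (0 : ℂ) 1) : G s z = G t z := by
  have ha : ∀ s, 0 < s → AnalyticOnNhd ℂ (G s) (Metric.ball 0 1) := fun s hs =>
    (hG.diff s hs).analyticOnNhd Metric.isOpen_ball
  refine (ha s hs).eqOn_of_preconnected_of_eventuallyEq (ha t ht)
    (convex_ball 0 1).isPreconnected zero_mem_ball ?_ hz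
  filter_upwards [Metric.ball_mem_nhds (0 : ℂ) (show (0 : ℝ) < 1 / 2 by norm_num)] with w hw
  rw [mem_ball_zero_iff] at hw
  have hw1 : w ∈ Metric.ball (0 : ℂ) 1 := by rw [mem_ball_zero_iff]; linarith
  have h1 : Filter.Tendsto (fun k : ℕ => 2 * B * (2 * ‖w‖) ^ k) Filter.atTop
      (nhds (2 * B * 0)) :=
    (tendsto_pow_atTop_nhds_zero_of_lt_one (by positivity) (by linarith)).const_mul _
  have h2 : ‖G s w - G t w‖ ≤ 2 * B * 0 :=
    ge_of_tendsto' h1 fun k => IsRationalFamily.norm_sub_le k hG hs ht w hw1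
  rw [mul_zero, norm_le_zero_iff, sub_eq_zero] at h2
  exact h2

end Family

end TypeII

namespace TypeII

section Rigidity

open Polynomial

variable {ι : Type*} [Fintype ι] [DecidableEq ι]

lemma re_trace_nonneg (X : Matrix ι ι ℂ) : 0 ≤ (trace (Xᴴ * X)).re :=
  (Complex.le_def.1 (Matrix.posSemidef_conjTranspose_mul_self X).trace_nonneg).1

lemma eq_zero_of_re_trace_nonpos {X : Matrix ι ι ℂ} (h : (trace (Xᴴ * X)).re ≤ 0) : X = 0 := by
  have h1 := Complex.le_def.1 (Matrix.posSemidef_conjTranspose_mul_self X).trace_nonneg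
  refine Matrix.trace_conjTranspose_mul_self_eq_zero_iff.1 (Complex.ext ?_ h1.2.symm)
  exact le_antisymm h h1.1

lemma re_trace_sub (X Y : Matrix ι ι ℂ) : (trace ((Y - X)ᴴ * (Y - X))).re =
    (trace (Yᴴ * Y)).re + (trace (Xᴴ * X)).re - 2 * (trace (Yᴴ * X)).re := by
  have h : trace (Xᴴ * Y) = star (trace (Yᴴ * X)) := by
    rw [← trace_conjTranspose, conjTranspose_mul, conjTranspose_conjTranspose]
  rw [conjTranspose_sub, sub_mul, mul_sub, mul_sub, trace_sub, trace_sub, trace_sub, h]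
  simp
  ring

lemma exists_diagonalization (X : Matrix ι ι ℂ) (hX : opn X ≤ 1) :
    ∃ (U : Matrix ι ι ℂ) (l : ι → ℝ), Uᴴ * U = 1 ∧ U * Uᴴ = 1 ∧
      Xᴴ * X = U * diagonal (fun i => (l i : ℂ)) * Uᴴ ∧ (∀ i, 0 ≤ l i) ∧ ∀ i, l i ≤ 1 := by
  have hA : (Xᴴ * X).IsHermitian := (Matrix.posSemidef_conjTranspose_mul_self X).isHermitian
  have hs := hA.spectral_theorem
  rw [Unitary.conjStarAlgAut_apply] at hs
  set U : Matrix ι ι ℂ := (hA.eigenvectorUnitary : Matrix ι ι ℂ) with hU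
  have h1 : Uᴴ * U = 1 := (Unitary.mem_iff.1 hA.eigenvectorUnitary.2).1
  have h2 : U * Uᴴ = 1 := (Unitary.mem_iff.1 hA.eigenvectorUnitary.2).2
  have l0 := (Matrix.posSemidef_conjTranspose_mul_self X).eigenvalues_nonneg
  change ∀ i, 0 ≤ hA.eigenvalues i at l0
  obtain ⟨l, hl⟩ : ∃ l, l = hA.eigenvalues := ⟨_, rfl⟩
  rw [← hl] at hs l0
  have hs' : Xᴴ * X = U * diagonal (fun i => (l i : ℂ)) * Uᴴ := hs
  refine ⟨U, l, h1, h2, hs', l0, fun i => ?_⟩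
  have h3 := (opn_le_iff_posSemidef zero_le_one).1 hX
  have h4 := (h3.conjTranspose_mul_mul_same U).diag_nonneg (i := i)
  have h5 : Uᴴ * ((((1 : ℝ) ^ 2 : ℝ) : ℂ) • 1 - Xᴴ * X) * U =
      1 - diagonal (fun i => (l i : ℂ)) := by
    rw [hs', mul_sub, sub_mul]
    have h6 : Uᴴ * (U * diagonal (fun i => (l i : ℂ)) * Uᴴ) * U =
      (Uᴴ * U) * diagonal (fun i => (l i : ℂ)) * (Uᴴ * U) := by noncomm_ring
    rw [h6, h1, one_mul, mul_one]
    simp [h1]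
  rw [h5, Matrix.sub_apply, one_apply_eq, diagonal_apply_eq, sub_nonneg] at h4
  exact_mod_cast h4

lemma trace_conj_unitary {U M : Matrix ι ι ℂ} (hU : Uᴴ * U = 1) :
    trace (U * M * Uᴴ) = trace M := by
  rw [trace_mul_comm, ← Matrix.mul_assoc, hU, one_mul]

lemma card_le_of_det {U : Matrix ι ι ℂ} {l : ι → ℝ} (hU : U * Uᴴ = 1) {p : ℂ[X]} {m : ℕ}
    (hp : p.natDegree ≤ m) (h : ∀ x : ℂ,
      (1 + x • (U * diagonal (fun i => (l i : ℂ)) * Uᴴ)).det = p.eval x) :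
    (Finset.univ.filter fun i => l i ≠ 0).card ≤ m := by
  have hU' : Uᴴ * U = 1 := mul_eq_one_comm.1 hU
  have h1 : p = ∏ i, (C (l i : ℂ) * X + C 1) := by
    refine Polynomial.funext fun x => ?_
    have h2 : 1 + x • (U * diagonal (fun i => (l i : ℂ)) * Uᴴ) =
        U * diagonal (fun i => (l i : ℂ) * x + 1) * Uᴴ := by
      have : diagonal (fun i => (l i : ℂ) * x + 1) =
          1 + x • diagonal (fun i => (l i : ℂ)) := by
        ext i j
        by_cases hij : i = j
        · subst hij; simp; ring
        · simp [hij]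
      rw [this, mul_add, add_mul, mul_one, hU, mul_smul_comm, smul_mul_assoc]
    rw [← h, h2, det_mul, det_mul, mul_right_comm, ← det_mul, hU, det_one, one_mul, det_diagonal,
      eval_prod]
    simp
  have h2 : p.natDegree = (Finset.univ.filter fun i => l i ≠ 0).card := by
    have hne : ∀ i, (C (l i : ℂ) * X + C 1) ≠ 0 := fun i h0 => by
      have := congrArg (Polynomial.eval 0) h0
      simp at this
    rw [h1, natDegree_prod _ _ fun i _ => hne i, Finset.card_filter]
    refine Finset.sum_congr rfl fun i _ => ?_
    split_ifs with hi
    · exact natDegree_linear (by exact_mod_cast hi)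
    · rw [not_not.1 hi]; simp
  exact h2 ▸ hp

variable {X Y : Matrix ι ι ℂ} {p : ℂ[X]} {m : ℕ}

lemma re_trace_gram_le (hX : opn X ≤ 1) (hp : p.natDegree ≤ m)
    (h : ∀ x : ℂ, (1 + x • (Xᴴ * X)).det = p.eval x) : (trace (Xᴴ * X)).re ≤ m := by
  obtain ⟨U, l, h1, h2, hA, l0, l1⟩ := exists_diagonalization X hX
  rw [hA] at h ⊢
  have hc := card_le_of_det h2 hp h
  rw [trace_conj_unitary h1, trace_diagonal, Complex.re_sum]
  calc ∑ i, ((l i : ℝ) : ℂ).re = ∑ i, l i := rfl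
    _ ≤ ∑ i, if l i ≠ 0 then (1 : ℝ) else 0 := Finset.sum_le_sum fun i _ => by
        split_ifs with hi
        · exact l1 i
        · exact (not_not.1 hi).le
    _ = ((Finset.univ.filter fun i => l i ≠ 0).card : ℝ) := by rw [Finset.sum_boole]
    _ ≤ m := by exact_mod_cast hc

lemma trace_eq_sum_cols (X Y : Matrix ι ι ℂ) :
    trace (Yᴴ * X) = ∑ i, star (Yᵀ i) ⬝ᵥ (Xᵀ i) := rfl

lemma nsq_sub_re (v w : ι → ℂ) : nsq (v - w) = nsq v + nsq w - 2 * (star v ⬝ᵥ w).re := by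
  have h1 := congrArg Complex.re (nsq_coe (v - w))
  have h2 := congrArg Complex.re (nsq_coe v)
  have h3 := congrArg Complex.re (nsq_coe w)
  have h4 : star w ⬝ᵥ v = star (star v ⬝ᵥ w) := by
    rw [← Matrix.star_dotProduct_star, star_star]
  rw [star_sub, sub_dotProduct, dotProduct_sub, dotProduct_sub, h4] at h1
  simp at h1 h2 h3
  rw [h1, h2, h3]
  ring

lemma nsq_col_le (hY : opn Y ≤ 1) {U : Matrix ι ι ℂ} (hU : Uᴴ * U = 1) (i : ι) :
    nsq ((Y * U)ᵀ i) ≤ 1 := by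
  have h1 : (Y * U)ᵀ i = Y *ᵥ (Uᵀ i) := by
    ext k
    rfl
  have h2 : nsq (Uᵀ i) = 1 := by
    have h3 := nsq_coe (Uᵀ i)
    have h4 : star (Uᵀ i) ⬝ᵥ Uᵀ i = (Uᴴ * U) i i := rfl
    rw [h4, hU, one_apply_eq] at h3
    exact_mod_cast h3
  have h3 := nsq_mulVec_le Y (Uᵀ i)
  rw [h2, mul_one] at h3
  rw [h1]
  exact h3.trans (by nlinarith [opn_nonneg Y])

/-- Equality case of a trace inequality between contractions. -/
lemma rigid_of_trace (hX : opn X ≤ 1) (hY : opn Y ≤ 1) (hp : p.natDegree ≤ m)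
    (h : ∀ x : ℂ, (1 + x • (Xᴴ * X)).det = p.eval x) (ht : trace (Yᴴ * X) = m) :
    (Xᴴ * X) * (Xᴴ * X) = Xᴴ * X ∧ Y * (Xᴴ * X) = X ∧ trace (Xᴴ * X) = m := by
  obtain ⟨U, l, h1, h2, hA, l0, l1⟩ := exists_diagonalization X hX
  have hc : (Finset.univ.filter fun i => l i ≠ 0).card ≤ m :=
    card_le_of_det h2 hp (by rw [← hA]; exact h)
  set F := Finset.univ.filter fun i => l i ≠ 0 with hF
  have hgram : (X * U)ᴴ * (X * U) = diagonal fun i => (l i : ℂ) := by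
    calc (X * U)ᴴ * (X * U) = Uᴴ * (Xᴴ * X) * U := by rw [conjTranspose_mul]; noncomm_ring
      _ = (Uᴴ * U) * diagonal (fun i => (l i : ℂ)) * (Uᴴ * U) := by rw [hA]; noncomm_ring
      _ = _ := by rw [h1, one_mul, mul_one]
  have hcol : ∀ i, nsq ((X * U)ᵀ i) = l i := fun i => by
    have h3 := nsq_coe ((X * U)ᵀ i)
    have h4 : star ((X * U)ᵀ i) ⬝ᵥ (X * U)ᵀ i = ((X * U)ᴴ * (X * U)) i i := rfl
    rw [h4, hgram, diagonal_apply_eq] at h3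
    exact_mod_cast h3
  have hcol0 : ∀ i ∉ F, (X * U)ᵀ i = 0 := fun i hi => by
    rw [← nsq_eq_zero, hcol]
    simpa [hF] using hi
  have htr : ∑ i ∈ F, (star ((Y * U)ᵀ i) ⬝ᵥ (X * U)ᵀ i).re = m := by
    have h3 : trace ((Y * U)ᴴ * (X * U)) = m := by
      rw [← ht, conjTranspose_mul, Matrix.mul_assoc, trace_mul_comm, Matrix.mul_assoc,
        Matrix.mul_assoc, h2, mul_one]
    have h4 := congrArg Complex.re h3
    rw [trace_eq_sum_cols, Complex.re_sum, Complex.natCast_re] at h4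
    rw [← h4]
    refine Finset.sum_subset (Finset.subset_univ _) fun i _ hi => ?_
    rw [hcol0 i hi, dotProduct_zero, Complex.zero_re]
  have hsum : ∑ i ∈ F, (nsq ((Y * U)ᵀ i - (X * U)ᵀ i) + (1 - l i) + (1 - nsq ((Y * U)ᵀ i))) =
      2 * F.card - 2 * m := by
    have h3 : ∀ i ∈ F, nsq ((Y * U)ᵀ i - (X * U)ᵀ i) + (1 - l i) + (1 - nsq ((Y * U)ᵀ i)) =
        2 - 2 * (star ((Y * U)ᵀ i) ⬝ᵥ (X * U)ᵀ i).re := fun i _ => by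
      rw [nsq_sub_re, hcol]; ring
    rw [Finset.sum_congr rfl h3, Finset.sum_sub_distrib, ← Finset.mul_sum, htr,
      Finset.sum_const, nsmul_eq_mul]
    ring
  have hnn : ∀ i ∈ F, 0 ≤ nsq ((Y * U)ᵀ i - (X * U)ᵀ i) + (1 - l i) +
      (1 - nsq ((Y * U)ᵀ i)) := fun i _ => by
    have := nsq_nonneg ((Y * U)ᵀ i - (X * U)ᵀ i)
    have := nsq_col_le hY h1 i
    have := l1 i
    linarith
  have hcm : (F.card : ℝ) ≤ m := by exact_mod_cast hc
  have hz := (Finset.sum_eq_zero_iff_of_nonneg hnn).1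
    (le_antisymm (by rw [hsum]; linarith) (Finset.sum_nonneg hnn))
  have hm : (F.card : ℝ) = m := by
    have := Finset.sum_eq_zero hz
    rw [hsum] at this
    linarith
  have hF1 : ∀ i ∈ F, l i = 1 ∧ (Y * U)ᵀ i = (X * U)ᵀ i := fun i hi => by
    have h3 := hz i hi
    have h4 := nsq_nonneg ((Y * U)ᵀ i - (X * U)ᵀ i)
    have h5 := nsq_col_le hY h1 i
    have h6 := l1 i
    exact ⟨by linarith, sub_eq_zero.1 (nsq_eq_zero.1 (by linarith))⟩
  have hll : ∀ i, l i * l i = l i := fun i => by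
    by_cases hi : l i = 0
    · rw [hi, mul_zero]
    · rw [(hF1 i (by simpa [hF] using hi)).1, mul_one]
  refine ⟨?_, ?_, ?_⟩
  · rw [hA]
    calc U * diagonal (fun i => (l i : ℂ)) * Uᴴ * (U * diagonal (fun i => (l i : ℂ)) * Uᴴ)
        = U * (diagonal (fun i => (l i : ℂ)) * (Uᴴ * U) * diagonal (fun i => (l i : ℂ))) * Uᴴ := by
          noncomm_ring
      _ = U * diagonal (fun i => (l i : ℂ)) * Uᴴ := by
          rw [h1, mul_one, diagonal_mul_diagonal]
          congr 3
          funext i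
          exact_mod_cast hll i
  · have h3 : Y * U * diagonal (fun i => (l i : ℂ)) = X * U := by
      ext k i
      rw [mul_diagonal]
      by_cases hi : i ∈ F
      · have := congrFun (hF1 i hi).2 k
        rw [(hF1 i hi).1, Complex.ofReal_one, mul_one]
        exact this
      · have h4 := congrFun (hcol0 i hi) k
        have h5 : l i = 0 := by simpa [hF] using hi
        rw [h5, Complex.ofReal_zero, mul_zero]
        exact h4.symm
    rw [hA, ← Matrix.mul_assoc, ← Matrix.mul_assoc, h3, Matrix.mul_assoc, h2, mul_one]
  · rw [hA, trace_conj_unitary h1, trace_diagonal]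
    have h3 : ∑ i, l i = m := by
      rw [← hm, ← Finset.sum_subset (Finset.subset_univ F) fun i _ hi => by simpa [hF] using hi,
        Finset.sum_congr rfl fun i hi => (hF1 i hi).1]
      simp
    exact_mod_cast h3

lemma eq_of_gram_idempotent (h : (Xᴴ * X) * (Xᴴ * X) = Xᴴ * X) : X * Xᴴ * X = X := by
  rw [← sub_eq_zero]
  refine Matrix.conjTranspose_mul_self_eq_zero.1 ?_
  calc (X * Xᴴ * X - X)ᴴ * (X * Xᴴ * X - X)
      = (Xᴴ * X) * (Xᴴ * X) * (Xᴴ * X) - (Xᴴ * X) * (Xᴴ * X)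
        - ((Xᴴ * X) * (Xᴴ * X) - (Xᴴ * X)) := by
        rw [conjTranspose_sub, conjTranspose_mul, conjTranspose_mul, conjTranspose_conjTranspose]
        noncomm_ring
    _ = 0 := by rw [h, h, sub_self]

lemma norm_trace_le {L : Matrix ι ι ℂ} (hL : L * Lᴴ * L = L) (ht : trace (Lᴴ * L) = m)
    (hX : opn X ≤ 1) : ‖trace (Lᴴ * X)‖ ≤ m := by
  have hL' : Lᴴ * L * Lᴴ = Lᴴ := by
    have := congrArg conjTranspose hL
    rwa [conjTranspose_mul, conjTranspose_mul, conjTranspose_conjTranspose, ← Matrix.mul_assoc]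
      at this
  have key : ∀ X : Matrix ι ι ℂ, opn X ≤ 1 → (trace (Lᴴ * X)).re ≤ m := by
    intro X hX
    have h1 := re_trace_nonneg (L - X * (Lᴴ * L))
    have h2 : trace (Lᴴ * (X * (Lᴴ * L))) = trace (Lᴴ * X) := by
      rw [← Matrix.mul_assoc, trace_mul_comm, ← Matrix.mul_assoc, hL']
    have h3 : (trace ((X * (Lᴴ * L))ᴴ * (X * (Lᴴ * L)))).re ≤ m := by
      have h4 := (opn_le_iff_posSemidef zero_le_one).1 hX
      have h5 := (Complex.le_def.1 (h4.conjTranspose_mul_mul_same (Lᴴ * L)).trace_nonneg).1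
      have h6 : (Lᴴ * L)ᴴ * ((((1 : ℝ) ^ 2 : ℝ) : ℂ) • 1 - Xᴴ * X) * (Lᴴ * L) =
          Lᴴ * L - (X * (Lᴴ * L))ᴴ * (X * (Lᴴ * L)) := by
        have h7 : (Lᴴ * L)ᴴ * (Lᴴ * L) = Lᴴ * L := by
          rw [conjTranspose_mul, conjTranspose_conjTranspose, Matrix.mul_assoc,
            ← Matrix.mul_assoc L, hL]
        rw [conjTranspose_mul X, mul_sub, sub_mul]
        simp only [one_pow, Complex.ofReal_one, one_smul, mul_one, h7]
        noncomm_ring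
      rw [h6, trace_sub, ht] at h5
      rw [Complex.sub_re, Complex.natCast_re, Complex.zero_re, sub_nonneg] at h5
      exact h5
    rw [re_trace_sub, h2, ht] at h1
    simp at h1
    simp at h3
    linarith
  by_cases h0 : trace (Lᴴ * X) = 0
  · rw [h0, norm_zero]; positivity
  set t := trace (Lᴴ * X) with ht'
  have hn : (‖t‖ : ℂ) ≠ 0 := by exact_mod_cast norm_ne_zero_iff.2 h0
  have h1 := key ((star t / ‖t‖) • X) (by
    rw [opn_smul, norm_div, norm_star, Complex.norm_real, norm_norm,
      div_self (norm_ne_zero_iff.2 h0), one_mul]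
    exact hX)
  rw [mul_smul_comm, trace_smul, ← ht', smul_eq_mul] at h1
  have h2 : star t / ‖t‖ * t = ‖t‖ := by
    rw [div_mul_eq_mul_div, div_eq_iff hn]
    have := Complex.conj_mul' t
    rw [starRingEnd_apply] at this
    rw [this, sq]
  rw [h2, Complex.ofReal_re] at h1
  exact h1

end Rigidity

end TypeII

namespace TypeII

section Curves

open Polynomial

variable {ι : Type*} [Fintype ι] [DecidableEq ι]

/-- The identification of matrices with operators on Euclidean space, as a linear map. -/
def toOp (ι : Type*) [Fintype ι] [DecidableEq ι] :
    Matrix ι ι ℂ →L[ℂ] (EuclideanSpace ℂ ι →L[ℂ] EuclideanSpace ℂ ι) :=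
  LinearMap.toContinuousLinearMap
    { toFun := fun Z => Matrix.toEuclideanCLM (𝕜 := ℂ) (n := ι) Z
      map_add' := fun _ _ => map_add _ _ _
      map_smul' := fun _ _ => map_smul _ _ _ }

lemma continuous_opn : Continuous (opn : Matrix ι ι ℂ → ℝ) :=
  (toOp ι).continuous.norm

lemma opn_le_norm_of_curve {F : ℂ → Matrix ι ι ℂ}
    (hF : DifferentiableOn ℂ F (Metric.ball 0 1)) (h : ∀ z ∈ Metric.ball (0 : ℂ) 1, opn (F z) ≤ 1)
    (h0 : F 0 = 0) {z : ℂ} (hz : z ∈ Metric.ball (0 : ℂ) 1) : opn (F z) ≤ ‖z‖ := by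
  have h1 := Complex.norm_le_norm_of_mapsTo_ball (f := fun z => toOp ι (F z)) (R := 1)
    ((toOp ι).differentiable.comp_differentiableOn hF)
    (fun w hw => by rw [mem_closedBall_zero_iff]; exact h w hw) (by simp [h0])
    (mem_ball_zero_iff.1 hz)
  exact h1

lemma EntriesIn.differentiable {γ : ℂ → Matrix ι ι ℂ} (hγ : EntriesIn PF1 γ) :
    Differentiable ℂ γ :=
  differentiableOn_univ.1 (differentiableOn_matrix fun i j =>
    (PF1.differentiable (hγ i j)).differentiableOn)

lemma EntriesIn.eq_of_infinite {γ δ : ℂ → Matrix ι ι ℂ} (hγ : EntriesIn PF1 γ)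
    (hδ : EntriesIn PF1 δ) {S : Set ℂ} (hS : S.Infinite) (h : ∀ x ∈ S, γ x = δ x) (x : ℂ) :
    γ x = δ x := by
  ext i j
  exact congrFun (PF1.eq_of_infinite (hγ i j) (hδ i j) hS fun x hx => by rw [h x hx]) x

lemma EntriesIn.exists_smul {γ : ℂ → Matrix ι ι ℂ} (hγ : EntriesIn PF1 γ) (h0 : γ 0 = 0) :
    ∃ δ : ℂ → Matrix ι ι ℂ, EntriesIn PF1 δ ∧ ∀ z, γ z = z • δ z := by
  have h : ∀ i j, ∃ q : ℂ[X], ∀ z, γ z i j = z * q.eval z := by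
    intro i j
    obtain ⟨p, hp⟩ := exists_polynomial (hγ i j)
    obtain ⟨q, rfl⟩ : X ∣ p := X_dvd_iff.2 (by
      rw [coeff_zero_eq_eval_zero, ← hp, h0]; rfl)
    exact ⟨q, fun z => by rw [hp, eval_mul, eval_X]⟩
  choose q hq using h
  exact ⟨fun z => Matrix.of fun i j => (q i j).eval z, fun i j => eval_mem_PF1 _, fun z => by
    ext i j
    exact hq i j z⟩

lemma exists_pow_of_ne_zero {u : ℂ → ℂ} (hu : u ∈ PF1) (h0 : u 0 = 1) {a : ℂ} (ha : a ≠ 0)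
    (h : ∀ z, z ≠ a⁻¹ → u z ≠ 0) : ∃ m : ℕ, ∀ z, u z = (1 - a * z) ^ m := by
  obtain ⟨p, hp⟩ := exists_polynomial hu
  have hp0 : p ≠ 0 := by
    rintro rfl
    simp [hp] at h0
  obtain ⟨q, hq, hq'⟩ := exists_eq_pow_rootMultiplicity_mul_and_not_dvd p hp0 a⁻¹
  have hdeg : q.degree = 0 := by
    by_contra hd
    obtain ⟨x, hx⟩ := IsAlgClosed.exists_root q hd
    by_cases hxa : x = a⁻¹
    · subst hxa
      exact hq' (dvd_iff_isRoot.2 hx)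
    · refine h x hxa ?_
      rw [hp, hq, eval_mul, hx.eq_zero, mul_zero]
  rw [eq_C_of_degree_eq_zero hdeg] at hq
  set m := p.rootMultiplicity a⁻¹
  set c := q.coeff 0
  have hev : ∀ z, u z = (z - a⁻¹) ^ m * c := fun z => by
    rw [hp, hq]
    simp
  refine ⟨m, fun z => ?_⟩
  have h1 : 1 - a * z = (z - a⁻¹) * (-a) := by field_simp; ring
  have h2 : (-a) ^ m = c := by
    have h3 := h0
    rw [hev, zero_sub] at h3
    have h4 : (-a⁻¹) ^ m * (-a) ^ m = 1 := by
      rw [← mul_pow, neg_mul_neg, inv_mul_cancel₀ ha, one_pow]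
    exact mul_left_cancel₀ (left_ne_zero_of_mul_eq_one h4) (h4.trans h3.symm)
  rw [h1, mul_pow, h2, hev]

lemma EntriesIn.exists_polynomial_matrix {γ : ℂ → Matrix ι ι ℂ} (hγ : EntriesIn PF1 γ) :
    ∃ M : Matrix ι ι ℂ[X], ∀ z, γ z = M.map (Polynomial.evalRingHom z) := by
  choose q hq using fun i j => exists_polynomial (hγ i j)
  exact ⟨Matrix.of q, fun z => by
    ext i j
    exact hq i j z⟩

lemma trace_of_det_eq_pow {γ : ℂ → Matrix ι ι ℂ} (hγ : EntriesIn PF1 γ) {a : ℂ} {m : ℕ}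
    (h : ∀ z, (1 - z • γ z).det = (1 - a * z) ^ m) : trace (γ 0) = m * a := by
  obtain ⟨M, hM⟩ := hγ.exists_polynomial_matrix
  have h1 := det_one_add_smul (X : ℂ[X]) (-M)
  have h2 : (1 + (X : ℂ[X]) • (-M)).det = (1 - C a * X) ^ m := by
    refine Polynomial.funext fun z => ?_
    have h3 := (Polynomial.evalRingHom z).map_det (1 + (X : ℂ[X]) • (-M))
    rw [coe_evalRingHom] at h3
    have h4 : (Polynomial.evalRingHom z).mapMatrix (1 + (X : ℂ[X]) • (-M)) = 1 - z • γ z := by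
      rw [hM, map_add, map_one, sub_eq_add_neg, ← smul_neg]
      congr 1
      ext i j
      simp
    rw [h3, h4, h]
    simp
  rw [h2] at h1
  have h3 := congrArg (fun p : ℂ[X] => (derivative p).eval 0) h1
  have h4 : trace (γ 0) = (trace M).eval 0 := by
    rw [hM]
    simp [trace, eval_finsetSum]
  rw [h4]
  simp [derivative_pow] at h3
  linear_combination -h3

lemma natDegree_det_of_homogeneous {γ : ℂ → Matrix ι ι ℂ} (hγ : EntriesIn PF1 γ) {m : ℕ}
    (R : Matrix ι ι ℂ) (h : ∀ c : ℂ, ∃ p : ℂ[X], p.natDegree ≤ m ∧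
      ∀ z, (1 + (c • R) * (z • γ z)).det = p.eval z) (z : ℂ) :
    ∃ p : ℂ[X], p.natDegree ≤ m ∧ ∀ x : ℂ, (1 + x • (R * γ z)).det = p.eval x := by
  have hmem : (fun y : ℂ × ℂ => (1 + y.2 • (R * γ y.1)).det) ∈ PF2 :=
    EntriesIn.det ((EntriesIn.const 1).add (EntriesIn.smul snd_mem_PF2
      ((EntriesIn.const R).mul fun i j => PF1.comp fst_mem_PF2 (hγ i j))))
  obtain ⟨P, hP⟩ := exists_polynomial₂ hmem
  have hcoef : ∀ j, m < j → P.coeff j = 0 := by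
    have key : ∀ k, m < k → ∀ j, (P.coeff j * X ^ j).coeff k = 0 := by
      intro k hk
      set t : ℂ[X] := ∑ j ∈ Finset.range (P.natDegree + 1),
        C ((P.coeff j * X ^ j).coeff k) * X ^ j with ht
      have ht0 : t = 0 := by
        refine Polynomial.funext fun c => ?_
        obtain ⟨p, hp, hpe⟩ := h c
        have h1 : p = P.eval (C c * X) := by
          refine Polynomial.funext fun z => ?_
          rw [← hpe]
          have h2 := hP z (c * z)
          have h3 : (P.eval (C c * X)).eval z = (P.map (evalRingHom z)).eval (c * z) := by
            rw [eval_map, ← coe_evalRingHom z, eval₂_eq_sum_range, eval_eq_sum_range, map_sum]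
            simp
          rw [h3, ← h2]
          congr 2
          rw [smul_mul_assoc, mul_smul_comm, smul_smul]
        have h4 : p.coeff k = 0 := coeff_eq_zero_of_natDegree_lt (hp.trans_lt hk)
        rw [h1, eval_eq_sum_range, finsetSum_coeff] at h4
        rw [eval_zero, ← h4, ht, eval_finsetSum]
        refine Finset.sum_congr rfl fun j _ => ?_
        rw [eval_mul, eval_C, eval_pow, eval_X, mul_pow, ← C_pow, mul_left_comm, coeff_C_mul,
          mul_comm]
      intro j
      by_cases hj : j ≤ P.natDegree
      · have h5 : t.coeff j = (P.coeff j * X ^ j).coeff k := by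
          rw [ht, finsetSum_coeff, Finset.sum_eq_single j]
          · simp
          · intro i _ hij
            rw [coeff_C_mul_X_pow, if_neg hij.symm]
          · intro hj'
            exact absurd (Finset.mem_range.2 (Nat.lt_succ_of_le hj)) hj'
        rw [← h5, ht0, coeff_zero]
      · rw [coeff_eq_zero_of_natDegree_lt (not_le.1 hj), zero_mul, coeff_zero]
    intro j hj
    ext l
    have := key (l + j) (by omega) j
    rwa [coeff_mul_X_pow] at this
  refine ⟨P.map (evalRingHom z), natDegree_map_le.trans ?_, fun x => hP z x⟩
  exact natDegree_le_iff_coeff_eq_zero.2 hcoef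

end Curves

end TypeII

namespace TypeII

variable {n n' : ℕ} {f g : Matrix (Fin n) (Fin n) ℂ → Matrix (Fin n') (Fin n') ℂ}

section Families

variable {Y ι : Type*} [Fintype ι] [DecidableEq ι] {A : Subalgebra ℂ (Y → ℂ)}

lemma EntriesIn.num_family {P : Y → Matrix (ι ⊕ ι) (ι ⊕ ι) ℂ} {γ : Y → Matrix ι ι ℂ}
    (hP : EntriesIn A P) (hγ : EntriesIn A γ) : EntriesIn A fun y => num (P y) (γ y) :=
  EntriesIn.add (EntriesIn.mul (γ := fun y => (P y).toBlocks₁₁) (fun _ _ => hP _ _) hγ)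
    (fun _ _ => hP _ _)

lemma EntriesIn.den_family {P : Y → Matrix (ι ⊕ ι) (ι ⊕ ι) ℂ} {γ : Y → Matrix ι ι ℂ}
    (hP : EntriesIn A P) (hγ : EntriesIn A γ) : EntriesIn A fun y => den (P y) (γ y) :=
  EntriesIn.add (EntriesIn.mul (γ := fun y => (P y).toBlocks₂₁) (fun _ _ => hP _ _) hγ)
    (fun _ _ => hP _ _)

end Families

lemma act_eq_smul {ι : Type*} [Fintype ι] [DecidableEq ι] (T : Matrix (ι ⊕ ι) (ι ⊕ ι) ℂ)
    (Z : Matrix ι ι ℂ) : act T Z = (den T Z).det⁻¹ • (num T Z * (den T Z).adjugate) := by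
  rw [act, Matrix.inv_def, Ring.inverse_eq_inv', mul_smul_comm]

/-- Two polynomial maps between type II domains, fixing the origin and intertwined by
linear fractional automorphisms. -/
structure Intertwined (f g : Matrix (Fin n) (Fin n) ℂ → Matrix (Fin n') (Fin n') ℂ)
    (T : Matrix (Fin n ⊕ Fin n) (Fin n ⊕ Fin n) ℂ)
    (S : Matrix (Fin n' ⊕ Fin n') (Fin n' ⊕ Fin n') ℂ) : Prop where
  polyf : IsPolyMapII f
  polyg : IsPolyMapII g
  mapsf : Set.MapsTo f (OmegaII n) (OmegaII n')
  mapsg : Set.MapsTo g (OmegaII n) (OmegaII n')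
  zerof : f 0 = 0
  zerog : g 0 = 0
  inT : InG T
  inS : InG S
  rel : ∀ z ∈ OmegaII n, f z = act S (g (act T z))

/-- A tripotent spanning the direction of the largest singular value of the image of the
origin. -/
structure IsAxis (T : Matrix (Fin n ⊕ Fin n) (Fin n ⊕ Fin n) ℂ) (e : Matrix (Fin n) (Fin n) ℂ)
    (a : ℝ) : Prop where
  trip : IsTripotent e
  pos : 0 < a
  lt : a < 1
  gram : (act T 0)ᴴ * e = (a : ℂ) • (eᴴ * e)
  opn_le : opn (act T 0) ≤ a

variable {T : Matrix (Fin n ⊕ Fin n) (Fin n ⊕ Fin n) ℂ}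
  {S : Matrix (Fin n' ⊕ Fin n') (Fin n' ⊕ Fin n') ℂ} {e : Matrix (Fin n) (Fin n) ℂ} {a : ℝ}

lemma smul_mem_OmegaII {Z : Matrix (Fin n) (Fin n) ℂ} (hZ : Zᵀ = -Z) (h : opn Z ≤ 1) {z : ℂ}
    (hz : z ∈ Metric.ball (0 : ℂ) 1) : z • Z ∈ OmegaII n := by
  rw [mem_OmegaII_iff, transpose_smul, hZ, smul_neg, opn_smul]
  rw [mem_ball_zero_iff] at hz
  exact ⟨rfl, lt_of_le_of_lt (mul_le_of_le_one_right (norm_nonneg _) h) hz⟩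

lemma IsTripotent.smul_mem (he : IsTripotent e) {z : ℂ} (hz : z ∈ Metric.ball (0 : ℂ) 1) :
    z • e ∈ OmegaII n := smul_mem_OmegaII he.antisymm he.opn_le hz

lemma IsAxis.den_inv (h : IsAxis T e a) (hT : InG T) (z : ℂ) :
    den T⁻¹ (z • e) = (den T 0)ᴴ * (1 + ((1 - a * z) - 1) • (eᴴ * e)) := by
  rw [hT.den_inv, mul_smul_comm, h.gram, smul_smul]
  congr 1
  module

lemma isUnit_det_den_zero {ι : Type*} [Fintype ι] [DecidableEq ι]
    {T : Matrix (ι ⊕ ι) (ι ⊕ ι) ℂ} (hT : InG T) : IsUnit (den T 0).det :=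
  hT.isUnit_den (by rw [opn_zero]; exact one_pos)

lemma IsAxis.isUnit_den_inv (h : IsAxis T e a) (hT : InG T) {z : ℂ} (hz : 1 - a * z ≠ 0) :
    IsUnit (den T⁻¹ (z • e)).det := by
  rw [h.den_inv hT, det_mul, det_conjTranspose]
  exact ((isUnit_det_den_zero hT).star).mul (h.trip.isUnit_one_add hz)

lemma Intertwined.num_eq (h : Intertwined f g T S) (he : IsAxis T e a) {z : ℂ}
    (hz : 1 - a * z ≠ 0) :
    num S (g (z • e)) = f (act T⁻¹ (z • e)) * den S (g (z • e)) := by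
  have hγ : EntriesIn PF1 fun z : ℂ => z • e := EntriesIn.smul id_mem_PF1 (EntriesIn.const e)
  have hg : EntriesIn PF1 fun z : ℂ => g (z • e) := hγ.comp h.polyg
  have hd := ((EntriesIn.const T⁻¹).den_family hγ).det
  obtain ⟨K, H, hH, hH'⟩ := exists_clear h.polyf
    (((EntriesIn.const T⁻¹).num_family hγ).mul ((EntriesIn.const T⁻¹).den_family hγ).adjugate) hd
  have key := EntriesIn.eq_of_infinite
    (EntriesIn.smul (pow_mem' hd K) ((EntriesIn.const S).num_family hg))
    (hH.mul ((EntriesIn.const S).den_family hg)) (infinite_ball one_pos) (fun w hw => ?_) z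
  · have hne := (he.isUnit_den_inv h.inT hz).ne_zero
    rw [hH' z hne, ← act_eq_smul, smul_mul_assoc] at key
    exact smul_right_injective _ (pow_ne_zero K hne) key
  · have hmem := he.trip.smul_mem hw
    have hmem' := mem_OmegaII_iff.1 hmem
    have hne := (h.inT.inv.isUnit_den hmem'.2).ne_zero
    rw [hH' w hne, ← act_eq_smul, smul_mul_assoc, h.rel _ (h.inT.inv.mapsTo hmem),
      h.inT.act_act_inv hmem'.2, act, Matrix.mul_assoc, Matrix.nonsing_inv_mul, Matrix.mul_one]
    exact h.inS.isUnit_den (mem_OmegaII_iff.1 (h.mapsg hmem)).2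

lemma Intertwined.inv_mul (h : Intertwined f g T S) (he : IsAxis T e a) {z : ℂ}
    (hz : 1 - a * z ≠ 0) :
    num S⁻¹ (f (act T⁻¹ (z • e))) * den S (g (z • e)) = g (z • e) ∧
      den S⁻¹ (f (act T⁻¹ (z • e))) * den S (g (z • e)) = 1 := by
  have h1 : S * aug (g (z • e)) = aug (f (act T⁻¹ (z • e))) * den S (g (z • e)) := by
    rw [mul_fromRows_one, aug_mul, h.num_eq he hz]
  have h2 : aug (g (z • e)) = S⁻¹ * aug (f (act T⁻¹ (z • e))) * den S (g (z • e)) := by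
    rw [Matrix.mul_assoc, ← h1, ← Matrix.mul_assoc, Matrix.nonsing_inv_mul _ h.inS.isUnit_det,
      Matrix.one_mul]
  rw [mul_fromRows_one, fromRows_mul, aug] at h2
  obtain ⟨h3, h4⟩ := fromRows_inj h2
  exact ⟨h3.symm, h4.symm⟩

/-- The image of the origin on the target side. -/
lemma Intertwined.act_inv_zero (h : Intertwined f g T S) : act S⁻¹ 0 = g (act T 0) := by
  have h0 := h.rel 0 (zero_mem_OmegaII n)
  rw [h.zerof] at h0
  rw [h0]
  exact h.inS.act_inv_act (mem_OmegaII_iff.1 (h.mapsg (h.inT.mapsTo (zero_mem_OmegaII n)))).2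

lemma Intertwined.den_eq (h : Intertwined f g T S) (W : Matrix (Fin n') (Fin n') ℂ) :
    den S W = (den S⁻¹ 0)ᴴ * (1 - (g (act T 0))ᴴ * W) := by
  have h1 := h.inS.inv.den_inv W
  rwa [Matrix.nonsing_inv_nonsing_inv _ h.inS.isUnit_det, h.act_inv_zero] at h1

lemma Intertwined.exists_det_eq (h : Intertwined f g T S) (he : IsAxis T e a) :
    ∃ m : ℕ, ∀ z : ℂ, (1 - (g (act T 0))ᴴ * g (z • e)).det = (1 - a * z) ^ m := by
  have hγ : EntriesIn PF1 fun z : ℂ => z • e := EntriesIn.smul id_mem_PF1 (EntriesIn.const e)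
  have ha : (a : ℂ) ≠ 0 := by exact_mod_cast he.pos.ne'
  refine exists_pow_of_ne_zero (u := fun z => (1 - (g (act T 0))ᴴ * g (z • e)).det)
    ((EntriesIn.const 1).sub ((EntriesIn.const _).mul (hγ.comp h.polyg))).det ?_
    ha ?_
  · simp [h.zerog]
  · intro z hz h0
    have hz' : 1 - a * z ≠ 0 := by
      intro h1
      apply hz
      field_simp
      linear_combination -h1
    have h1 := congrArg det (h.inv_mul he hz').2
    rw [h.den_eq, det_mul, det_mul, h0] at h1
    simp at h1

end TypeII

namespace TypeII

variable {n n' : ℕ} {f g : Matrix (Fin n) (Fin n) ℂ → Matrix (Fin n') (Fin n') ℂ}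
  {T : Matrix (Fin n ⊕ Fin n) (Fin n ⊕ Fin n) ℂ}
  {S : Matrix (Fin n' ⊕ Fin n') (Fin n' ⊕ Fin n') ℂ} {e : Matrix (Fin n) (Fin n) ℂ} {a : ℝ}

lemma IsAxis.act_inv_eq (he : IsAxis T e a) (hT : InG T) {z : ℂ} (hz : 1 - a * z ≠ 0) :
    act T⁻¹ (z • e) = ((z * (1 - a * z)⁻¹) • (T⁻¹.toBlocks₁₁ * e) +
      T⁻¹.toBlocks₁₂ * (1 + ((1 - a * z)⁻¹ - 1) • (eᴴ * e))) * ((den T 0)ᴴ)⁻¹ := by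
  set x : ℂ := 1 - a * z with hx
  have h1 : (den T⁻¹ (z • e))⁻¹ = (1 + (x⁻¹ - 1) • (eᴴ * e)) * ((den T 0)ᴴ)⁻¹ := by
    rw [he.den_inv hT, Matrix.mul_inv_rev]
    congr 1
    refine Matrix.inv_eq_left_inv ?_
    rw [he.trip.one_add_mul, inv_mul_cancel₀ hz, sub_self, zero_smul, add_zero]
  rw [act, h1, ← Matrix.mul_assoc]
  congr 1
  rw [num, add_mul, mul_smul_comm, smul_mul_assoc, Matrix.mul_assoc, he.trip.mul_one_add,
    mul_smul_comm, smul_smul]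

lemma Intertwined.exists_det_one_add (h : Intertwined f g T S) (he : IsAxis T e a) {m : ℕ}
    (hm : ∀ z : ℂ, (1 - (g (act T 0))ᴴ * g (z • e)).det = (1 - a * z) ^ m)
    (R : Matrix (Fin n') (Fin n') ℂ) :
    ∃ p : Polynomial ℂ, p.natDegree ≤ m ∧ ∀ z : ℂ, (1 + R * g (z • e)).det = p.eval z := by
  have hγ : EntriesIn PF1 fun z : ℂ => z • e := EntriesIn.smul id_mem_PF1 (EntriesIn.const e)
  obtain ⟨p, hp⟩ := exists_polynomial
    ((EntriesIn.const 1).add ((EntriesIn.const R).mul (hγ.comp h.polyg))).det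
  refine ⟨p, ?_, hp⟩
  have hw : EntriesIn PF2 fun y : ℂ × ℂ => f ((y.1 • (T⁻¹.toBlocks₁₁ * e) +
      T⁻¹.toBlocks₁₂ * (1 + (y.2 - 1) • (eᴴ * e))) * ((den T 0)ᴴ)⁻¹) :=
    EntriesIn.comp h.polyf (((EntriesIn.smul fst_mem_PF2 (EntriesIn.const _)).add
      ((EntriesIn.const _).mul ((EntriesIn.const 1).add (EntriesIn.smul
        (PF2.sub_mem snd_mem_PF2 (const_mem 1)) (EntriesIn.const _))))).mul (EntriesIn.const _))
  have hc := PF2.continuous (((EntriesIn.const S⁻¹).den_family hw).add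
    ((EntriesIn.const R).mul ((EntriesIn.const S⁻¹).num_family hw))).det
  obtain ⟨C, hC⟩ := (isCompact_closedBall (0 : ℂ × ℂ) (1 + 2 / a)).exists_bound_of_continuousOn
    hc.continuousOn
  have ha := he.pos
  have hC0 : 0 ≤ C := (norm_nonneg _).trans (hC 0 (by simp; positivity))
  refine natDegree_le_of_growth (C := C * ‖star (den S⁻¹ 0).det‖) ?_
  filter_upwards [Filter.eventually_ge_atTop (2 / a)] with x hx
  have hx0 : 0 < x := lt_of_lt_of_le (by positivity) hx
  have hax : 2 ≤ a * x := by rwa [div_le_iff₀' ha] at hx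
  have hne : (1 : ℂ) - a * x ≠ 0 := by
    intro h0
    have : (1 : ℝ) - a * x = 0 := by exact_mod_cast h0
    linarith
  have hnorm : ‖(1 : ℂ) - a * x‖ = a * x - 1 := by
    have : (1 : ℂ) - a * x = ((1 - a * x : ℝ) : ℂ) := by push_cast; ring
    rw [this, Complex.norm_real, Real.norm_eq_abs, abs_of_neg (by linarith)]
    ring
  obtain ⟨h1, h2⟩ := h.inv_mul he hne
  have h3 : 1 + R * g ((x : ℂ) • e) = (den S⁻¹ (f (act T⁻¹ ((x : ℂ) • e))) +
      R * num S⁻¹ (f (act T⁻¹ ((x : ℂ) • e)))) * den S (g ((x : ℂ) • e)) := by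
    rw [add_mul, h2, Matrix.mul_assoc, h1]
  have h4 : (den S (g ((x : ℂ) • e))).det = star (den S⁻¹ 0).det * (1 - a * x) ^ m := by
    rw [h.den_eq, det_mul, hm, det_conjTranspose]
  rw [← hp, h3, det_mul, h4, he.act_inv_eq h.inT hne, norm_mul, norm_mul, norm_pow, hnorm,
    ← mul_assoc]
  have h5 : ‖((1 : ℂ) - a * x)⁻¹‖ ≤ 1 := by
    rw [norm_inv, hnorm]
    exact inv_le_one_of_one_le₀ (by linarith)
  have h6 : ‖(x : ℂ) * ((1 : ℂ) - a * x)⁻¹‖ ≤ 2 / a := by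
    rw [norm_mul, norm_inv, hnorm, Complex.norm_real, Real.norm_eq_abs, abs_of_pos hx0,
      ← div_eq_mul_inv, div_le_div_iff₀ (by linarith) ha]
    linarith
  have h2a : 0 < 2 / a := by positivity
  have h7 := hC ((x : ℂ) * ((1 : ℂ) - a * x)⁻¹, ((1 : ℂ) - a * x)⁻¹) (by
    rw [mem_closedBall_zero_iff, Prod.norm_def]
    exact max_le (by linarith) (by linarith))
  have h8 : (a * x - 1) ^ m ≤ x ^ m := by
    refine pow_le_pow_left₀ (by linarith) ?_ m
    nlinarith [he.lt]
  gcongr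
  exact pow_nonneg (by linarith) m

end TypeII

namespace TypeII

variable {n n' : ℕ} {f g : Matrix (Fin n) (Fin n) ℂ → Matrix (Fin n') (Fin n') ℂ}
  {T : Matrix (Fin n ⊕ Fin n) (Fin n ⊕ Fin n) ℂ}
  {S : Matrix (Fin n' ⊕ Fin n') (Fin n' ⊕ Fin n') ℂ} {e : Matrix (Fin n) (Fin n) ℂ} {a : ℝ}

/-- The Schwarz lemma for polynomial maps along complex lines. -/
lemma opn_apply_smul_le (hg : IsPolyMapII g) (hmaps : Set.MapsTo g (OmegaII n) (OmegaII n'))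
    (h0 : g 0 = 0) {Z : Matrix (Fin n) (Fin n) ℂ} (hZ : Zᵀ = -Z) (hZ1 : opn Z ≤ 1) {z : ℂ}
    (hz : z ∈ Metric.ball (0 : ℂ) 1) : opn (g (z • Z)) ≤ ‖z‖ :=
  opn_le_norm_of_curve (F := fun z => g (z • Z))
    ((EntriesIn.smul id_mem_PF1 (EntriesIn.const Z)).comp hg).differentiable.differentiableOn
    (fun _ hw => (mem_OmegaII_iff.1 (hmaps (smul_mem_OmegaII hZ hZ1 hw))).2.le)
    (by simp [h0]) hz

lemma opn_le_one_of_smul {γ : ℂ → Matrix (Fin n) (Fin n) ℂ} (hγ : Continuous γ)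
    (h : ∀ z ∈ Metric.ball (0 : ℂ) 1, opn (z • γ z) ≤ ‖z‖) {z : ℂ}
    (hz : z ∈ Metric.ball (0 : ℂ) 1) : opn (γ z) ≤ 1 := by
  have h1 : ∀ w ∈ Metric.ball (0 : ℂ) 1, w ≠ 0 → opn (γ w) ≤ 1 := by
    intro w hw hw0
    have := h w hw
    rw [opn_smul] at this
    exact le_of_mul_le_mul_left (by rwa [mul_one]) (norm_pos_iff.2 hw0)
  rcases eq_or_ne z 0 with rfl | hz0
  swap
  · exact h1 z hz hz0
  refine le_of_tendsto (x := nhdsWithin 0 {0}ᶜ) (f := fun w => opn (γ w))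
    (((continuous_opn.comp hγ).tendsto 0).mono_left nhdsWithin_le_nhds) ?_
  filter_upwards [self_mem_nhdsWithin,
    mem_nhdsWithin_of_mem_nhds (Metric.isOpen_ball.mem_nhds hz)] with w hw0 hw
  exact h1 w hw hw0

lemma Intertwined.opn_le (h : Intertwined f g T S) (he : IsAxis T e a) :
    opn (g (act T 0)) ≤ a := by
  have ha : (a : ℂ) ≠ 0 := by exact_mod_cast he.pos.ne'
  have h1 := mem_OmegaII_iff.1 (h.inT.mapsTo (zero_mem_OmegaII n))
  have h2 := opn_apply_smul_le h.polyg h.mapsg h.zerog (Z := (a : ℂ)⁻¹ • act T 0) (z := a)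
    (by rw [transpose_smul, h1.1, smul_neg]) (by
      rw [opn_smul, norm_inv, Complex.norm_real, Real.norm_eq_abs, abs_of_pos he.pos,
        inv_mul_le_iff₀ he.pos, mul_one]
      exact he.opn_le) (by simpa [abs_of_pos he.pos] using he.lt)
  rwa [smul_smul, mul_inv_cancel₀ ha, one_smul, Complex.norm_real, Real.norm_eq_abs,
    abs_of_pos he.pos] at h2

lemma Intertwined.exists_tripotent (h : Intertwined f g T S) (he : IsAxis T e a) :
    ∃ (m : ℕ) (V : Matrix (Fin n') (Fin n') ℂ), IsTripotent V ∧ (∀ z : ℂ, g (z • e) = z • V) ∧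
      (∀ z : ℂ, (1 - z • ((g (act T 0))ᴴ * V)).det = (1 - a * z) ^ m) ∧
      ∀ x : ℂ, (1 + (x - 1) • (Vᴴ * V)).det = x ^ m := by
  have ha : (a : ℂ) ≠ 0 := by exact_mod_cast he.pos.ne'
  obtain ⟨m, hm⟩ := h.exists_det_eq he
  have hge : EntriesIn PF1 fun z : ℂ => g (z • e) :=
    EntriesIn.comp h.polyg (EntriesIn.smul id_mem_PF1 (EntriesIn.const e))
  obtain ⟨γ, hγ, hgγ⟩ := hge.exists_smul (by simp [h.zerog])
  set b := g (act T 0) with hb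
  set L := γ 0 with hL
  have htr : trace (bᴴ * L) = m * a :=
    trace_of_det_eq_pow (γ := fun z => bᴴ * γ z) ((EntriesIn.const _).mul hγ) fun z => by
      rw [← mul_smul_comm, ← hgγ, hm]
  have hγ1 : ∀ z ∈ Metric.ball (0 : ℂ) 1, opn (γ z) ≤ 1 := fun z hz =>
    opn_le_one_of_smul hγ.differentiable.continuous (fun w hw => by
      rw [← hgγ]
      exact opn_apply_smul_le h.polyg h.mapsg h.zerog he.trip.antisymm he.trip.opn_le hw) hz
  have hdeg : ∀ (R : Matrix (Fin n') (Fin n') ℂ) (z : ℂ), ∃ p : Polynomial ℂ,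
      p.natDegree ≤ m ∧ ∀ x : ℂ, (1 + x • (R * γ z)).det = p.eval x := fun R z =>
    natDegree_det_of_homogeneous hγ R (fun c => by
      obtain ⟨p, hp, hp'⟩ := h.exists_det_one_add he hm (c • R)
      exact ⟨p, hp, fun w => by rw [← hgγ, hp']⟩) z
  have hL1 : opn L ≤ 1 := hγ1 0 (Metric.mem_ball_self one_pos)
  obtain ⟨p, hp, hp'⟩ := hdeg Lᴴ 0
  have hY1 : opn ((a : ℂ)⁻¹ • b) ≤ 1 := by
    rw [opn_smul, norm_inv, Complex.norm_real, Real.norm_eq_abs, abs_of_pos he.pos,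
      inv_mul_le_iff₀ he.pos, mul_one]
    exact h.opn_le he
  have hstar : ((a : ℂ)⁻¹ • b)ᴴ = (a : ℂ)⁻¹ • bᴴ := by
    rw [conjTranspose_smul]
    simp
  obtain ⟨hid, hYL, htL⟩ := rigid_of_trace hL1 hY1 hp hp' (by
    rw [hstar, smul_mul_assoc, trace_smul, htr, smul_eq_mul]
    field_simp)
  have hLL := eq_of_gram_idempotent hid
  have hconst : ∀ z ∈ Metric.ball (0 : ℂ) 1, trace (Lᴴ * γ z) = m := by
    have hmem : (fun z => trace (Lᴴ * γ z)) ∈ PF1 := by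
      have : (fun z => trace (Lᴴ * γ z)) = ∑ i, fun z => (Lᴴ * γ z) i i := by
        funext z
        simp [trace, Finset.sum_apply]
      rw [this]
      exact PF1.sum_mem fun i _ => ((EntriesIn.const Lᴴ).mul hγ) i i
    have h1 := Complex.eqOn_of_isPreconnected_of_isMaxOn_norm
      (f := fun z => trace (Lᴴ * γ z)) (U := Metric.ball (0 : ℂ) 1) (c := 0)
      (convex_ball _ _).isPreconnected Metric.isOpen_ball
      (PF1.differentiable hmem).differentiableOn (Metric.mem_ball_self one_pos) (fun z hz => by
        change ‖trace (Lᴴ * γ z)‖ ≤ ‖trace (Lᴴ * γ 0)‖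
        rw [← hL, htL, Complex.norm_natCast]
        exact norm_trace_le hLL htL (hγ1 z hz))
    intro z hz
    exact (h1 hz).trans htL
  have hball : ∀ z ∈ Metric.ball (0 : ℂ) 1, γ z = L := by
    intro z hz
    obtain ⟨q, hq, hq'⟩ := hdeg (γ z)ᴴ z
    have h1 := re_trace_gram_le (hγ1 z hz) hq hq'
    have h2 := re_trace_sub (γ z) L
    rw [hconst z hz, htL, Complex.natCast_re] at h2
    have h3 := eq_zero_of_re_trace_nonpos (X := L - γ z) (by linarith)
    exact (sub_eq_zero.1 h3).symm
  have hall : ∀ z, γ z = L := hγ.eq_of_infinite (EntriesIn.const L) (infinite_ball one_pos) hball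
  have hg : ∀ z : ℂ, g (z • e) = z • L := fun z => by rw [hgγ, hall]
  have hdet : ∀ z : ℂ, (1 - z • (bᴴ * L)).det = (1 - a * z) ^ m := fun z => by
    rw [← mul_smul_comm, ← hg, hm]
  refine ⟨m, L, ⟨?_, hLL⟩, hg, hdet, fun x => ?_⟩
  · have hmem : (2 : ℂ)⁻¹ • e ∈ OmegaII n := he.trip.smul_mem (by
      rw [mem_ball_zero_iff, norm_inv, Complex.norm_ofNat]
      norm_num)
    have h1 := (mem_OmegaII_iff.1 (h.mapsg hmem)).1
    rw [hg, transpose_smul, ← smul_neg] at h1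
    exact smul_right_injective _ (inv_ne_zero two_ne_zero) h1
  · have h1 := hdet ((1 - x) * (a : ℂ)⁻¹)
    have h2 : Lᴴ * L * bᴴ = (a : ℂ) • Lᴴ := by
      have h3 := congrArg conjTranspose hYL
      rw [conjTranspose_mul, conjTranspose_mul, conjTranspose_conjTranspose, hstar,
        mul_smul_comm] at h3
      calc Lᴴ * L * bᴴ = (a : ℂ) • ((a : ℂ)⁻¹ • (Lᴴ * L * bᴴ)) := by
            rw [smul_smul, mul_inv_cancel₀ ha, one_smul]
        _ = (a : ℂ) • Lᴴ := by rw [h3]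
    have h4 : (1 - ((1 - x) * (a : ℂ)⁻¹) • (bᴴ * L)).det = (1 + (x - 1) • (Lᴴ * L)).det := by
      have h5 : bᴴ * L = bᴴ * L * (Lᴴ * L) := by
        rw [Matrix.mul_assoc, ← Matrix.mul_assoc L, hLL]
      rw [h5, sub_eq_add_neg, ← neg_smul, ← smul_mul_assoc, det_one_add_mul_comm,
        mul_smul_comm, ← Matrix.mul_assoc, h2, smul_mul_assoc, smul_smul]
      congr 3
      field_simp
      ring
    rw [← h4, h1]
    congr 1
    field_simp
    ring

end TypeII

namespace TypeII

section Rational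

variable {Y ι : Type*} [Fintype ι] [DecidableEq ι] {A : Subalgebra ℂ (Y → ℂ)}

lemma act_mul_den {T : Matrix (ι ⊕ ι) (ι ⊕ ι) ℂ} {Z : Matrix ι ι ℂ}
    (h : IsUnit (den T Z).det) : act T Z * den T Z = num T Z := by
  rw [act, Matrix.mul_assoc, Matrix.nonsing_inv_mul _ h, Matrix.mul_one]

lemma den_smul (c : ℂ) (T : Matrix (ι ⊕ ι) (ι ⊕ ι) ℂ) (Z : Matrix ι ι ℂ) :
    den (c • T) Z = c • den T Z := by
  rw [den, den, smul_add, ← smul_mul_assoc]; rfl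

lemma act_smul {c : ℂ} (hc : c ≠ 0) {T : Matrix (ι ⊕ ι) (ι ⊕ ι) ℂ} {Z : Matrix ι ι ℂ}
    (h : IsUnit (den T Z).det) : act (c • T) Z = act T Z := by
  refine act_eq_of_mul_fromRows (C := c • den T Z) ?_ ?_
  · rw [Matrix.smul_mul, mul_fromRows_act h, Matrix.mul_smul]
  · rw [det_smul]
    exact ((isUnit_iff_ne_zero.2 hc).pow _).mul h

lemma det_smul_ne_zero {c : ℂ} (hc : c ≠ 0) {M : Matrix ι ι ℂ} (h : IsUnit M.det) :
    (c • M).det ≠ 0 := by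
  rw [det_smul]
  exact mul_ne_zero (pow_ne_zero _ hc) h.ne_zero

/-- Clearing denominators in the composition of a polynomial map with two families of
linear fractional maps. -/
lemma exists_rational {n n' : ℕ} {f : Matrix (Fin n) (Fin n) ℂ → Matrix (Fin n') (Fin n') ℂ}
    (hf : IsPolyMapII f) {P : Y → Matrix (Fin n ⊕ Fin n) (Fin n ⊕ Fin n) ℂ}
    {Q : Y → Matrix (Fin n' ⊕ Fin n') (Fin n' ⊕ Fin n') ℂ} {γ : Y → Matrix (Fin n) (Fin n) ℂ}
    (hP : EntriesIn A P) (hQ : EntriesIn A Q) (hγ : EntriesIn A γ) :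
    ∃ (K : ℕ) (N : Y → Matrix (Fin n') (Fin n') ℂ) (d : Y → ℂ), EntriesIn A N ∧ d ∈ A ∧
      ∀ y, (den (P y) (γ y)).det ≠ 0 →
        d y = (den (P y) (γ y)).det ^ K * (den (Q y) (f (act (P y) (γ y)))).det ∧
        (IsUnit (den (Q y) (f (act (P y) (γ y)))).det →
          d y • act (Q y) (f (act (P y) (γ y))) = N y) := by
  have hδ := (hP.den_family hγ).det
  obtain ⟨K, H, hH, hH'⟩ := exists_clear hf ((hP.num_family hγ).mul (hP.den_family hγ).adjugate) hδ
  have hK := pow_mem' hδ K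
  have hU₁ : EntriesIn A fun y => (Q y).toBlocks₁₁ * H y +
      (den (P y) (γ y)).det ^ K • (Q y).toBlocks₁₂ :=
    (EntriesIn.mul (fun _ _ => hQ _ _) hH).add (EntriesIn.smul hK fun _ _ => hQ _ _)
  have hU₂ : EntriesIn A fun y => (Q y).toBlocks₂₁ * H y +
      (den (P y) (γ y)).det ^ K • (Q y).toBlocks₂₂ :=
    (EntriesIn.mul (fun _ _ => hQ _ _) hH).add (EntriesIn.smul hK fun _ _ => hQ _ _)
  refine ⟨K * Fintype.card (Fin n'), _, _, hU₁.mul hU₂.adjugate, hU₂.det, fun y hy => ?_⟩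
  have h1 : H y = (den (P y) (γ y)).det ^ K • f (act (P y) (γ y)) := by
    rw [hH' y hy, act_eq_smul]
  have h2 : (Q y).toBlocks₂₁ * H y + (den (P y) (γ y)).det ^ K • (Q y).toBlocks₂₂ =
      (den (P y) (γ y)).det ^ K • den (Q y) (f (act (P y) (γ y))) := by
    rw [h1, mul_smul_comm, ← smul_add]; rfl
  have h3 : (Q y).toBlocks₁₁ * H y + (den (P y) (γ y)).det ^ K • (Q y).toBlocks₁₂ =
      (den (P y) (γ y)).det ^ K • num (Q y) (f (act (P y) (γ y))) := by
    rw [h1, mul_smul_comm, ← smul_add]; rfl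
  refine ⟨?_, fun hu => ?_⟩
  · rw [h2, det_smul, pow_mul]
  · rw [h2, h3]
    have h4 : num (Q y) (f (act (P y) (γ y))) =
        act (Q y) (f (act (P y) (γ y))) * den (Q y) (f (act (P y) (γ y))) :=
      (act_mul_den hu).symm
    rw [h4, ← mul_smul_comm, Matrix.mul_assoc, Matrix.mul_adjugate, mul_smul_comm,
      Matrix.mul_one]

/-- The polynomial multiple `(2 * s) • tv s e` of a transvection. -/
def ptv (s : ℂ) (e : Matrix ι ι ℂ) : Matrix (ι ⊕ ι) (ι ⊕ ι) ℂ :=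
  fromBlocks ((2 * s) • 1 + (s ^ 2 + 1 - 2 * s) • (e * eᴴ)) ((s ^ 2 - 1) • e) ((s ^ 2 - 1) • eᴴ)
    ((2 * s) • 1 + (s ^ 2 + 1 - 2 * s) • (eᴴ * e))

lemma ptv_eq {s : ℂ} (hs : s ≠ 0) (e : Matrix ι ι ℂ) : ptv s e = (2 * s) • tv s e := by
  rw [ptv, tv, fromBlocks_smul, smul_add, smul_add, smul_smul, smul_smul, smul_smul, smul_smul,
    mul_sub, two_mul_ch hs, two_mul_sh hs, mul_one]

lemma tv_neg (s : ℂ) (e : Matrix ι ι ℂ) : tv s (-e) = tv s⁻¹ e := by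
  rw [tv, tv, ch_inv, sh_inv]
  simp

lemma EntriesIn.ptv {c : Y → ℂ} (hc : c ∈ A) (e : Matrix ι ι ℂ) :
    EntriesIn A fun y => ptv (c y) e := by
  have h1 : (fun y => 2 * c y) ∈ A := A.mul_mem (const_mem 2) hc
  have h2 : (fun y => c y ^ 2) ∈ A := pow_mem' hc 2
  have h3 : (fun y => c y ^ 2 - 1) ∈ A := A.sub_mem h2 (const_mem 1)
  have h4 : (fun y => c y ^ 2 + 1 - 2 * c y) ∈ A := A.sub_mem (A.add_mem h2 (const_mem 1)) h1
  have h5 : ∀ B : Matrix ι ι ℂ,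
      EntriesIn A fun y => (2 * c y) • (1 : Matrix ι ι ℂ) + (c y ^ 2 + 1 - 2 * c y) • B :=
    fun B => (EntriesIn.smul h1 (EntriesIn.const 1)).add (EntriesIn.smul h4 (EntriesIn.const B))
  have h6 : ∀ B : Matrix ι ι ℂ, EntriesIn A fun y => (c y ^ 2 - 1) • B :=
    fun B => EntriesIn.smul h3 (EntriesIn.const B)
  rintro (i | i) (j | j)
  exacts [h5 _ i j, h6 _ i j, h6 _ i j, h5 _ i j]

end Rational

variable {n n' : ℕ} {f g : Matrix (Fin n) (Fin n) ℂ → Matrix (Fin n') (Fin n') ℂ}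

lemma IsPolyMapII.differentiable (hf : IsPolyMapII f) : Differentiable ℂ f := by
  refine differentiableOn_univ.1 (differentiableOn_matrix fun i j => ?_)
  obtain ⟨p, hp⟩ := hf i j
  simp only [hp]
  rw [differentiableOn_univ]
  clear hp
  induction p using MvPolynomial.induction_on with
  | C a => simp
  | add p q hp hq =>
    simp only [map_add]
    exact hp.add hq
  | mul_X p q hp =>
    simp only [map_mul, MvPolynomial.eval_X]
    exact hp.mul (differentiableOn_univ.1 (differentiableOn_entry differentiableOn_id q.1 q.2))

end TypeII

namespace TypeII

variable {n n' : ℕ} {f g : Matrix (Fin n) (Fin n) ℂ → Matrix (Fin n') (Fin n') ℂ}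
  {T : Matrix (Fin n ⊕ Fin n) (Fin n ⊕ Fin n) ℂ}
  {S : Matrix (Fin n' ⊕ Fin n') (Fin n' ⊕ Fin n') ℂ} {e : Matrix (Fin n) (Fin n) ℂ} {a : ℝ}
  {V : Matrix (Fin n') (Fin n') ℂ}

lemma ofReal_ne_zero_of_pos {s : ℝ} (hs : 0 < s) : (s : ℂ) ≠ 0 := by exact_mod_cast hs.ne'

lemma IsTripotent.neg (he : IsTripotent e) : IsTripotent (-e) :=
  ⟨by rw [transpose_neg, he.antisymm], by
    rw [conjTranspose_neg, neg_mul_neg, mul_neg, he.tripotent]⟩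

lemma IsTripotent.isUnit_den_tv (hV : IsTripotent V) {s : ℂ} (hs : s ≠ 0) (hc : ch s ≠ 0) :
    den (tv s⁻¹ V) ((sh s / ch s) • V) * (1 + (ch s - 1) • (Vᴴ * V)) = 1 := by
  have h1 : aug (0 : Matrix (Fin n') (Fin n') ℂ) =
      tv s⁻¹ V * aug ((sh s / ch s) • V) * (1 + (ch s - 1) • (Vᴴ * V)) := by
    rw [Matrix.mul_assoc, ← hV.tv_aug_zero hc, ← Matrix.mul_assoc, hV.tv_inv_mul hs,
      Matrix.one_mul]
  rw [mul_fromRows_one, fromRows_mul, aug] at h1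
  exact (fromRows_inj h1).2.symm

lemma exists_rep_one (hg : IsPolyMapII g) (hmaps : Set.MapsTo g (OmegaII n) (OmegaII n'))
    (he : IsTripotent e) (hV : IsTripotent V) (hgV : ∀ z : ℂ, g (z • e) = z • V)
    {Z : Matrix (Fin n) (Fin n) ℂ} (hZ : Z ∈ OmegaII n) (i j : Fin n') :
    ∃ n ∈ PF2, ∃ d ∈ PF2, (∀ s : ℝ, 0 < s → ∀ z ∈ Metric.ball (0 : ℂ) 1,
      d ((s : ℂ), z) * act (tv (s : ℂ)⁻¹ V) (g (act (tv (s : ℂ) e) (z • Z))) i j =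
        n ((s : ℂ), z)) ∧ ∀ s, d (s, 0) = 0 → s = 0 ∨ s ^ 2 = -1 := by
  have hZ' := mem_OmegaII_iff.1 hZ
  obtain ⟨K, N, d, hN, hd, h⟩ := exists_rational (A := PF2) (P := fun y => ptv y.1 e)
    (Q := fun y => ptv y.1 (-V)) (γ := fun y => y.2 • Z) hg (EntriesIn.ptv fst_mem_PF2 e)
    (EntriesIn.ptv fst_mem_PF2 _) (EntriesIn.smul snd_mem_PF2 (EntriesIn.const Z))
  refine ⟨_, hN i j, d, hd, fun s hs z hz => ?_, fun s h0 => ?_⟩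
  · have hs' := ofReal_ne_zero_of_pos hs
    have h2s : 2 * (s : ℂ) ≠ 0 := mul_ne_zero two_ne_zero hs'
    have hw := smul_mem_OmegaII hZ'.1 hZ'.2.le hz
    have h1 := (he.inG hs).isUnit_den (mem_OmegaII_iff.1 hw).2
    have hw' := hmaps ((he.inG hs).mapsTo hw)
    have h2 := (hV.neg.inG hs).isUnit_den (mem_OmegaII_iff.1 hw').2
    have h3 := h ((s : ℂ), z)
    simp only [ptv_eq hs'] at h3
    rw [den_smul, act_smul h2s h1, den_smul, act_smul h2s h2] at h3
    have h4 := (h3 (det_smul_ne_zero h2s h1)).2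
      (isUnit_iff_ne_zero.2 (det_smul_ne_zero h2s h2))
    rw [tv_neg] at h4
    exact congrFun (congrFun h4 i) j
  · by_contra! hne
    obtain ⟨hs, hs2⟩ := hne
    have h2s : 2 * s ≠ 0 := mul_ne_zero two_ne_zero hs
    have hc : ch s ≠ 0 := by
      intro hc
      have := two_mul_ch hs
      rw [hc, mul_zero] at this
      exact hs2 (by linear_combination -this)
    have h1 : IsUnit (den (tv s e) 0).det := by
      rw [den_tv_zero]
      exact he.isUnit_one_add hc
    have h2 : IsUnit (den (tv s⁻¹ V) ((sh s / ch s) • V)).det :=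
      (Matrix.isUnit_iff_isUnit_det _).1 (IsUnit.of_mul_eq_one _ (hV.isUnit_den_tv hs hc))
    have h3 := h (s, 0)
    simp only [ptv_eq hs, zero_smul] at h3
    rw [den_smul, act_smul h2s h1, den_smul, he.act_tv_zero hc, hgV, tv_neg] at h3
    have h4 := (h3 (det_smul_ne_zero h2s h1)).1
    rw [h0] at h4
    exact mul_ne_zero (pow_ne_zero _ (det_smul_ne_zero h2s h1)) (det_smul_ne_zero h2s h2) h4.symm

lemma IsAxis.den_inv_mul_tv (he : IsAxis T e a) (hT : InG T) (s : ℂ) :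
    den (T⁻¹ * tv s e) 0 = (den T 0)ᴴ * (1 + ((ch s - a * sh s) - 1) • (eᴴ * e)) := by
  have h0 := hT.den_inv 0
  have h1 := he.den_inv hT 1
  rw [den_zero, mul_zero, sub_zero, mul_one] at h0
  rw [den, h0, one_smul, mul_one] at h1
  have h2 : T⁻¹.toBlocks₂₁ * e = -((a : ℂ) • ((den T 0)ᴴ * (eᴴ * e))) := by
    rw [eq_sub_of_add_eq h1, mul_add, mul_one, mul_smul_comm]
    module
  have h3 : T⁻¹ * tv s e * aug (0 : Matrix (Fin n) (Fin n) ℂ) =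
      T⁻¹ * fromRows (sh s • e) (1 + (ch s - 1) • (eᴴ * e)) := by
    rw [Matrix.mul_assoc, mul_fromRows_one, num_tv_zero, den_tv_zero]
  rw [mul_fromRows_one, mul_fromRows_eq, h0, mul_smul_comm, mul_smul_comm, h2] at h3
  rw [(fromRows_inj h3).2, mul_add, mul_add, mul_one, mul_smul_comm, mul_smul_comm]
  module

lemma Intertwined.exists_rep_two (h : Intertwined f g T S) (he : IsAxis T e a)
    (hV : IsTripotent V) (hgV : ∀ z : ℂ, g (z • e) = z • V) {m : ℕ}
    (hm : ∀ z : ℂ, (1 - z • ((g (act T 0))ᴴ * V)).det = (1 - a * z) ^ m)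
    (hm' : ∀ x : ℂ, (1 + (x - 1) • (Vᴴ * V)).det = x ^ m)
    {Z : Matrix (Fin n) (Fin n) ℂ} (hZ : Z ∈ OmegaII n) (i j : Fin n') :
    ∃ n ∈ PF2, ∃ d ∈ PF2, (∀ s : ℝ, 0 < s → ∀ z ∈ Metric.ball (0 : ℂ) 1,
      d ((s : ℂ), z) * act (tv (s : ℂ)⁻¹ V) (g (act (tv (s : ℂ) e) (z • Z))) i j =
        n ((s : ℂ), z)) ∧ ∀ s, d (s, 0) = 0 → s = 0 ∨ s ^ 2 ≠ -1 := by
  have hZ' := mem_OmegaII_iff.1 hZ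
  have hP : EntriesIn PF2 fun y : ℂ × ℂ => T⁻¹ * ptv y.1 e :=
    (EntriesIn.const _).mul (EntriesIn.ptv fst_mem_PF2 e)
  have hγ : EntriesIn PF2 fun y : ℂ × ℂ => y.2 • Z :=
    EntriesIn.smul snd_mem_PF2 (EntriesIn.const Z)
  obtain ⟨K, N, d, hN, hd, hNd⟩ := exists_rational (A := PF2) (P := fun y => T⁻¹ * ptv y.1 e)
    (Q := fun y => ptv y.1 (-V) * S⁻¹) h.polyf hP
    ((EntriesIn.ptv fst_mem_PF2 _).mul (EntriesIn.const _)) hγ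
  have hdelta : ∀ s : ℂ, s ≠ 0 → ch s - a * sh s ≠ 0 →
      (den (T⁻¹ * ptv s e) 0).det ≠ 0 := by
    intro s hs hx
    rw [ptv_eq hs, mul_smul_comm, den_smul, he.den_inv_mul_tv h.inT]
    refine det_smul_ne_zero (mul_ne_zero two_ne_zero hs) ?_
    rw [det_mul, det_conjTranspose]
    exact (isUnit_det_den_zero h.inT).star.mul (he.trip.isUnit_one_add hx)
  have main : ∀ s : ℝ, 0 < s → ∀ z ∈ Metric.ball (0 : ℂ) 1,
      (den (T⁻¹ * ptv s e) (z • Z)).det ≠ 0 ∧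
      act (T⁻¹ * ptv s e) (z • Z) = act T⁻¹ (act (tv (s : ℂ) e) (z • Z)) ∧
      f (act T⁻¹ (act (tv (s : ℂ) e) (z • Z))) = act S (g (act (tv (s : ℂ) e) (z • Z))) ∧
      act (tv s e) (z • Z) ∈ OmegaII n := by
    intro s hs z hz
    have hs' := ofReal_ne_zero_of_pos hs
    have h2s : 2 * (s : ℂ) ≠ 0 := mul_ne_zero two_ne_zero hs'
    have hw := smul_mem_OmegaII hZ'.1 hZ'.2.le hz
    have hw2 := (mem_OmegaII_iff.1 hw).2
    have h1 := (h.inT.inv.mul (he.trip.inG hs)).isUnit_den hw2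
    have hv := (he.trip.inG hs).mapsTo hw
    refine ⟨?_, ?_, ?_, hv⟩
    · rw [ptv_eq hs', mul_smul_comm, den_smul]
      exact det_smul_ne_zero h2s h1
    · rw [ptv_eq hs', mul_smul_comm, act_smul h2s h1, h.inT.inv.act_mul (he.trip.inG hs) hw2]
    · rw [h.rel _ (h.inT.inv.mapsTo hv), h.inT.act_act_inv (mem_OmegaII_iff.1 hv).2]
  refine ⟨_, hN i j, d, hd, fun s hs z hz => ?_, fun s h0 => ?_⟩
  · have hs' := ofReal_ne_zero_of_pos hs
    have h2s : 2 * (s : ℂ) ≠ 0 := mul_ne_zero two_ne_zero hs'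
    obtain ⟨h1, h2, h3, h4⟩ := main s hs z hz
    have hy := h.mapsg h4
    have hy2 := (mem_OmegaII_iff.1 hy).2
    have hSy := h.inS.opn_act_lt hy2
    have hQ := (hV.neg.inG hs).mul h.inS.inv
    have h5 := hQ.isUnit_den hSy
    have h6 := hNd ((s : ℂ), z)
    simp only [h2, h3, ptv_eq hs' (-V), smul_mul_assoc] at h6
    rw [den_smul, act_smul h2s h5, (hV.neg.inG hs).act_mul h.inS.inv hSy,
      h.inS.act_inv_act hy2, tv_neg] at h6
    rw [tv_neg] at h5
    exact congrFun (congrFun ((h6 h1).2 (isUnit_iff_ne_zero.2 (det_smul_ne_zero h2s h5))) i) j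
  · by_contra! hne
    obtain ⟨hs, hs2⟩ := hne
    have hpoly : (fun s => d (s, 0) * (star (den S⁻¹ 0).det *
        (s ^ 2 + 1 - a * (s ^ 2 - 1)) ^ m)) = fun s : ℂ =>
        (den (T⁻¹ * ptv s e) 0).det ^ K * ((2 * s) ^ n' * (2 * s) ^ m) := by
      have hid2 : (fun s : ℂ => s ^ 2) ∈ PF1 := pow_mem' id_mem_PF1 2
      have h2id : (fun s : ℂ => 2 * s) ∈ PF1 := PF1.mul_mem (const_mem 2) id_mem_PF1
      refine PF1.eq_of_infinite (PF1.mul_mem (PF2.slice_left hd 0) (PF1.mul_mem (const_mem _)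
        (pow_mem' (PF1.sub_mem (PF1.add_mem hid2 (const_mem 1)) (PF1.mul_mem (const_mem _)
          (PF1.sub_mem hid2 (const_mem 1)))) m)))
        (PF1.mul_mem (pow_mem' (EntriesIn.den_family ((EntriesIn.const _).mul
          (EntriesIn.ptv id_mem_PF1 e)) (EntriesIn.const 0)).det K)
          (PF1.mul_mem (pow_mem' h2id n') (pow_mem' h2id m))) infinite_pos ?_
      rintro _ ⟨s, hs, rfl⟩
      have hs' := ofReal_ne_zero_of_pos hs
      obtain ⟨h1, h2, h3, h4⟩ := main s hs 0 zero_mem_ball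
      have hc : ch (s : ℂ) ≠ 0 := by
        have : ch (s : ℂ) = (((s + s⁻¹) / 2 : ℝ) : ℂ) := by
          rw [ch]
          push_cast
          rfl
        rw [this]
        exact ofReal_ne_zero_of_pos (by positivity)
      have h5 := hNd ((s : ℂ), 0)
      rw [zero_smul, he.trip.act_tv_zero hc] at h2 h3 h4
      rw [zero_smul] at h1
      rw [hgV] at h3
      have hy := h.mapsg h4
      rw [hgV] at hy
      have hU := h.inS.isUnit_den (mem_OmegaII_iff.1 hy).2
      simp only [zero_smul, h2, h3, ptv_eq hs' (-V), smul_mul_assoc] at h5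
      rw [den_smul, tv_neg, det_smul, Fintype.card_fin] at h5
      have h6 : den (tv (s : ℂ)⁻¹ V * S⁻¹) (act S ((sh s / ch s : ℂ) • V)) *
          (den S ((sh s / ch s : ℂ) • V) * (1 + (ch s - 1) • (Vᴴ * V))) = 1 := by
        have h7 : tv (s : ℂ)⁻¹ V * S⁻¹ * aug (act S ((sh s / ch s : ℂ) • V)) *
            den S ((sh s / ch s : ℂ) • V) = tv (s : ℂ)⁻¹ V * aug ((sh s / ch s : ℂ) • V) := by
          rw [Matrix.mul_assoc (_ * S⁻¹), ← mul_fromRows_act hU, Matrix.mul_assoc,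
            ← Matrix.mul_assoc S⁻¹, Matrix.nonsing_inv_mul _ h.inS.isUnit_det, Matrix.one_mul]
        rw [mul_fromRows_one, mul_fromRows_one, fromRows_mul] at h7
        rw [← Matrix.mul_assoc, (fromRows_inj h7).2, hV.isUnit_den_tv hs' hc]
      have h8 := congrArg det h6
      rw [det_mul, det_mul, h.den_eq, det_mul, mul_smul_comm, hm, hm', det_one,
        det_conjTranspose] at h8
      have h9 : (1 - a * (sh s / ch s : ℂ)) ^ m * ch s ^ m * (2 * s) ^ m =
          ((s : ℂ) ^ 2 + 1 - a * ((s : ℂ) ^ 2 - 1)) ^ m := by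
        rw [← mul_pow, ← mul_pow, ← two_mul_ch hs', ← two_mul_sh hs']
        congr 1
        field_simp
      change d (s, 0) * _ = _
      rw [(h5 h1).1, ← h9]
      linear_combination (den (T⁻¹ * ptv (s : ℂ) e) 0).det ^ K *
        ((2 * (s : ℂ)) ^ n' * (2 * (s : ℂ)) ^ m) * h8
    have h1 := congrFun hpoly s
    simp only [h0, zero_mul] at h1
    have h2s : 2 * s ≠ 0 := mul_ne_zero two_ne_zero hs
    refine mul_ne_zero (pow_ne_zero _ (hdelta s hs ?_)) (mul_ne_zero (pow_ne_zero _ h2s)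
      (pow_ne_zero _ h2s)) h1.symm
    intro h2
    have h3 : 2 * s * (ch s - a * sh s) = s ^ 2 + 1 - a * (s ^ 2 - 1) := by
      rw [← two_mul_ch hs, ← two_mul_sh hs]
      ring
    rw [h2, hs2] at h3
    have h4 : (a : ℂ) = 0 := by linear_combination -h3 / 2
    exact he.pos.ne' (by exact_mod_cast h4)

end TypeII

namespace TypeII

variable {n n' : ℕ} {f g : Matrix (Fin n) (Fin n) ℂ → Matrix (Fin n') (Fin n') ℂ}
  {T : Matrix (Fin n ⊕ Fin n) (Fin n ⊕ Fin n) ℂ}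
  {S : Matrix (Fin n' ⊕ Fin n') (Fin n' ⊕ Fin n') ℂ} {e : Matrix (Fin n) (Fin n) ℂ} {a : ℝ}
  {V : Matrix (Fin n') (Fin n') ℂ}

lemma IsTripotent.inG_inv (he : IsTripotent e) {s : ℝ} (hs : 0 < s) : InG (tv (s : ℂ)⁻¹ e) := by
  rw [← tv_neg]
  exact he.neg.inG hs

lemma IsTripotent.act_tv_inv (he : IsTripotent e) {s : ℝ} (hs : 0 < s)
    {Z : Matrix (Fin n) (Fin n) ℂ} (hZ : Z ∈ OmegaII n) :
    act (tv s e) (act (tv (s : ℂ)⁻¹ e) Z) = Z := by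
  rw [← he.inv_tv (ofReal_ne_zero_of_pos hs)]
  exact (he.inG hs).act_act_inv (mem_OmegaII_iff.1 hZ).2

lemma Intertwined.isRationalFamily (h : Intertwined f g T S) (he : IsAxis T e a)
    (hV : IsTripotent V) (hgV : ∀ z : ℂ, g (z • e) = z • V) {m : ℕ}
    (hm : ∀ z : ℂ, (1 - z • ((g (act T 0))ᴴ * V)).det = (1 - a * z) ^ m)
    (hm' : ∀ x : ℂ, (1 + (x - 1) • (Vᴴ * V)).det = x ^ m)
    {Z : Matrix (Fin n) (Fin n) ℂ} (hZ : Z ∈ OmegaII n) (i j : Fin n') :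
    IsRationalFamily (fun s z => act (tv (s : ℂ)⁻¹ V) (g (act (tv (s : ℂ) e) (z • Z))) i j) 1 where
  pos := one_pos
  diff s hs := by
    have hZ' := mem_OmegaII_iff.1 hZ
    have hw : ∀ z ∈ Metric.ball (0 : ℂ) 1, z • Z ∈ OmegaII n := fun z hz =>
      smul_mem_OmegaII hZ'.1 hZ'.2.le hz
    refine differentiableOn_entry (differentiableOn_act
      ((IsPolyMapII.differentiable h.polyg).comp_differentiableOn
      (differentiableOn_act (differentiableOn_id.smul_const Z) fun z hz =>
        (he.trip.inG hs).isUnit_den (mem_OmegaII_iff.1 (hw z hz)).2)) fun z hz => ?_) i j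
    exact (hV.inG_inv hs).isUnit_den
      (mem_OmegaII_iff.1 (h.mapsg ((he.trip.inG hs).mapsTo (hw z hz)))).2
  bound s hs z hz := by
    have hZ' := mem_OmegaII_iff.1 hZ
    have hw := smul_mem_OmegaII hZ'.1 hZ'.2.le hz
    exact (norm_entry_le_opn _ i j).trans (mem_OmegaII_iff.1
      ((hV.inG_inv hs).mapsTo (h.mapsg ((he.trip.inG hs).mapsTo hw)))).2.le
  rep₁ := exists_rep_one h.polyg h.mapsg he.trip hV hgV hZ i j
  rep₂ := h.exists_rep_two he hV hgV hm hm' hZ i j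

lemma Intertwined.exists_tv_comm (h : Intertwined f g T S) (he : IsAxis T e a) :
    ∃ V : Matrix (Fin n') (Fin n') ℂ, IsTripotent V ∧ ∀ s : ℝ, 0 < s → ∀ Z ∈ OmegaII n,
      g (act (tv (s : ℂ) e) Z) = act (tv (s : ℂ) V) (g Z) := by
  obtain ⟨m, V, hV, hgV, hm, hm'⟩ := h.exists_tripotent he
  refine ⟨V, hV, fun s hs Z hZ => ?_⟩
  have hZ' := mem_OmegaII_iff.1 hZ
  obtain ⟨r, hr, hr1⟩ := exists_between hZ'.2
  have hr0 : 0 < r := (opn_nonneg Z).trans_lt hr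
  have hrC := ofReal_ne_zero_of_pos hr0
  have hZr : (r : ℂ)⁻¹ • Z ∈ OmegaII n := by
    rw [mem_OmegaII_iff, transpose_smul, hZ'.1, smul_neg, opn_smul, norm_inv, Complex.norm_real,
      Real.norm_eq_abs, abs_of_pos hr0, inv_mul_lt_iff₀ hr0, mul_one]
    exact ⟨rfl, hr⟩
  have hrb : (r : ℂ) ∈ Metric.ball (0 : ℂ) 1 := by simpa [abs_of_pos hr0] using hr1
  have h1 : act (tv (s : ℂ)⁻¹ V) (g (act (tv (s : ℂ) e) Z)) = g Z := by
    ext i j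
    have h2 := (h.isRationalFamily he hV hgV hm hm' hZr i j).eq hs one_pos hrb
    simp only [smul_smul, mul_inv_cancel₀ hrC, one_smul, Complex.ofReal_one, inv_one, tv_one,
      act_one] at h2
    exact h2
  rw [← h1]
  exact (hV.act_tv_inv hs (h.mapsg ((he.trip.inG hs).mapsTo hZ))).symm

lemma Intertwined.step (h : Intertwined f g T S) (he : IsAxis T e a) {s : ℝ} (hs : 0 < s) :
    ∃ S' : Matrix (Fin n' ⊕ Fin n') (Fin n' ⊕ Fin n') ℂ,
      Intertwined f g (tv (s : ℂ)⁻¹ e * T) S' := by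
  obtain ⟨V, hV, hVg⟩ := h.exists_tv_comm he
  refine ⟨S * tv (s : ℂ) V, h.polyf, h.polyg, h.mapsf, h.mapsg, h.zerof, h.zerog,
    (he.trip.inG_inv hs).mul h.inT, h.inS.mul (hV.inG hs), fun z hz => ?_⟩
  have h1 := h.inT.mapsTo hz
  have h2 := (he.trip.inG_inv hs).mapsTo h1
  rw [(he.trip.inG_inv hs).act_mul h.inT (mem_OmegaII_iff.1 hz).2,
    h.inS.act_mul (hV.inG hs) (mem_OmegaII_iff.1 (h.mapsg h2)).2, ← hVg s hs _ h2,
    he.trip.act_tv_inv hs h1, h.rel z hz]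

end TypeII

namespace TypeII

section Singular

variable {ι : Type*} [Fintype ι] [DecidableEq ι]

/-- A matrix of norm one attains its norm. -/
lemma exists_gram_fixed {W : Matrix ι ι ℂ} (hW : opn W = 1) :
    ∃ v : ι → ℂ, star v ⬝ᵥ v = 1 ∧ Wᴴ *ᵥ (W *ᵥ v) = v := by
  have hs : (1 - Wᴴ * W).PosSemidef := by
    have := (opn_le_iff_posSemidef (Z := W) zero_le_one).1 hW.le
    simpa using this
  have hd : (1 - Wᴴ * W).det = 0 := by
    by_contra hne
    exact hW.not_lt (opn_lt_one_iff_posDef.2 (hs.posDef_iff_isUnit.2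
      ((Matrix.isUnit_iff_isUnit_det _).2 (isUnit_iff_ne_zero.2 hne))))
  obtain ⟨v, hv, hv0⟩ := Matrix.exists_mulVec_eq_zero_iff.2 hd
  have hn := nsq_pos hv
  have hr : 0 < Real.sqrt (nsq v) := Real.sqrt_pos.2 hn
  rw [Matrix.sub_mulVec, Matrix.one_mulVec, sub_eq_zero, ← Matrix.mulVec_mulVec] at hv0
  refine ⟨((Real.sqrt (nsq v))⁻¹ : ℂ) • v, ?_, ?_⟩
  · rw [← nsq_coe, nsq_smul, norm_inv, Complex.norm_real, Real.norm_of_nonneg hr.le, inv_pow,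
      Real.sq_sqrt hn.le, inv_mul_cancel₀ hn.ne', Complex.ofReal_one]
  · rw [Matrix.mulVec_smul, Matrix.mulVec_smul, ← hv0]

/-- An antisymmetric matrix of norm one agrees with a nonzero tripotent on its support. -/
lemma exists_tripotent_of_opn_eq_one {W : Matrix ι ι ℂ} (hW : opn W = 1) (hWt : Wᵀ = -W) :
    ∃ e : Matrix ι ι ℂ, IsTripotent e ∧ Wᴴ * e = eᴴ * e ∧ W * (eᴴ * e) = e ∧ e ≠ 0 := by
  obtain ⟨v, hv, hvw⟩ := exists_gram_fixed hW
  obtain ⟨w, hw⟩ : ∃ w, w = W *ᵥ v := ⟨_, rfl⟩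
  have h0 : Wᴴ *ᵥ w = v := by rw [hw, hvw]
  have h1 : W *ᵥ star w = -star v := by
    have := congrArg star h0
    rw [Matrix.star_mulVec, Matrix.conjTranspose_conjTranspose, ← Matrix.mulVec_transpose, hWt,
      Matrix.neg_mulVec] at this
    rw [← this, neg_neg]
  have h2 : Wᴴ *ᵥ star v = -star w := by
    have := congrArg star hw
    rw [Matrix.star_mulVec, ← Matrix.mulVec_transpose, conjTranspose_of_transpose_eq_neg hWt,
      Matrix.neg_mulVec] at this
    rw [this, neg_neg]
  have h3 : w ⬝ᵥ v = 0 := by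
    have : (W *ᵥ v) ⬝ᵥ v = -((W *ᵥ v) ⬝ᵥ v) := by
      conv_lhs => rw [dotProduct_comm, Matrix.dotProduct_mulVec, ← Matrix.mulVec_transpose, hWt,
        Matrix.neg_mulVec, neg_dotProduct]
    rw [hw]
    exact self_eq_neg.1 this
  have h4 : star w ⬝ᵥ w = 1 := by
    conv_lhs => rw [hw]
    rw [Matrix.star_mulVec, ← Matrix.dotProduct_mulVec, hvw, hv]
  have h5 : v ⬝ᵥ w = 0 := by rw [dotProduct_comm, h3]
  have h6 : star v ⬝ᵥ star w = 0 := by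
    rw [Matrix.star_dotProduct_star, h3, star_zero]
  have h7 : star w ⬝ᵥ star v = 0 := by rw [dotProduct_comm, h6]
  have h8 : v ⬝ᵥ star v = 1 := by rw [dotProduct_comm, hv]
  have h9 : w ⬝ᵥ star w = 1 := by rw [dotProduct_comm, h4]
  obtain ⟨e, he⟩ : ∃ e, e = vecMulVec w (star v) - vecMulVec (star v) w := ⟨_, rfl⟩
  have he' : eᴴ = vecMulVec v (star w) - vecMulVec (star w) v := by
    rw [he, conjTranspose_sub, conjTranspose_vecMulVec, conjTranspose_vecMulVec, star_star]
  have hP : eᴴ * e = vecMulVec v (star v) + vecMulVec (star w) w := by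
    rw [he', he]
    simp [Matrix.sub_mul, Matrix.mul_sub, vecMulVec_mul_vecMulVec, h4, h8, h5, h7]
  have hWP : W * (eᴴ * e) = e := by
    rw [hP, Matrix.mul_add, mul_vecMulVec, mul_vecMulVec, ← hw, h1, neg_vecMulVec, he,
      sub_eq_add_neg]
  have hWe : Wᴴ * e = eᴴ * e := by
    rw [hP, he, Matrix.mul_sub, mul_vecMulVec, mul_vecMulVec, h0, h2, neg_vecMulVec, sub_neg_eq_add]
  have hPP : eᴴ * e * (eᴴ * e) = eᴴ * e := by
    rw [hP]
    simp [Matrix.add_mul, Matrix.mul_add, vecMulVec_mul_vecMulVec, hv, h9, h6, h3]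
  refine ⟨e, ⟨?_, ?_⟩, hWe, hWP, ?_⟩
  · rw [he, transpose_sub, transpose_vecMulVec, transpose_vecMulVec, neg_sub]
  · conv_lhs => rw [Matrix.mul_assoc]; enter [1]; rw [← hWP]
    rw [Matrix.mul_assoc, hPP, hWP]
  · intro h
    have h10 : (eᴴ * e) *ᵥ v = v := by
      rw [hP, Matrix.add_mulVec, vecMulVec_mulVec, vecMulVec_mulVec, hv, h3]
      simp
    rw [h, Matrix.mul_zero, Matrix.zero_mulVec] at h10
    rw [← h10] at hv
    simp at hv


lemma IsTripotent.act_tv_inv_eq_sub {e Z : Matrix ι ι ℂ} (he : IsTripotent e) {r s : ℂ}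
    (hr : 1 - r ^ 2 ≠ 0) (hc : ch s ≠ 0) (hsh : sh s = r * ch s)
    (h1 : Z * (eᴴ * e) = r • e) (h2 : eᴴ * Z = r • (eᴴ * e)) :
    act (tv s⁻¹ e) Z = Z - r • e := by
  have hd : ch s - r * sh s ≠ 0 := by
    rw [hsh, show ch s - r * (r * ch s) = (1 - r ^ 2) * ch s by ring]
    exact mul_ne_zero hr hc
  refine act_eq_of_mul_fromRows (C := 1 + ((ch s - r * sh s) - 1) • (eᴴ * e)) ?_
    (he.isUnit_one_add hd)
  have h3 : e * (eᴴ * Z) = r • e := by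
    rw [h2, mul_smul_comm, ← Matrix.mul_assoc, he.tripotent]
  rw [aug_mul, mul_fromRows_one, tv, ch_inv, sh_inv, num, den, toBlocks_fromBlocks₁₁,
    toBlocks_fromBlocks₁₂, toBlocks_fromBlocks₂₁, toBlocks_fromBlocks₂₂]
  congr 1
  · rw [Matrix.add_mul, Matrix.one_mul, smul_mul_assoc, Matrix.mul_assoc, h3, hsh, Matrix.mul_add,
      Matrix.mul_one, mul_smul_comm, Matrix.sub_mul, h1, smul_mul_assoc, ← Matrix.mul_assoc e,
      he.tripotent]
    module
  · rw [smul_mul_assoc, h2, smul_smul]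
    module

lemma IsTripotent.rank_sub_lt {e Z : Matrix ι ι ℂ} (he : IsTripotent e) (hne : e ≠ 0) {r : ℂ}
    (hr : r ≠ 0) (h1 : Z * (eᴴ * e) = r • e) (h2 : eᴴ * Z = r • (eᴴ * e)) :
    (Z - r • e).rank < Z.rank := by
  have hker : LinearMap.ker Z.mulVecLin < LinearMap.ker (Z - r • e).mulVecLin := by
    refine lt_of_le_of_ne (fun x hx => ?_) fun heq => hne ?_
    · rw [LinearMap.mem_ker, Matrix.mulVecLin_apply] at hx ⊢
      have h3 : r • e = e * (eᴴ * Z) := by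
        rw [h2, mul_smul_comm, ← Matrix.mul_assoc, he.tripotent]
      rw [Matrix.sub_mulVec, h3, ← Matrix.mulVec_mulVec, ← Matrix.mulVec_mulVec, hx]
      simp
    · refine Matrix.ext_iff_mulVec.2 fun y => ?_
      have hy : (eᴴ * e) *ᵥ y ∈ LinearMap.ker (Z - r • e).mulVecLin := by
        rw [LinearMap.mem_ker, Matrix.mulVecLin_apply, Matrix.mulVec_mulVec, Matrix.sub_mul, h1,
          smul_mul_assoc, ← Matrix.mul_assoc, he.tripotent, sub_self, Matrix.zero_mulVec]
      rw [← heq, LinearMap.mem_ker, Matrix.mulVecLin_apply, Matrix.mulVec_mulVec, h1,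
        Matrix.smul_mulVec] at hy
      rw [Matrix.zero_mulVec]
      exact (smul_eq_zero.1 hy).resolve_left hr
  have h5 := Submodule.finrank_lt_finrank_of_lt hker
  have h3 := Z.mulVecLin.finrank_range_add_finrank_ker
  have h4 := (Z - r • e).mulVecLin.finrank_range_add_finrank_ker
  rw [Matrix.rank, Matrix.rank]
  omega

end Singular

variable {n n' : ℕ} {f g : Matrix (Fin n) (Fin n) ℂ → Matrix (Fin n') (Fin n') ℂ}
  {T : Matrix (Fin n ⊕ Fin n) (Fin n ⊕ Fin n) ℂ}
  {S : Matrix (Fin n' ⊕ Fin n') (Fin n' ⊕ Fin n') ℂ}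

/-- A nonzero point can be moved by a transvection to a point of smaller rank. -/
lemma exists_rank_act_lt {Z : Matrix (Fin n) (Fin n) ℂ} (hZ : Z ∈ OmegaII n) (hZ0 : Z ≠ 0) :
    ∃ (e : Matrix (Fin n) (Fin n) ℂ) (r s : ℝ), IsTripotent e ∧ 0 < r ∧ r < 1 ∧ 0 < s ∧
      Zᴴ * e = (r : ℂ) • (eᴴ * e) ∧ opn Z ≤ r ∧ (act (tv (s : ℂ)⁻¹ e) Z).rank < Z.rank := by
  obtain ⟨hZt, hZ1⟩ := mem_OmegaII_iff.1 hZ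
  have hr : 0 < opn Z := lt_of_le_of_ne (opn_nonneg Z) fun h => hZ0 (opn_eq_zero h.symm)
  obtain ⟨r, hrZ⟩ : ∃ r, r = opn Z := ⟨_, rfl⟩
  rw [← hrZ] at hr hZ1
  have hrC : (r : ℂ) ≠ 0 := ofReal_ne_zero_of_pos hr
  obtain ⟨W, hZW⟩ : ∃ W, Z = (r : ℂ) • W := ⟨(r : ℂ)⁻¹ • Z, by rw [smul_inv_smul₀ hrC]⟩
  have hW : opn W = 1 := by
    rw [hZW, opn_smul, Complex.norm_real, Real.norm_of_nonneg hr.le] at hrZ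
    exact mul_left_cancel₀ hr.ne' (by rw [← hrZ, mul_one])
  have hWt : Wᵀ = -W := by
    rw [hZW, transpose_smul, ← smul_neg] at hZt
    exact smul_right_injective _ hrC hZt
  obtain ⟨e, he, h1, h2, hne⟩ := exists_tripotent_of_opn_eq_one hW hWt
  have h3 : eᴴ * W = eᴴ * e := by
    have := congrArg conjTranspose h1
    rwa [conjTranspose_mul, conjTranspose_mul, conjTranspose_conjTranspose,
      conjTranspose_conjTranspose] at this
  have h2' : Z * (eᴴ * e) = (r : ℂ) • e := by rw [hZW, smul_mul_assoc, h2]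
  have h3' : eᴴ * Z = (r : ℂ) • (eᴴ * e) := by rw [hZW, mul_smul_comm, h3]
  have h4 : 0 < (1 + r) / (1 - r) := by have : 0 < 1 - r := sub_pos.2 hZ1; positivity
  obtain ⟨s, hs⟩ : ∃ s, s = Real.sqrt ((1 + r) / (1 - r)) := ⟨_, rfl⟩
  have hs0 : 0 < s := hs ▸ Real.sqrt_pos.2 h4
  have hs2 : s ^ 2 * (1 - r) = 1 + r := by
    rw [hs, Real.sq_sqrt h4.le, div_mul_cancel₀ _ (sub_pos.2 hZ1).ne']
  have hsC := ofReal_ne_zero_of_pos hs0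
  have hs2' : (s : ℂ) ^ 2 * (1 - r) = 1 + r := by exact_mod_cast hs2
  have hsh : sh (s : ℂ) = r * ch s := by
    refine mul_left_cancel₀ (mul_ne_zero two_ne_zero hsC) ?_
    rw [two_mul_sh hsC, mul_left_comm, two_mul_ch hsC]
    linear_combination hs2'
  have hc : ch (s : ℂ) ≠ 0 := by
    have : (s : ℂ) ^ 2 + 1 ≠ 0 := by exact_mod_cast (by positivity : s ^ 2 + 1 ≠ 0)
    rw [← two_mul_ch hsC] at this
    exact right_ne_zero_of_mul this
  have hr1 : 1 - (r : ℂ) ^ 2 ≠ 0 := by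
    exact_mod_cast (by nlinarith : (0 : ℝ) < 1 - r ^ 2).ne'
  refine ⟨e, r, s, he, hr, hZ1, hs0, ?_, hrZ.ge, ?_⟩
  · rw [hZW, conjTranspose_smul, smul_mul_assoc, h1]
    simp
  · rw [he.act_tv_inv_eq_sub hr1 hc hsh h2' h3']
    exact he.rank_sub_lt hne hrC h2' h3'

lemma exists_act_zero_eq {Z : Matrix (Fin n) (Fin n) ℂ} (hZ : Z ∈ OmegaII n) :
    ∃ T : Matrix (Fin n ⊕ Fin n) (Fin n ⊕ Fin n) ℂ, InG T ∧ act T 0 = Z := by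
  induction h : Z.rank using Nat.strong_induction_on generalizing Z with
  | _ k ih =>
    by_cases hZ0 : Z = 0
    · exact ⟨1, InG.one, by rw [act_one, hZ0]⟩
    obtain ⟨e, r, s, he, -, -, hs, -, -, hlt⟩ := exists_rank_act_lt hZ hZ0
    obtain ⟨T, hT, hT0⟩ := ih _ (h ▸ hlt) ((he.inG_inv hs).mapsTo hZ) rfl
    refine ⟨tv (s : ℂ) e * T, (he.inG hs).mul hT, ?_⟩
    rw [(he.inG hs).act_mul hT (mem_OmegaII_iff.1 (zero_mem_OmegaII n)).2, hT0,
      he.act_tv_inv hs hZ]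

lemma Intertwined.exists_act_zero (h : Intertwined f g T S) :
    ∃ T' S', Intertwined f g T' S' ∧ act T' 0 = 0 := by
  induction hk : (act T 0).rank using Nat.strong_induction_on generalizing T S with
  | _ k ih =>
    by_cases h0 : act T 0 = 0
    · exact ⟨T, S, h, h0⟩
    have hm := h.inT.mapsTo (zero_mem_OmegaII n)
    obtain ⟨e, r, s, he, hr, hr1, hs, hg, ho, hlt⟩ := exists_rank_act_lt hm h0
    obtain ⟨S', hS'⟩ := h.step ⟨he, hr, hr1, hg, ho⟩ hs
    refine ih _ ?_ hS' rfl
    rw [(he.inG_inv hs).act_mul h.inT (mem_OmegaII_iff.1 (zero_mem_OmegaII n)).2]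
    exact hk ▸ hlt

/-- Polynomial maps intertwined by automorphisms are intertwined by isotropies. -/
lemma Intertwined.exists_isotropy (h : Intertwined f g T S) :
    ∃ T' S', Intertwined f g T' S' ∧ act T' 0 = 0 ∧ act S' 0 = 0 := by
  obtain ⟨T', S', h', h0⟩ := h.exists_act_zero
  refine ⟨T', S', h', h0, ?_⟩
  have := h'.rel 0 (zero_mem_OmegaII n)
  rw [h0, h.zerog, h.zerof] at this
  exact this.symm

end TypeII

namespace TypeII

section Cartan

open Metric Asymptotics Filter

variable {E : Type*} [NormedAddCommGroup E] [NormedSpace ℂ E] {F : E → E}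

lemma norm_iterate_le (hd : DifferentiableOn ℂ F (ball 0 1))
    (hm : Set.MapsTo F (ball 0 1) (ball 0 1)) (h0 : F 0 = 0) (N : ℕ) {z : E}
    (hz : z ∈ ball (0 : E) 1) : ‖F^[N] z‖ ≤ ‖z‖ := by
  induction N with
  | zero => simp
  | succ N ih =>
    rw [Function.iterate_succ_apply']
    exact (Complex.norm_le_norm_of_mapsTo_ball hd (hm.mono_right ball_subset_closedBall) h0
      (mem_ball_zero_iff.1 (hm.iterate N hz))).trans ih

lemma differentiableOn_iterate (hd : DifferentiableOn ℂ F (ball 0 1))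
    (hm : Set.MapsTo F (ball 0 1) (ball 0 1)) (N : ℕ) :
    DifferentiableOn ℂ F^[N] (ball 0 1) := by
  induction N with
  | zero => exact differentiableOn_id
  | succ N ih =>
    rw [Function.iterate_succ']
    exact hd.comp ih (hm.iterate N)

lemma iterate_sub_self (N : ℕ) (z : E) :
    F^[N] z - z = ∑ j ∈ Finset.range N, (F (F^[j] z) - F^[j] z) := by
  simp only [← Function.iterate_succ_apply']
  rw [Finset.sum_range_sub (fun j => F^[j] z)]
  rfl

/-- The Schwarz lemma for the displacement of a self-map of the unit ball. -/
lemma norm_sub_self_le (hd : DifferentiableOn ℂ F (ball 0 1))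
    (hm : Set.MapsTo F (ball 0 1) (ball 0 1)) (h0 : F 0 = 0) {m : ℕ}
    (ho : (fun z => F z - z) =o[nhds 0] fun z => ‖z‖ ^ m) {z : E} (hz : z ∈ ball (0 : E) 1) :
    ‖F z - z‖ ≤ 2 * ‖z‖ ^ (m + 1) := by
  have := Complex.dist_le_mul_div_pow_of_mapsTo_ball_of_isLittleO (f := fun z => F z - z)
    (c := (0 : E)) (R₁ := 1) (R₂ := 2) (n := m) (hd.sub differentiableOn_id) (fun w hw => ?_)
    (by simpa [h0] using ho) hz
  · simpa [h0] using this
  · have h1 := mem_ball_zero_iff.1 hw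
    have h2 := mem_ball_zero_iff.1 (hm hw)
    simp only [h0, sub_zero, mem_closedBall_zero_iff]
    linarith [norm_sub_le (F w) w]

lemma isLittleO_of_norm_le {H : E → E} {m : ℕ} {C r : ℝ} (hr : 0 < r)
    (h : ∀ z ∈ ball (0 : E) r, ‖H z‖ ≤ C * ‖z‖ ^ (m + 1)) :
    H =o[nhds 0] fun z => ‖z‖ ^ m := by
  have h1 : H =O[nhds 0] fun z : E => ‖z‖ ^ (m + 1) := by
    refine IsBigO.of_bound C ?_
    filter_upwards [ball_mem_nhds (0 : E) hr] with z hz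
    simpa using h z hz
  refine h1.trans_isLittleO ?_
  have h2 : (fun z : E => ‖z‖) =o[nhds 0] fun _ => (1 : ℝ) := by
    rw [isLittleO_one_iff]
    simpa using (continuous_norm (E := E)).tendsto 0
  simpa [pow_succ] using (isBigO_refl (fun z : E => ‖z‖ ^ m) (nhds 0)).mul_isLittleO h2

lemma norm_sub_self_le_succ (hd : DifferentiableOn ℂ F (ball 0 1))
    (hm : Set.MapsTo F (ball 0 1) (ball 0 1)) (h0 : F 0 = 0) {m : ℕ} (hm1 : 1 ≤ m)
    (h : ∀ z ∈ ball (0 : E) 1, ‖F z - z‖ ≤ 2 * ‖z‖ ^ (m + 1)) :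
    ∀ z ∈ ball (0 : E) 1, ‖F z - z‖ ≤ 2 * ‖z‖ ^ (m + 2) := by
  have hit : ∀ (N : ℕ), ∀ z ∈ ball (0 : E) 1, ‖F^[N] z - z‖ ≤ 2 * ‖z‖ ^ (m + 1) := by
    intro N z hz
    refine norm_sub_self_le (differentiableOn_iterate hd hm N) (hm.iterate N)
      (Function.iterate_fixed h0 N) (isLittleO_of_norm_le (C := N * 2) one_pos fun w hw => ?_) hz
    rw [iterate_sub_self]
    refine (norm_sum_le _ _).trans ((Finset.sum_le_card_nsmul _ _ (2 * ‖w‖ ^ (m + 1))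
      fun j _ => ?_).trans_eq ?_)
    · refine (h _ (hm.iterate j hw)).trans ?_
      gcongr
      exact norm_iterate_le hd hm h0 j hw
    · rw [Finset.card_range, nsmul_eq_mul, mul_assoc]
  have hloc : ∀ z ∈ ball (0 : E) (1 / 4), ‖F z - z‖ ≤ 32 * ‖z‖ ^ (m + 2) := by
    intro z hz
    rcases eq_or_ne z 0 with rfl | hz0
    · simp [h0]
    have hr : 0 < ‖z‖ := norm_pos_iff.2 hz0
    have hr4 : ‖z‖ < 1 / 4 := mem_ball_zero_iff.1 hz
    have hz1 : z ∈ ball (0 : E) 1 := mem_ball_zero_iff.2 (hr4.trans (by norm_num))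
    have hpow : ∀ x : ℝ, 0 ≤ x → x ≤ 1 → x ^ (m + 1) ≤ x ^ 2 := fun x hx hx1 =>
      pow_le_pow_of_le_one hx hx1 (by omega)
    have hsub : ball z ‖z‖ ⊆ ball (0 : E) 1 := by
      intro w hw
      rw [mem_ball_iff_norm] at hw
      rw [mem_ball_zero_iff]
      linarith [norm_le_norm_add_norm_sub' w z]
    have hb : ∀ w ∈ ball z ‖z‖, ‖F w - w‖ ≤ 8 * ‖z‖ ^ 2 := by
      intro w hw
      have hw1 := mem_ball_zero_iff.1 (hsub hw)
      rw [mem_ball_iff_norm] at hw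
      have : ‖w‖ ≤ 2 * ‖z‖ := by linarith [norm_le_norm_add_norm_sub' w z]
      calc ‖F w - w‖ ≤ 2 * ‖w‖ ^ (m + 1) := h w (mem_ball_zero_iff.2 hw1)
        _ ≤ 2 * ‖w‖ ^ 2 :=
          mul_le_mul_of_nonneg_left (hpow _ (norm_nonneg _) hw1.le) zero_le_two
        _ ≤ 2 * (2 * ‖z‖) ^ 2 := by gcongr
        _ = 8 * ‖z‖ ^ 2 := by ring
    have hlip : ∀ j : ℕ, ‖(F (F^[j] z) - F^[j] z) - (F z - z)‖ ≤ 32 * ‖z‖ ^ (m + 2) := by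
      intro j
      have hj := hit j z hz1
      have hj' : F^[j] z ∈ ball z ‖z‖ := by
        rw [mem_ball_iff_norm]
        have := hpow ‖z‖ hr.le (by linarith)
        nlinarith
      have := Complex.dist_le_div_mul_dist_of_mapsTo_ball (f := fun z => F z - z)
        (R₂ := 16 * ‖z‖ ^ 2) ((hd.sub differentiableOn_id).mono hsub) (fun w hw => ?_) hj'
      · rw [dist_eq_norm, dist_eq_norm] at this
        refine this.trans ((mul_le_mul_of_nonneg_left hj (by positivity)).trans_eq ?_)
        field_simp
        ring
      · rw [mem_closedBall_iff_norm]
        linarith [norm_sub_le (F w - w) (F z - z), hb w hw, hb z (mem_ball_self hr)]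
    have hN : ∀ N : ℕ, N * (‖F z - z‖ - 32 * ‖z‖ ^ (m + 2)) ≤ 2 * ‖z‖ ^ (m + 1) := by
      intro N
      have h1 : ‖∑ j ∈ Finset.range N, ((F (F^[j] z) - F^[j] z) - (F z - z))‖ ≤
          N * (32 * ‖z‖ ^ (m + 2)) := by
        refine (norm_sum_le _ _).trans ((Finset.sum_le_card_nsmul _ _ _
          fun j _ => hlip j).trans_eq ?_)
        rw [Finset.card_range, nsmul_eq_mul]
      rw [Finset.sum_sub_distrib, ← iterate_sub_self, Finset.sum_const, Finset.card_range] at h1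
      have h2 := hit N z hz1
      have h3 : ‖N • (F z - z)‖ = N * ‖F z - z‖ := by
        rw [← Nat.cast_smul_eq_nsmul ℂ, norm_smul, Complex.norm_natCast]
      have h4 := norm_sub_norm_le (N • (F z - z)) (F^[N] z - z)
      rw [norm_sub_rev (N • (F z - z))] at h4
      linarith
    by_contra! hlt
    obtain ⟨N, hN'⟩ := exists_nat_gt (2 * ‖z‖ ^ (m + 1) / (‖F z - z‖ - 32 * ‖z‖ ^ (m + 2)))
    rw [div_lt_iff₀ (sub_pos.2 hlt)] at hN'
    exact (hN N).not_gt hN'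
  exact fun z hz => norm_sub_self_le hd hm h0 (isLittleO_of_norm_le (by norm_num) hloc) hz

/-- Cartan's uniqueness theorem for the unit ball of a normed space. -/
theorem eq_self_of_hasFDerivAt_id (hd : DifferentiableOn ℂ F (ball 0 1))
    (hm : Set.MapsTo F (ball 0 1) (ball 0 1)) (h0 : F 0 = 0)
    (h' : HasFDerivAt F (ContinuousLinearMap.id ℂ E) 0) {z : E} (hz : z ∈ ball (0 : E) 1) :
    F z = z := by
  have h1 : ∀ m : ℕ, ∀ z ∈ ball (0 : E) 1, ‖F z - z‖ ≤ 2 * ‖z‖ ^ (m + 2) := by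
    intro m
    induction m with
    | zero =>
      refine fun z hz => norm_sub_self_le hd hm h0 ?_ hz
      have := h'.isLittleO.norm_right
      simpa [h0] using this
    | succ m ih => exact norm_sub_self_le_succ hd hm h0 (by omega) ih
  have h2 : Tendsto (fun m : ℕ => 2 * ‖z‖ ^ (m + 2)) atTop (nhds 0) := by
    have := (tendsto_add_atTop_iff_nat 2).2
      (tendsto_pow_atTop_nhds_zero_of_lt_one (norm_nonneg z) (mem_ball_zero_iff.1 hz))
    simpa using this.const_mul 2
  have h3 := ge_of_tendsto' h2 fun m => h1 m z hz
  exact sub_eq_zero.1 (norm_le_zero_iff.1 h3)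

/-- A biholomorphic self-map of the unit ball fixing the origin is linear. -/
theorem exists_linear_of_ball {K K' : E → E} (hd : DifferentiableOn ℂ K (ball 0 1))
    (hm : Set.MapsTo K (ball 0 1) (ball 0 1)) (h0 : K 0 = 0)
    (hd' : DifferentiableOn ℂ K' (ball 0 1)) (hm' : Set.MapsTo K' (ball 0 1) (ball 0 1))
    (hl : ∀ z ∈ ball (0 : E) 1, K' (K z) = z) (hr : ∀ z ∈ ball (0 : E) 1, K (K' z) = z) :
    ∃ L : E →L[ℂ] E, ∀ z ∈ ball (0 : E) 1, K z = L z := by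
  have hb : ball (0 : E) 1 ∈ nhds 0 := ball_mem_nhds _ one_pos
  have h0' : K' 0 = 0 := by simpa [h0] using hl 0 (mem_ball_self one_pos)
  have hK := (hd.differentiableAt hb).hasFDerivAt
  have hK' := (hd'.differentiableAt hb).hasFDerivAt
  have hcomp : (fderiv ℂ K' 0).comp (fderiv ℂ K 0) = ContinuousLinearMap.id ℂ E := by
    have h1 : HasFDerivAt (K' ∘ K) ((fderiv ℂ K' 0).comp (fderiv ℂ K 0)) 0 :=
      HasFDerivAt.comp 0 (by rwa [h0]) hK
    refine h1.unique ((hasFDerivAt_id (0 : E)).congr_of_eventuallyEq ?_)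
    filter_upwards [hb] with z hz using hl z hz
  have hcomp' : (fderiv ℂ K 0).comp (fderiv ℂ K' 0) = ContinuousLinearMap.id ℂ E := by
    have h1 : HasFDerivAt (K ∘ K') ((fderiv ℂ K 0).comp (fderiv ℂ K' 0)) 0 :=
      HasFDerivAt.comp 0 (by rwa [h0']) hK'
    refine h1.unique ((hasFDerivAt_id (0 : E)).congr_of_eventuallyEq ?_)
    filter_upwards [hb] with z hz using hr z hz
  have hn : ‖fderiv ℂ K' 0‖ ≤ 1 := Complex.norm_fderiv_le_one_of_mapsTo_ball hd'
    (by rw [h0']; exact hm'.mono_right ball_subset_closedBall) one_pos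
  refine ⟨fderiv ℂ K 0, fun z hz => ?_⟩
  have h2 := eq_self_of_hasFDerivAt_id (F := fun z => fderiv ℂ K' 0 (K z))
    ((fderiv ℂ K' 0).differentiable.comp_differentiableOn hd) (fun w hw => ?_)
    (by simp [h0]) (by rw [← hcomp]; exact (fderiv ℂ K' 0).hasFDerivAt.comp 0 hK) hz
  · have h3 := congrArg (fun A : E →L[ℂ] E => A (K z)) hcomp'
    simp only [ContinuousLinearMap.comp_apply, ContinuousLinearMap.id_apply] at h3
    rw [← h3, h2]
  · rw [mem_ball_zero_iff]
    exact ((fderiv ℂ K' 0).le_of_opNorm_le hn _).trans_lt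
      (by rw [one_mul]; exact mem_ball_zero_iff.1 (hm hw))

end Cartan

end TypeII

namespace TypeII

section Isotropy

open Metric

variable {n n' : ℕ}

/-- The antisymmetric matrices. -/
def antisymmSubmodule (n : ℕ) : Submodule ℂ (Matrix (Fin n) (Fin n) ℂ) :=
  LinearMap.ker ((transposeLinearEquiv (Fin n) (Fin n) ℂ ℂ).toLinearMap + LinearMap.id)

/-- The antisymmetric matrices, to be equipped with the operator norm. -/
def AntisymmMatrix (n : ℕ) : Type := antisymmSubmodule n

namespace AntisymmMatrix

instance : AddCommGroup (AntisymmMatrix n) := inferInstanceAs (AddCommGroup (antisymmSubmodule n))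

instance : Module ℂ (AntisymmMatrix n) := inferInstanceAs (Module ℂ (antisymmSubmodule n))

instance : FiniteDimensional ℂ (AntisymmMatrix n) :=
  inferInstanceAs (FiniteDimensional ℂ (antisymmSubmodule n))

/-- The underlying matrix, as a linear map. -/
def valLinear (n : ℕ) : AntisymmMatrix n →ₗ[ℂ] Matrix (Fin n) (Fin n) ℂ :=
  (antisymmSubmodule n).subtype

lemma valLinear_injective : Function.Injective (valLinear n) := Subtype.val_injective

lemma toOp_injective (n : ℕ) : Function.Injective (toOp (Fin n)) := fun _ _ h =>
  (Matrix.toEuclideanCLM (𝕜 := ℂ) (n := Fin n)).injective h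

instance : NormedAddCommGroup (AntisymmMatrix n) :=
  NormedAddCommGroup.induced (AntisymmMatrix n) _ ((toOp (Fin n)).toLinearMap ∘ₗ valLinear n)
    ((toOp_injective n).comp valLinear_injective)

instance : NormedSpace ℂ (AntisymmMatrix n) :=
  NormedSpace.induced ℂ _ _ ((toOp (Fin n)).toLinearMap ∘ₗ valLinear n)

/-- The underlying matrix. -/
def val (n : ℕ) : AntisymmMatrix n →L[ℂ] Matrix (Fin n) (Fin n) ℂ :=
  LinearMap.toContinuousLinearMap (valLinear n)

lemma transpose_val (x : AntisymmMatrix n) : (val n x)ᵀ = -val n x :=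
  eq_neg_of_add_eq_zero_left (show (_)ᵀ + _ = 0 from Subtype.property x)

lemma opn_val (x : AntisymmMatrix n) : opn (val n x) = ‖x‖ := rfl

lemma val_mem {x : AntisymmMatrix n} :
    val n x ∈ OmegaII n ↔ x ∈ ball (0 : AntisymmMatrix n) 1 := by
  rw [mem_OmegaII_iff, opn_val, mem_ball_zero_iff]
  exact and_iff_right (transpose_val x)

/-- The antisymmetric part of a matrix. -/
def part (n : ℕ) : Matrix (Fin n) (Fin n) ℂ →L[ℂ] AntisymmMatrix n :=
  LinearMap.toContinuousLinearMap <| LinearMap.codRestrict (antisymmSubmodule n)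
    ((1 / 2 : ℂ) • (LinearMap.id - (transposeLinearEquiv (Fin n) (Fin n) ℂ ℂ).toLinearMap))
    fun Z => by simp [antisymmSubmodule, LinearMap.mem_ker, smul_sub]

lemma val_part {Z : Matrix (Fin n) (Fin n) ℂ} (hZ : Zᵀ = -Z) : val n (part n Z) = Z := by
  change (1 / 2 : ℂ) • (Z - Zᵀ) = Z
  rw [hZ]
  module

lemma part_val (x : AntisymmMatrix n) : part n (val n x) = x :=
  valLinear_injective (val_part (transpose_val x))

lemma part_mem {Z : Matrix (Fin n) (Fin n) ℂ} (hZ : Z ∈ OmegaII n) :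
    part n Z ∈ ball (0 : AntisymmMatrix n) 1 := by
  rwa [← val_mem, val_part (mem_OmegaII_iff.1 hZ).1]

end AntisymmMatrix

open AntisymmMatrix in
/-- An automorphism fixing the origin is linear, and so is its inverse. -/
lemma exists_linear_of_fixes_zero {k k' : Matrix (Fin n) (Fin n) ℂ → Matrix (Fin n) (Fin n) ℂ}
    (hm : Set.MapsTo k (OmegaII n) (OmegaII n)) (hd : DifferentiableOn ℂ k (OmegaII n))
    (hm' : Set.MapsTo k' (OmegaII n) (OmegaII n)) (hd' : DifferentiableOn ℂ k' (OmegaII n))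
    (hl : ∀ z ∈ OmegaII n, k' (k z) = z) (hr : ∀ z ∈ OmegaII n, k (k' z) = z) (h0 : k 0 = 0) :
    ∃ L : Matrix (Fin n) (Fin n) ℂ →L[ℂ] Matrix (Fin n) (Fin n) ℂ,
      ∀ z ∈ OmegaII n, k z = L z := by
  have key : ∀ {k : Matrix (Fin n) (Fin n) ℂ → Matrix (Fin n) (Fin n) ℂ},
      Set.MapsTo k (OmegaII n) (OmegaII n) → DifferentiableOn ℂ k (OmegaII n) →
      Set.MapsTo (fun x => part n (k (val n x)))
        (ball (0 : AntisymmMatrix n) 1) (ball 0 1) ∧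
      DifferentiableOn ℂ (fun x => part n (k (val n x)))
        (ball (0 : AntisymmMatrix n) 1) :=
    fun hm hd => ⟨fun x hx => part_mem (hm (val_mem.2 hx)),
      (part n).differentiable.comp_differentiableOn
        (hd.comp (val n).differentiable.differentiableOn
          fun x hx => val_mem.2 hx)⟩
  have key' : ∀ {z : Matrix (Fin n) (Fin n) ℂ}, z ∈ OmegaII n →
      val n (part n z) = z :=
    fun hz => val_part (mem_OmegaII_iff.1 hz).1
  obtain ⟨L, hL⟩ := exists_linear_of_ball (E := AntisymmMatrix n) (key hm hd).2 (key hm hd).1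
    (by simp [h0])
    (key hm' hd').2 (key hm' hd').1
    (fun x hx => by
      have hx' := val_mem.2 hx
      simp only [key' (hm hx'), hl _ hx', part_val])
    (fun x hx => by
      have hx' := val_mem.2 hx
      simp only [key' (hm' hx'), hr _ hx', part_val])
  refine ⟨(val n).comp (L.comp (part n)), fun z hz => ?_⟩
  have h1 := congrArg (val n) (hL _ (part_mem hz))
  simp only [key' hz, key' (hm hz)] at h1
  exact h1

lemma IsAutomorphismOf.comp {E : Type*} [NormedAddCommGroup E] [NormedSpace ℂ E] {Ω : Set E}
    {τ σ : E → E} (hτ : IsAutomorphismOf Ω τ) (hσ : IsAutomorphismOf Ω σ) :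
    IsAutomorphismOf Ω (τ ∘ σ) := by
  obtain ⟨hm, hd, τ', hm', hd', hl, hr⟩ := hτ
  obtain ⟨hm₂, hd₂, σ', hm₂', hd₂', hl₂, hr₂⟩ := hσ
  exact ⟨hm.comp hm₂, hd.comp hd₂ hm₂, σ' ∘ τ', hm₂'.comp hm', hd₂'.comp hd' hm',
    fun z hz => by simp [hl _ (hm₂ hz), hl₂ z hz], fun z hz => by simp [hr₂ _ (hm' hz), hr z hz]⟩

lemma IsPolyMapII.linear_comp {f : Matrix (Fin n) (Fin n) ℂ → Matrix (Fin n') (Fin n') ℂ}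
    (hf : IsPolyMapII f) (L : Matrix (Fin n') (Fin n') ℂ →L[ℂ] Matrix (Fin n') (Fin n') ℂ) :
    IsPolyMapII fun Z => L (f Z) := by
  choose p hp using hf
  intro i j
  refine ⟨∑ a, ∑ b, MvPolynomial.C (L (Matrix.single a b 1) i j) * p a b, fun Z => ?_⟩
  change L (f Z) i j = _
  conv_lhs => rw [Matrix.matrix_eq_sum_single (f Z)]
  simp only [map_sum, Matrix.sum_apply, MvPolynomial.eval_mul, MvPolynomial.eval_C, ← hp]
  refine Finset.sum_congr rfl fun a _ => Finset.sum_congr rfl fun b _ => ?_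
  rw [show Matrix.single a b (f Z a b) = f Z a b • Matrix.single a b 1 by simp, map_smul,
    Matrix.smul_apply, smul_eq_mul, mul_comm]

lemma IsPolyMapII.comp_linear {f : Matrix (Fin n) (Fin n) ℂ → Matrix (Fin n') (Fin n') ℂ}
    (hf : IsPolyMapII f) (L : Matrix (Fin n) (Fin n) ℂ →L[ℂ] Matrix (Fin n) (Fin n) ℂ) :
    IsPolyMapII fun Z => f (L Z) := by
  have hL : IsPolyMapII L := IsPolyMapII.linear_comp (f := id)
    (fun i j => ⟨MvPolynomial.X (i, j), fun Z => by simp⟩) L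
  choose q hq using hL
  intro i j
  obtain ⟨p, hp⟩ := hf i j
  refine ⟨MvPolynomial.bind₁ (fun a => q a.1 a.2) p, fun Z => ?_⟩
  change f (L Z) i j = _
  rw [hp, ← MvPolynomial.coe_aeval_eq_eval, ← MvPolynomial.coe_aeval_eq_eval, RingHom.coe_coe,
    RingHom.coe_coe, MvPolynomial.aeval_bind₁]
  simp [hq]

end Isotropy

end TypeII

namespace TypeII

variable {n n' : ℕ}

/-- An equivalence of `f` and `g` can be corrected by automorphisms fixing the origin so that
the remaining automorphisms are generalized Möbius transformations. -/
lemma exists_isotropic_equivalence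
    {f g : Matrix (Fin n) (Fin n) ℂ → Matrix (Fin n') (Fin n') ℂ}
    (hfpoly : IsPolyMapII f) (hgpoly : IsPolyMapII g)
    (hfmaps : Set.MapsTo f (OmegaII n) (OmegaII n'))
    (hgmaps : Set.MapsTo g (OmegaII n) (OmegaII n'))
    (hf0 : f 0 = 0) (hg0 : g 0 = 0)
    {τ : Matrix (Fin n) (Fin n) ℂ → Matrix (Fin n) (Fin n) ℂ}
    {σ : Matrix (Fin n') (Fin n') ℂ → Matrix (Fin n') (Fin n') ℂ}
    (hτ : IsAutomorphismOf (OmegaII n) τ) (hσ : IsAutomorphismOf (OmegaII n') σ)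
    (hrel : ∀ Z ∈ OmegaII n, f Z = σ (g (τ Z))) :
    ∃ τ σ, IsAutomorphismOf (OmegaII n) τ ∧ IsAutomorphismOf (OmegaII n') σ ∧
      τ 0 = 0 ∧ σ 0 = 0 ∧ ∀ Z ∈ OmegaII n, f Z = σ (g (τ Z)) := by
  have h0 := zero_mem_OmegaII n
  have h0' := zero_mem_OmegaII n'
  obtain ⟨T, hT, hT0⟩ := exists_act_zero_eq (hτ.1 h0)
  obtain ⟨S, hS, hS0⟩ := exists_act_zero_eq (hgmaps (hτ.1 h0))
  have hk := IsAutomorphismOf.comp hT.inv.isAutomorphismOf hτ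
  have hl := IsAutomorphismOf.comp hσ hS.isAutomorphismOf
  have hk0 : (act T⁻¹ ∘ τ) 0 = 0 := by
    rw [Function.comp_apply, ← hT0, hT.act_inv_act (mem_OmegaII_iff.1 h0).2]
  have hl0 : (σ ∘ act S) 0 = 0 := by
    rw [Function.comp_apply, hS0, ← hrel 0 h0, hf0]
  have hTk : ∀ z ∈ OmegaII n, act T ((act T⁻¹ ∘ τ) z) = τ z := fun z hz =>
    hT.act_act_inv (mem_OmegaII_iff.1 (hτ.1 hz)).2
  obtain ⟨hkm, hkd, k', hkm', hkd', hkl, hkr⟩ := id hk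
  obtain ⟨hlm, hld, l', hlm', hld', hll, hlr⟩ := id hl
  have hlS : ∀ z ∈ OmegaII n', l' (σ z) = act S⁻¹ z := fun z hz => by
    have := hll _ (hS.inv.mapsTo hz)
    rwa [Function.comp_apply, hS.act_act_inv (mem_OmegaII_iff.1 hz).2] at this
  have hk0' : k' 0 = 0 := by simpa only [hk0] using hkl 0 h0
  have hl0' : l' 0 = 0 := by simpa only [hl0] using hll 0 h0'
  obtain ⟨K, hK⟩ := exists_linear_of_fixes_zero hkm' hkd' hkm hkd hkr hkl hk0'
  obtain ⟨L, hL⟩ := exists_linear_of_fixes_zero hlm' hld' hlm hld hlr hll hl0'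
  have hFeq : ∀ z ∈ OmegaII n, L (f (K z)) = l' (f (k' z)) := fun z hz => by
    rw [← hK z hz, hL _ (hfmaps (hkm' hz))]
  have hI : Intertwined (fun Z => L (f (K Z))) g T S⁻¹ :=
    { polyf := IsPolyMapII.comp_linear (IsPolyMapII.linear_comp hfpoly L) K
      polyg := hgpoly
      mapsf := fun z hz => by
        simp only [hFeq z hz]
        exact hlm' (hfmaps (hkm' hz))
      mapsg := hgmaps
      zerof := by simp [hf0]
      zerog := hg0
      inT := hT
      inS := hS.inv
      rel := fun z hz => by
        rw [hFeq z hz, hrel _ (hkm' hz), hlS _ (hgmaps (hτ.1 (hkm' hz))), ← hTk _ (hkm' hz),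
          hkr z hz] }
  obtain ⟨T', S', hI', hT', hS'⟩ := hI.exists_isotropy
  refine ⟨act T' ∘ act T⁻¹ ∘ τ, (σ ∘ act S) ∘ act S',
    IsAutomorphismOf.comp hI'.inT.isAutomorphismOf hk,
    IsAutomorphismOf.comp hl hI'.inS.isAutomorphismOf, ?_, ?_, fun z hz => ?_⟩
  · rw [Function.comp_apply, hk0, hT']
  · rw [Function.comp_apply, hS', hl0]
  · have h1 := hI'.rel _ (hkm hz)
    simp only [hFeq _ (hkm hz), hkl z hz] at h1
    rw [← hlr _ (hfmaps hz), h1]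
    rfl

end TypeII

/-- Theorem 1.1, type II case. -/
theorem equivalent_iff_isotropically_equivalent_typeII
    (n n' : ℕ) (hn : 2 ≤ n) (hn' : 2 ≤ n')
    (f g : Matrix (Fin n) (Fin n) ℂ → Matrix (Fin n') (Fin n') ℂ)
    (hfpoly : IsPolyMapII f) (hgpoly : IsPolyMapII g)
    (hfmaps : Set.MapsTo f (OmegaII n) (OmegaII n'))
    (hgmaps : Set.MapsTo g (OmegaII n) (OmegaII n'))
    (hfproper : IsProperOn f (OmegaII n) (OmegaII n'))
    (hgproper : IsProperOn g (OmegaII n) (OmegaII n'))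
    (hf0 : f 0 = 0) (hg0 : g 0 = 0) :
    (∃ τ σ, IsAutomorphismOf (OmegaII n) τ ∧ IsAutomorphismOf (OmegaII n') σ ∧
        ∀ Z ∈ OmegaII n, f Z = σ (g (τ Z))) ↔
      (∃ τ σ, IsAutomorphismOf (OmegaII n) τ ∧ IsAutomorphismOf (OmegaII n') σ ∧
        τ 0 = 0 ∧ σ 0 = 0 ∧ ∀ Z ∈ OmegaII n, f Z = σ (g (τ Z))) := by
  refine ⟨?_, fun ⟨τ, σ, hτ, hσ, _, _, h⟩ => ⟨τ, σ, hτ, hσ, h⟩⟩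
  rintro ⟨τ, σ, hτ, hσ, hrel⟩
  exact TypeII.exists_isotropic_equivalence hfpoly hgpoly hfmaps hgmaps hf0 hg0 hτ hσ hrel
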